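/- Comparison principle for the obstacle problem for switching systems: under Assumption (A), fix ε ∈ (0,1), controls α_1,…,α_J ∈ A with J ≥ 2 and a switching cost c > 0. If U = (U_1,…,U_J) is a bounded viscosity subsolution of the switching system and V = (V_1,…,V_J) is a bounded viscosity supersolution of the switching system with U_j(0,x) ≤ V_j(0,x) for all j ∈ {1,…,J} and all x ∈ ℝ^d, then U_j(t,x) ≤ V_j(t,x) for all j ∈ {1,…,J} and all (t,x) ∈ [0,T]×ℝ^d. -/

import Mathlib

open MeasureTheory Set Filter Topology Metric
open scoped RealInnerProductSpace Matrix

attribute [local instance] Matrix.normedAddCommGroup Matrix.normedSpace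

noncomputable section

abbrev Vec (d : ℕ) := EuclideanSpace ℝ (Fin d)

structure C12 (d : ℕ) where
  toFun : ℝ → Vec d → ℝ
  dt : ℝ → Vec d → ℝ
  grad : ℝ → Vec d → Vec d
  hess : ℝ → Vec d → Matrix (Fin d) (Fin d) ℝ
  hasDt : ∀ t x, HasDerivAt (fun s => toFun s x) (dt t x) t
  hasGrad : ∀ t x, HasGradientAt (toFun t) (grad t x) x
  hasHess : ∀ t x, HasFDerivAt (grad t)
      ((Matrix.toEuclideanLin (hess t x)).toContinuousLinearMap) x
  cont : Continuous fun p : ℝ × Vec d => toFun p.1 p.2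
  cont_dt : Continuous fun p : ℝ × Vec d => dt p.1 p.2
  cont_grad : Continuous fun p : ℝ × Vec d => grad p.1 p.2
  cont_hess : Continuous fun p : ℝ × Vec d => hess p.1 p.2

def mvE {d : ℕ} (M : Matrix (Fin d) (Fin d) ℝ) (v : Vec d) : Vec d :=
  (EuclideanSpace.equiv (Fin d) ℝ).symm (M.mulVec ((EuclideanSpace.equiv (Fin d) ℝ) v))

variable {n d m : ℕ}

/-- Assumption (A) of the paper. -/
structure AssumptionA (ν : Measure (Vec n)) (A : Set (Vec m)) (T : ℝ)
    (b : Vec m → Vec d → Vec d) (σ : Vec m → Vec d → Matrix (Fin d) (Fin d) ℝ)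
    (η : Vec m → Vec d → Vec n → Vec d) (γ : Vec d → Vec n → ℝ)
    (f : Vec m → ℝ → Vec d → ℝ → Vec d → ℝ → ℝ)
    (ζ : ℝ → Vec d → ℝ) (g : Vec d → ℝ) (C : ℝ) : Prop where
  hC : 0 < C
  hT : 0 < T
  hAcpt : IsCompact A
  hAne : A.Nonempty
  hν_sf : SigmaFinite ν
  hν_zero : ν {0} = 0
  hν_int : Integrable (fun e => min 1 (‖e‖ ^ 2)) ν
  hη_meas : ∀ α x, Measurable (η α x)
  hγ_meas : ∀ x, Measurable (γ x)
  hb : ∀ α ∈ A, ∀ α' ∈ A, ∀ x x' : Vec d,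
      ‖b α x - b α' x'‖ + ‖σ α x - σ α' x'‖ ≤ C * (‖x - x'‖ + ‖α - α'‖)
  hη_lip : ∀ α ∈ A, ∀ α' ∈ A, ∀ (x x' : Vec d) (e : Vec n),
      ‖η α x e - η α' x' e‖ ≤ C * (‖x - x'‖ + ‖α - α'‖) * min 1 ‖e‖
  hη_bdd : ∀ α ∈ A, ∀ (x : Vec d) (e : Vec n), ‖η α x e‖ ≤ C * min 1 ‖e‖
  hγ_lip : ∀ (x x' : Vec d) (e : Vec n),
      |γ x e - γ x' e| ≤ C * ‖x - x'‖ * min 1 (‖e‖ ^ 2)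
  hγ_nonneg : ∀ x e, 0 ≤ γ x e
  hγ_bdd : ∀ (x : Vec d) (e : Vec n), γ x e ≤ C * min 1 ‖e‖
  hf_t_cont : ∀ α x u p k, Continuous fun t => f α t x u p k
  hf_bdd : ∀ α ∈ A, ∀ t ∈ Icc (0:ℝ) T, ∀ x : Vec d, |f α t x 0 0 0| ≤ C
  hf_mono : ∀ α ∈ A, ∀ t ∈ Icc (0:ℝ) T, ∀ (x : Vec d) (p : Vec d) (k u v : ℝ),
      v ≤ u → C * (u - v) ≤ f α t x v p k - f α t x u p k
  hf_k_mono : ∀ α ∈ A, ∀ t ∈ Icc (0:ℝ) T, ∀ (x : Vec d) (u : ℝ) (p : Vec d),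
      Monotone fun k => f α t x u p k
  hf_lip : ∀ α ∈ A, ∀ α' ∈ A, ∀ t ∈ Icc (0:ℝ) T, ∀ (x : Vec d) (u v : ℝ) (p q : Vec d) (k k' : ℝ),
      |f α t x u p k - f α' t x v q k'| ≤ C * (‖α - α'‖ + |u - v| + ‖p - q‖ + |k - k'|)
  hf_x : ∀ R > (0:ℝ), ∃ mR : ℝ → ℝ, Continuous mR ∧ mR 0 = 0 ∧ (∀ r, 0 ≤ mR r) ∧
      ∀ α ∈ A, ∀ t ∈ Icc (0:ℝ) T, ∀ (x x' : Vec d) (u : ℝ) (p : Vec d) (k : ℝ),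
        ‖x‖ ≤ R → ‖x'‖ ≤ R → |u| ≤ R →
        |f α t x u p k - f α t x' u p k| ≤ mR (‖x - x'‖ * (1 + ‖p‖))
  hζ_t_cont : ∀ x, Continuous fun t => ζ t x
  hζg_lip : ∀ (t : ℝ) (x x' : Vec d), |g x - g x'| + |ζ t x - ζ t x'| ≤ C * ‖x - x'‖
  hζg_bdd : ∀ (t : ℝ) (x : Vec d), |g x| + |ζ t x| ≤ C
  hgζ : ∀ x, ζ 0 x ≤ g x

/-- The nonlocal operator `K^α`. -/
def Kop (ν : Measure (Vec n)) (η : Vec m → Vec d → Vec n → Vec d)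
    (φ : C12 d) (α : Vec m) (t : ℝ) (x : Vec d) : ℝ :=
  ∫ e, (φ.toFun t (x + η α x e) - φ.toFun t x - ⟪η α x e, φ.grad t x⟫) ∂ν

/-- The nonlocal operator `B^α`. -/
def Bop (ν : Measure (Vec n)) (η : Vec m → Vec d → Vec n → Vec d) (γ : Vec d → Vec n → ℝ)
    (φ : C12 d) (α : Vec m) (t : ℝ) (x : Vec d) : ℝ :=
  ∫ e, (φ.toFun t (x + η α x e) - φ.toFun t x) * γ x e ∂ν

/-- The local operator `A^α`. -/
def Aop (b : Vec m → Vec d → Vec d) (σ : Vec m → Vec d → Matrix (Fin d) (Fin d) ℝ)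
    (φ : C12 d) (α : Vec m) (t : ℝ) (x : Vec d) : ℝ :=
  (1/2) * Matrix.trace (σ α x * (σ α x)ᵀ * φ.hess t x) + ⟪b α x, φ.grad t x⟫

/-- `L^α = A^α + K^α`. -/
def Lop (ν : Measure (Vec n)) (b : Vec m → Vec d → Vec d)
    (σ : Vec m → Vec d → Matrix (Fin d) (Fin d) ℝ) (η : Vec m → Vec d → Vec n → Vec d)
    (φ : C12 d) (α : Vec m) (t : ℝ) (x : Vec d) : ℝ :=
  Aop b σ φ α t x + Kop ν η φ α t x

/-- Modified diffusion matrix `σ̃`. -/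
def sigmaTilde (ν : Measure (Vec n)) (σ : Vec m → Vec d → Matrix (Fin d) (Fin d) ℝ)
    (η : Vec m → Vec d → Vec n → Vec d) (ε : ℝ) (α : Vec m) (x : Vec d) :
    Matrix (Fin d) (Fin d) ℝ :=
  Matrix.of fun i j =>
    if i = j then
      Real.sqrt ((σ α x i i) ^ 2 + ∫ e in {e : Vec n | ‖e‖ < ε}, (η α x e i) ^ 2 ∂ν)
    else σ α x i j

/-- Truncated `K_ε^α`. -/
def Ktr (ν : Measure (Vec n)) (η : Vec m → Vec d → Vec n → Vec d) (ε : ℝ)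
    (φ : C12 d) (α : Vec m) (t : ℝ) (x : Vec d) : ℝ :=
  Kop (ν.restrict {e : Vec n | ε < ‖e‖}) η φ α t x

/-- Truncated `B_ε^α`. -/
def Btr (ν : Measure (Vec n)) (η : Vec m → Vec d → Vec n → Vec d) (γ : Vec d → Vec n → ℝ)
    (ε : ℝ) (φ : C12 d) (α : Vec m) (t : ℝ) (x : Vec d) : ℝ :=
  Bop (ν.restrict {e : Vec n | ε < ‖e‖}) η γ φ α t x

/-- Truncated `L_ε^α`. -/
def Ltr (ν : Measure (Vec n)) (b : Vec m → Vec d → Vec d)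
    (σ : Vec m → Vec d → Matrix (Fin d) (Fin d) ℝ) (η : Vec m → Vec d → Vec n → Vec d)
    (ε : ℝ) (φ : C12 d) (α : Vec m) (t : ℝ) (x : Vec d) : ℝ :=
  (1/2) * Matrix.trace (sigmaTilde ν σ η ε α x * (sigmaTilde ν σ η ε α x)ᵀ * φ.hess t x)
    + ⟪b α x, φ.grad t x⟫ + Ktr ν η ε φ α t x

/-- Viscosity subsolution of the HJBVI
`min{ u − ζ, ∂ₜu + inf_{α∈A}( −L^α u − f(α,t,x,u,σᵀDu,B^α u) ) } = 0`. -/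
def SubsolnHJBVI (ν : Measure (Vec n)) (A : Set (Vec m)) (T : ℝ)
    (b : Vec m → Vec d → Vec d) (σ : Vec m → Vec d → Matrix (Fin d) (Fin d) ℝ)
    (η : Vec m → Vec d → Vec n → Vec d) (γ : Vec d → Vec n → ℝ)
    (f : Vec m → ℝ → Vec d → ℝ → Vec d → ℝ → ℝ) (ζ : ℝ → Vec d → ℝ)
    (u : ℝ → Vec d → ℝ) : Prop :=
  ∀ (φ : C12 d) (t₀ : ℝ) (x₀ : Vec d), t₀ ∈ Ioc (0:ℝ) T →
    (∀ t ∈ Icc (0:ℝ) T, ∀ x, u t x - φ.toFun t x ≤ u t₀ x₀ - φ.toFun t₀ x₀) →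
    min (u t₀ x₀ - ζ t₀ x₀)
      (φ.dt t₀ x₀ + ⨅ α : A, (-(Lop ν b σ η φ (↑α) t₀ x₀)
        - f (↑α) t₀ x₀ (u t₀ x₀) (mvE ((σ (↑α) x₀)ᵀ) (φ.grad t₀ x₀))
            (Bop ν η γ φ (↑α) t₀ x₀))) ≤ 0

/-- Viscosity supersolution of the HJBVI. -/
def SupersolnHJBVI (ν : Measure (Vec n)) (A : Set (Vec m)) (T : ℝ)
    (b : Vec m → Vec d → Vec d) (σ : Vec m → Vec d → Matrix (Fin d) (Fin d) ℝ)
    (η : Vec m → Vec d → Vec n → Vec d) (γ : Vec d → Vec n → ℝ)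
    (f : Vec m → ℝ → Vec d → ℝ → Vec d → ℝ → ℝ) (ζ : ℝ → Vec d → ℝ)
    (u : ℝ → Vec d → ℝ) : Prop :=
  ∀ (φ : C12 d) (t₀ : ℝ) (x₀ : Vec d), t₀ ∈ Ioc (0:ℝ) T →
    (∀ t ∈ Icc (0:ℝ) T, ∀ x, u t₀ x₀ - φ.toFun t₀ x₀ ≤ u t x - φ.toFun t x) →
    0 ≤ min (u t₀ x₀ - ζ t₀ x₀)
      (φ.dt t₀ x₀ + ⨅ α : A, (-(Lop ν b σ η φ (↑α) t₀ x₀)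
        - f (↑α) t₀ x₀ (u t₀ x₀) (mvE ((σ (↑α) x₀)ᵀ) (φ.grad t₀ x₀))
            (Bop ν η γ φ (↑α) t₀ x₀)))

/-- Viscosity subsolution of the `A'`-HJBVI with `ε`-truncated operators. -/
def SubsolnHJBVIe (ν : Measure (Vec n)) (A' : Set (Vec m)) (T : ℝ)
    (b : Vec m → Vec d → Vec d) (σ : Vec m → Vec d → Matrix (Fin d) (Fin d) ℝ)
    (η : Vec m → Vec d → Vec n → Vec d) (γ : Vec d → Vec n → ℝ)
    (f : Vec m → ℝ → Vec d → ℝ → Vec d → ℝ → ℝ) (ζ : ℝ → Vec d → ℝ) (ε : ℝ)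
    (u : ℝ → Vec d → ℝ) : Prop :=
  ∀ (φ : C12 d) (t₀ : ℝ) (x₀ : Vec d), t₀ ∈ Ioc (0:ℝ) T →
    (∀ t ∈ Icc (0:ℝ) T, ∀ x, u t x - φ.toFun t x ≤ u t₀ x₀ - φ.toFun t₀ x₀) →
    min (u t₀ x₀ - ζ t₀ x₀)
      (φ.dt t₀ x₀ + ⨅ α : A', (-(Ltr ν b σ η ε φ (↑α) t₀ x₀)
        - f (↑α) t₀ x₀ (u t₀ x₀) (mvE ((sigmaTilde ν σ η ε (↑α) x₀)ᵀ) (φ.grad t₀ x₀))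
            (Btr ν η γ ε φ (↑α) t₀ x₀))) ≤ 0

/-- Viscosity supersolution of the `A'`-HJBVI with `ε`-truncated operators. -/
def SupersolnHJBVIe (ν : Measure (Vec n)) (A' : Set (Vec m)) (T : ℝ)
    (b : Vec m → Vec d → Vec d) (σ : Vec m → Vec d → Matrix (Fin d) (Fin d) ℝ)
    (η : Vec m → Vec d → Vec n → Vec d) (γ : Vec d → Vec n → ℝ)
    (f : Vec m → ℝ → Vec d → ℝ → Vec d → ℝ → ℝ) (ζ : ℝ → Vec d → ℝ) (ε : ℝ)
    (u : ℝ → Vec d → ℝ) : Prop :=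
  ∀ (φ : C12 d) (t₀ : ℝ) (x₀ : Vec d), t₀ ∈ Ioc (0:ℝ) T →
    (∀ t ∈ Icc (0:ℝ) T, ∀ x, u t₀ x₀ - φ.toFun t₀ x₀ ≤ u t x - φ.toFun t x) →
    0 ≤ min (u t₀ x₀ - ζ t₀ x₀)
      (φ.dt t₀ x₀ + ⨅ α : A', (-(Ltr ν b σ η ε φ (↑α) t₀ x₀)
        - f (↑α) t₀ x₀ (u t₀ x₀) (mvE ((sigmaTilde ν σ η ε (↑α) x₀)ᵀ) (φ.grad t₀ x₀))
            (Btr ν η γ ε φ (↑α) t₀ x₀)))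

/-- The switching obstacle `M_j U = max_{k ≠ j} (U_k − c)`. -/
def MaxSw {J : ℕ} (U : Fin J → ℝ → Vec d → ℝ) (c : ℝ) (j : Fin J) (t : ℝ) (x : Vec d) : ℝ :=
  ⨆ k : {k : Fin J // k ≠ j}, (U (↑k) t x - c)

/-- Viscosity subsolution of the switching system. -/
def SubsolnSwitch (ν : Measure (Vec n)) (T : ℝ)
    (b : Vec m → Vec d → Vec d) (σ : Vec m → Vec d → Matrix (Fin d) (Fin d) ℝ)
    (η : Vec m → Vec d → Vec n → Vec d) (γ : Vec d → Vec n → ℝ)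
    (f : Vec m → ℝ → Vec d → ℝ → Vec d → ℝ → ℝ) (ζ : ℝ → Vec d → ℝ) (ε : ℝ)
    {J : ℕ} (αs : Fin J → Vec m) (c : ℝ) (U : Fin J → ℝ → Vec d → ℝ) : Prop :=
  ∀ (j : Fin J) (φ : C12 d) (t₀ : ℝ) (x₀ : Vec d), t₀ ∈ Ioc (0:ℝ) T →
    (∀ t ∈ Icc (0:ℝ) T, ∀ x, U j t x - φ.toFun t x ≤ U j t₀ x₀ - φ.toFun t₀ x₀) →
    min (U j t₀ x₀ - ζ t₀ x₀)
      (min (φ.dt t₀ x₀ - Ltr ν b σ η ε φ (αs j) t₀ x₀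
          - f (αs j) t₀ x₀ (U j t₀ x₀)
              (mvE ((sigmaTilde ν σ η ε (αs j) x₀)ᵀ) (φ.grad t₀ x₀))
              (Btr ν η γ ε φ (αs j) t₀ x₀))
        (U j t₀ x₀ - MaxSw U c j t₀ x₀)) ≤ 0

/-- Viscosity supersolution of the switching system. -/
def SupersolnSwitch (ν : Measure (Vec n)) (T : ℝ)
    (b : Vec m → Vec d → Vec d) (σ : Vec m → Vec d → Matrix (Fin d) (Fin d) ℝ)
    (η : Vec m → Vec d → Vec n → Vec d) (γ : Vec d → Vec n → ℝ)
    (f : Vec m → ℝ → Vec d → ℝ → Vec d → ℝ → ℝ) (ζ : ℝ → Vec d → ℝ) (ε : ℝ)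
    {J : ℕ} (αs : Fin J → Vec m) (c : ℝ) (U : Fin J → ℝ → Vec d → ℝ) : Prop :=
  ∀ (j : Fin J) (φ : C12 d) (t₀ : ℝ) (x₀ : Vec d), t₀ ∈ Ioc (0:ℝ) T →
    (∀ t ∈ Icc (0:ℝ) T, ∀ x, U j t₀ x₀ - φ.toFun t₀ x₀ ≤ U j t x - φ.toFun t x) →
    0 ≤ min (U j t₀ x₀ - ζ t₀ x₀)
      (min (φ.dt t₀ x₀ - Ltr ν b σ η ε φ (αs j) t₀ x₀
          - f (αs j) t₀ x₀ (U j t₀ x₀)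
              (mvE ((sigmaTilde ν σ η ε (αs j) x₀)ᵀ) (φ.grad t₀ x₀))
              (Btr ν η γ ε φ (αs j) t₀ x₀))
        (U j t₀ x₀ - MaxSw U c j t₀ x₀))

/-- A function on the line with affinely bounded subgradients. -/
lemma sub_le_of_subgradient_le {φ ψ : ℝ → ℝ} {A B e : ℝ}
    (hsub : ∀ s s', φ s + ψ s * (s' - s) ≤ φ s')
    (hψ : ∀ s ∈ Icc (0 : ℝ) 1, ψ s ≤ A + B * s + e) :
    φ 1 - φ 0 ≤ A + B / 2 + e := by
  have key : ∀ n : ℕ, 0 < n → φ 1 - φ 0 ≤ A + e + B / 2 + B / 2 * (1 / (n : ℝ)) := by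
    intro n hn
    have hn' : (0 : ℝ) < n := by exact_mod_cast hn
    have step : ∀ k : ℕ, k ≤ n →
        φ (k / n) - φ 0 ≤ (A + e) * (k / n) + B * (k * (k + 1) / (2 * n ^ 2)) := by
      intro k
      induction k with
      | zero => intro _; simp
      | succ k ih =>
        intro hk
        have h1 := ih (by omega)
        have h2 := hsub ((k + 1 : ℕ) / n) (k / n)
        have hk' : ((k + 1 : ℕ) : ℝ) ≤ n := by exact_mod_cast hk
        have h3 := hψ ((k + 1 : ℕ) / n) ⟨by positivity, by rw [div_le_one hn']; exact hk'⟩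
        have h4 : (k : ℝ) / n - ((k + 1 : ℕ) : ℝ) / n = -(1 / n) := by push_cast; ring
        rw [h4] at h2
        have h5 : ψ ((k + 1 : ℕ) / n) * (1 / n) ≤ (A + B * ((k + 1 : ℕ) / n) + e) * (1 / n) :=
          mul_le_mul_of_nonneg_right h3 (by positivity)
        have h6 : (A + e) * (k / n) + B * (k * (k + 1) / (2 * n ^ 2))
            + (A + B * ((k + 1 : ℕ) / n) + e) * (1 / n)
            = (A + e) * ((k + 1 : ℕ) / n)
              + B * ((k + 1 : ℕ) * ((k + 1 : ℕ) + 1) / (2 * n ^ 2)) := by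
          push_cast; field_simp; ring
        linarith
    have := step n le_rfl
    rw [div_self hn'.ne'] at this
    have h7 : B * ((n : ℝ) * (n + 1) / (2 * n ^ 2)) = B / 2 + B / 2 * (1 / (n : ℝ)) := by
      field_simp
    rw [h7] at this
    linarith
  have hlim : Tendsto (fun n : ℕ => A + e + B / 2 + B / 2 * (1 / (n : ℝ))) atTop
      (𝓝 (A + e + B / 2 + B / 2 * 0)) :=
    (tendsto_one_div_atTop_nhds_zero_nat.const_mul _).const_add _
  have := ge_of_tendsto hlim (eventually_atTop.2 ⟨1, fun n hn => key n hn⟩)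
  linarith

lemma le_sub_of_le_subgradient {φ ψ : ℝ → ℝ} {A B e : ℝ}
    (hsub : ∀ s s', φ s + ψ s * (s' - s) ≤ φ s')
    (hψ : ∀ s ∈ Icc (0 : ℝ) 1, A + B * s - e ≤ ψ s) :
    A + B / 2 - e ≤ φ 1 - φ 0 := by
  have := sub_le_of_subgradient_le (φ := fun s => φ (1 - s)) (ψ := fun s => -ψ (1 - s))
    (A := -A - B) (B := B) (e := e)
    (fun s s' => by have := hsub (1 - s) (1 - s'); linarith)
    (fun s hs => by have := hψ (1 - s) ⟨by linarith [hs.2], by linarith [hs.1]⟩; linarith)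
  simp only [sub_self, sub_zero] at this
  linarith

lemma exists_notMem_image_of_lipschitz {E : Type*} [NormedAddCommGroup E] [InnerProductSpace ℝ E]
    [FiniteDimensional ℝ E] [MeasurableSpace E] [BorelSpace E] {K : NNReal} {N : E → E}
    (hN : LipschitzWith K N) {Z : Set E}
    (hZ : (Measure.hausdorffMeasure (Module.finrank ℝ E : ℝ) : Measure E) Z = 0)
    {ρ : ℝ} (hρ : 0 < ρ) : ∃ p : E, ‖p‖ < ρ ∧ p ∉ N '' Z := by
  by_contra! h
  have hsub : ball (0 : E) ρ ⊆ N '' Z := fun p hp => h p (by simpa using hp)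
  have h1 := hN.hausdorffMeasure_image_le (d := (Module.finrank ℝ E : ℝ)) (by positivity) Z
  rw [hZ, mul_zero] at h1
  have h2 : (Measure.hausdorffMeasure (Module.finrank ℝ E : ℝ) : Measure E) (ball 0 ρ) = 0 :=
    le_antisymm ((measure_mono hsub).trans h1) bot_le
  exact (measure_ball_pos _ (0 : E) hρ).ne' h2

/-- Touching a convex function from above by a paraboloid makes subgradients Lipschitz there. -/
lemma norm_subgradient_sub_le {E : Type*} [NormedAddCommGroup E] [InnerProductSpace ℝ E]
    {F : E → ℝ} {z z' q q' : E} {L : ℝ}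
    (hup : ∀ y, F y ≤ F z + ⟪q, y - z⟫ + L * ‖y - z‖ ^ 2)
    (hq : ∀ y, F z + ⟪q, y - z⟫ ≤ F y) (hq' : ∀ y, F z' + ⟪q', y - z'⟫ ≤ F y) :
    ‖q' - q‖ ≤ 4 * L * ‖z' - z‖ := by
  have main : ∀ y, ⟪q' - q, y - z'⟫ ≤ L * ‖y - z‖ ^ 2 := by
    intro y
    have h1 := hup y
    have h2 := hq' y
    have h3 := hq z'
    have h4 : ⟪q' - q, y - z'⟫ = ⟪q', y - z'⟫ - (⟪q, y - z⟫ - ⟪q, z' - z⟫) := by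
      rw [← inner_sub_right, inner_sub_left]; congr 2; abel
    linarith
  by_cases h0 : ‖q' - q‖ = 0
  · have hz := main z'
    have : 0 ≤ L * ‖z' - z‖ ^ 2 := by simpa using hz
    rw [h0]
    by_cases hz0 : ‖z' - z‖ = 0
    · simp [hz0]
    · have hp : 0 < ‖z' - z‖ := lt_of_le_of_ne (norm_nonneg _) (Ne.symm hz0)
      have : 0 ≤ L := by
        by_contra hL; push Not at hL
        have := mul_neg_of_neg_of_pos hL (pow_pos hp 2); linarith
      positivity
  · have hp : 0 < ‖q' - q‖ := lt_of_le_of_ne (norm_nonneg _) (Ne.symm h0)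
    set r := ‖z' - z‖ with hr
    by_cases hr0 : r = 0
    · have hzz : z' = z := by rw [hr] at hr0; exact sub_eq_zero.1 (norm_eq_zero.1 hr0)
      exfalso
      have : ∀ s > 0, ‖q' - q‖ ^ 2 ≤ L * s * ‖q' - q‖ ^ 2 := by
        intro s hs
        have := main (z' + s • (q' - q))
        rw [hzz, add_sub_cancel_left, inner_smul_right, real_inner_self_eq_norm_sq, norm_smul,
          Real.norm_eq_abs, abs_of_pos hs] at this
        have h : s * ‖q' - q‖ ^ 2 ≤ s * (L * s * ‖q' - q‖ ^ 2) := by linarith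
        exact le_of_mul_le_mul_left h hs
      have hL := this (1 / (2 * (|L| + 1))) (by positivity)
      have h1 : L * (1 / (2 * (|L| + 1))) ≤ 1 / 2 := by
        rw [mul_one_div, div_le_iff₀ (by positivity)]; linarith [le_abs_self L]
      nlinarith [pow_pos hp 2]
    · have hrp : 0 < r := lt_of_le_of_ne (norm_nonneg _) (Ne.symm hr0)
      have hL : 0 ≤ L := by
        have h1 := hup z'; have h2 := hq z'
        by_contra hL; push Not at hL
        have := mul_neg_of_neg_of_pos hL (pow_pos hrp 2)
        linarith
      set e : E := (r / ‖q' - q‖) • (q' - q) with he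
      have hne : ‖e‖ = r := by
        rw [he, norm_smul, Real.norm_eq_abs, abs_of_pos (by positivity)]; field_simp
      have h1 := main (z' + e)
      have h2 : ⟪q' - q, z' + e - z'⟫ = r * ‖q' - q‖ := by
        rw [add_sub_cancel_left, he, inner_smul_right, real_inner_self_eq_norm_sq]; field_simp
      have h3 : ‖z' + e - z‖ ≤ 2 * r := by
        calc ‖z' + e - z‖ = ‖(z' - z) + e‖ := by congr 1; abel
          _ ≤ ‖z' - z‖ + ‖e‖ := norm_add_le _ _
          _ = 2 * r := by rw [hne, ← hr]; ring
      have h4 : L * ‖z' + e - z‖ ^ 2 ≤ L * (2 * r) ^ 2 := by gcongr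
      have h5 : r * ‖q' - q‖ ≤ r * (4 * L * r) := by nlinarith
      exact le_of_mul_le_mul_left h5 hrp

lemma eq_zero_of_inner_le_sq {E : Type*} [NormedAddCommGroup E] [InnerProductSpace ℝ E]
    {v : E} {L : ℝ} (h : ∀ y, ⟪v, y⟫ ≤ L * ‖y‖ ^ 2) : v = 0 := by
  by_contra hv
  have hp : 0 < ‖v‖ := norm_pos_iff.2 hv
  set s : ℝ := 1 / (2 * (|L| + 1)) with hs
  have hs0 : 0 < s := by positivity
  have h1 := h (s • v)
  rw [inner_smul_right, real_inner_self_eq_norm_sq, norm_smul, Real.norm_eq_abs,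
    abs_of_pos hs0] at h1
  have h2 : s * ‖v‖ ^ 2 ≤ s * ((L * s) * ‖v‖ ^ 2) := by linarith
  have h3 := le_of_mul_le_mul_left h2 hs0
  have h4 : L * s ≤ 1 / 2 := by
    rw [hs, mul_one_div, div_le_iff₀ (by positivity)]; linarith [le_abs_self L]
  nlinarith [pow_pos hp 2]

/-- A perturbed maximum of a convex function minus a quadratic form is attained at a point where
the convex function has a second order expansion (Jensen's lemma and Alexandrov's theorem). -/
lemma exists_perturbed_max_of_convex {E : Type*} [NormedAddCommGroup E] [InnerProductSpace ℝ E]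
    [FiniteDimensional ℝ E] {F G : E → ℝ} {B : E →L[ℝ] E} {M c L : ℝ} (hc : 0 < c)
    (hsub : ∀ z, ∃ q, ‖q‖ ≤ M ∧ ∀ y, F z + ⟪q, y - z⟫ ≤ F y)
    (hG : ∀ z h, G (z + h) = G z + ⟪B z, h⟫ + G h)
    (hGl : ∀ h, c * ‖h‖ ^ 2 ≤ G h) (hGu : ∀ h, G h ≤ L * ‖h‖ ^ 2) {ρ : ℝ} (hρ : 0 < ρ) :
    ∃ (p z q : E) (R : E →L[ℝ] E), ‖p‖ < ρ ∧
      (∀ y, F y - G y + ⟪p, y⟫ ≤ F z - G z + ⟪p, z⟫) ∧ B z = q + p ∧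
      (∀ q', (∀ y, F z + ⟪q', y - z⟫ ≤ F y) → q' = q) ∧
      (∀ a a', ⟪R a, a'⟫ = ⟪a, R a'⟫) ∧
      ∀ e > 0, ∀ᶠ h in 𝓝 (0 : E),
        |F (z + h) - F z - ⟪q, h⟫ - 1 / 2 * ⟪R h, h⟫| ≤ e * ‖h‖ ^ 2 := by
  borelize E
  have hM : 0 ≤ M := by obtain ⟨q, hq, -⟩ := hsub 0; exact (norm_nonneg q).trans hq
  have hLip : ∀ y z, F y - F z ≤ M * ‖y - z‖ := by
    intro y z
    obtain ⟨q, hq, hq'⟩ := hsub y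
    have h1 := hq' z
    have h2 := abs_le.1 (abs_real_inner_le_norm q (z - y))
    have h3 : ‖q‖ * ‖z - y‖ ≤ M * ‖y - z‖ := by rw [norm_sub_rev z y]; gcongr
    linarith [h2.1]
  have hFcont : Continuous F := by
    have : LipschitzWith ⟨M, hM⟩ F := by
      apply LipschitzWith.of_dist_le_mul
      intro x y
      rw [Real.dist_eq, dist_eq_norm, abs_le]
      have h1 := hLip x y
      have h2 := hLip y x
      rw [norm_sub_rev] at h2
      constructor
      · change -(M * ‖x - y‖) ≤ _
        linarith
      · exact h1
    exact this.continuous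
  have hG0 : G 0 = 0 := by
    have := hG 0 0; simp at this; exact this
  have hGcont : Continuous G := by
    rw [continuous_iff_continuousAt]
    intro z
    have h1 : Tendsto G (𝓝 0) (𝓝 0) := by
      refine tendsto_of_tendsto_of_tendsto_of_le_of_le (g := fun h : E => c * ‖h‖ ^ 2)
        (h := fun h : E => L * ‖h‖ ^ 2) ?_ ?_ hGl hGu
      · have : Continuous fun h : E => c * ‖h‖ ^ 2 := by fun_prop
        simpa using this.tendsto 0
      · have : Continuous fun h : E => L * ‖h‖ ^ 2 := by fun_prop
        simpa using this.tendsto 0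
    have h2 : Tendsto (fun y => y - z) (𝓝 z) (𝓝 0) := by
      have : Continuous fun y : E => y - z := by fun_prop
      simpa using this.tendsto z
    have h3 : G = fun y => G z + ⟪B z, y - z⟫ + G (y - z) := by
      funext y; rw [← hG]; congr 1; abel
    have h4 : Tendsto (fun y => G z + ⟪B z, y - z⟫ + G (y - z)) (𝓝 z)
        (𝓝 (G z + ⟪B z, 0⟫ + 0)) :=
      ((tendsto_const_nhds.inner h2).const_add _).add (h1.comp h2)
    rw [ContinuousAt, show G z = G z + ⟪B z, (0 : E)⟫ + 0 by simp]
    rw [← h3] at h4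
    exact h4
  have hmax : ∀ p : E, ∃ z, ∀ y, F y - G y + ⟪p, y⟫ ≤ F z - G z + ⟪p, z⟫ := by
    intro p
    set r : ℝ := (M + ‖p‖) / c + 1 with hr
    have hr0 : 0 < r := by positivity
    obtain ⟨z, -, hz⟩ := (isCompact_closedBall (0 : E) r).exists_isMaxOn
      (f := fun y => F y - G y + ⟪p, y⟫) ⟨0, by simp [hr0.le]⟩ (by fun_prop)
    refine ⟨z, fun y => ?_⟩
    by_cases hy : ‖y‖ ≤ r
    · exact hz (by simpa using hy)
    · push Not at hy
      have h0 : F 0 - G 0 + ⟪p, (0 : E)⟫ ≤ F z - G z + ⟪p, z⟫ :=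
        hz (show (0 : E) ∈ closedBall (0 : E) r by simp [hr0.le])
      rw [hG0, inner_zero_right] at h0
      refine le_trans ?_ h0
      have h1 := hLip y 0
      have h2 := hGl y
      have h3 := (abs_le.1 (abs_real_inner_le_norm p y)).2
      rw [sub_zero] at h1
      have h4 : (M + ‖p‖) * ‖y‖ ≤ c * ‖y‖ ^ 2 := by
        have h5 : (M + ‖p‖) ≤ c * ‖y‖ := by
          have h6 : (M + ‖p‖) / c ≤ ‖y‖ := by linarith
          rw [div_le_iff₀ hc] at h6; linarith
        calc (M + ‖p‖) * ‖y‖ ≤ c * ‖y‖ * ‖y‖ := by gcongr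
          _ = _ := by ring
      linarith
  have hmono : ∀ z q z' q', (∀ y, F z + ⟪q, y - z⟫ ≤ F y) → (∀ y, F z' + ⟪q', y - z'⟫ ≤ F y) →
      ‖z - z'‖ ≤ ‖(z + q) - (z' + q')‖ := by
    intro z q z' q' h h'
    have h1 := h z'
    have h2 := h' z
    have h3 : 0 ≤ ⟪q - q', z - z'⟫ := by
      have : ⟪q - q', z - z'⟫ = -⟪q, z' - z⟫ - ⟪q', z - z'⟫ := by
        rw [inner_sub_left, ← inner_neg_right, neg_sub]
      linarith
    have h4 : ‖z - z'‖ ^ 2 ≤ ⟪(z + q) - (z' + q'), z - z'⟫ := by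
      rw [show (z + q) - (z' + q') = (z - z') + (q - q') by abel, inner_add_left,
        real_inner_self_eq_norm_sq]
      linarith
    have h5 := real_inner_le_norm ((z + q) - (z' + q')) (z - z')
    by_contra hlt
    push Not at hlt
    have : 0 < ‖z - z'‖ := (norm_nonneg _).trans_lt hlt
    nlinarith
  set D : Set E := {x | ∃ z q, (∀ y, F z + ⟪q, y - z⟫ ≤ F y) ∧ x = z + q} with hD
  obtain ⟨P0, hP0⟩ : ∃ P0 : E → E, ∀ z q, (∀ y, F z + ⟪q, y - z⟫ ≤ F y) → P0 (z + q) = z := by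
    classical
    refine ⟨fun x => if h : x ∈ D then h.choose else 0, fun z q h => ?_⟩
    have hx : z + q ∈ D := ⟨z, q, h, rfl⟩
    simp only [dif_pos hx]
    obtain ⟨q', hq', he⟩ := hx.choose_spec
    have := hmono _ _ _ _ h hq'
    rw [← he, sub_self, norm_zero] at this
    exact (sub_eq_zero.1 (norm_le_zero_iff.1 this)).symm
  have hP0L : LipschitzOnWith 1 P0 D := by
    apply LipschitzOnWith.of_dist_le_mul
    rintro x ⟨z, q, h, rfl⟩ x' ⟨z', q', h', rfl⟩
    rw [hP0 _ _ h, hP0 _ _ h', dist_eq_norm, dist_eq_norm]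
    simpa using hmono _ _ _ _ h h'
  obtain ⟨P, hPL, hPe⟩ := hP0L.extend_finite_dimension
  have hP : ∀ z q, (∀ y, F z + ⟪q, y - z⟫ ≤ F y) → P (z + q) = z := fun z q h => by
    rw [← hPe ⟨z, q, h, rfl⟩, hP0 _ _ h]
  set N : E → E := fun x => B (P x) + P x - x with hN
  have hNL : ∃ K, LipschitzWith K N :=
    ⟨_, ((B.lipschitz.comp hPL).add hPL).sub LipschitzWith.id⟩
  obtain ⟨K, hNL⟩ := hNL
  have hZ : (Measure.hausdorffMeasure (Module.finrank ℝ E : ℝ) : Measure E)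
      {x | ¬ DifferentiableAt ℝ P x} = 0 := by
    have := hPL.ae_differentiableAt
      (μ := (Measure.hausdorffMeasure (Module.finrank ℝ E : ℝ) : Measure E))
    rwa [ae_iff] at this
  obtain ⟨p, hpρ, hpN⟩ := exists_notMem_image_of_lipschitz hNL hZ hρ
  obtain ⟨z, hz⟩ := hmax p
  set q := B z - p with hq
  have hup : ∀ y, F y ≤ F z + ⟪q, y - z⟫ + G (y - z) := by
    intro y
    have h1 := hz y
    have h2 := hG z (y - z)
    rw [add_sub_cancel] at h2
    have h3 : ⟪q, y - z⟫ = ⟪B z, y - z⟫ - (⟪p, y⟫ - ⟪p, z⟫) := by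
      rw [hq, inner_sub_left, inner_sub_right p]
    linarith
  have huniq : ∀ q', (∀ y, F z + ⟪q', y - z⟫ ≤ F y) → q' = q := by
    intro q' hq'
    refine sub_eq_zero.1 (eq_zero_of_inner_le_sq (L := L) fun y => ?_)
    have h1 := hup (z + y)
    have h2 := hq' (z + y)
    rw [add_sub_cancel_left] at h1 h2
    have := hGu y
    rw [inner_sub_left]; linarith
  have hqs : ∀ y, F z + ⟪q, y - z⟫ ≤ F y := by
    obtain ⟨q', -, h⟩ := hsub z
    rwa [huniq q' h] at h
  have hup' : ∀ y, F y ≤ F z + ⟪q, y - z⟫ + L * ‖y - z‖ ^ 2 := fun y =>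
    (hup y).trans (by linarith [hGu (y - z)])
  have hL : 0 ≤ L ∨ Subsingleton E := by
    by_cases h : Subsingleton E
    · exact Or.inr h
    · left
      obtain ⟨v, hv⟩ : ∃ v : E, v ≠ 0 := by
        by_contra! hall
        exact h ⟨fun a b => by rw [hall a, hall b]⟩
      have h1 := (hGl v).trans (hGu v)
      have h2 : 0 < ‖v‖ := norm_pos_iff.2 hv
      exact hc.le.trans (le_of_mul_le_mul_right h1 (by positivity))
  set L' := max L 0 with hL'
  have hlip : ∀ z' q', (∀ y, F z' + ⟪q', y - z'⟫ ≤ F y) → ‖q' - q‖ ≤ 4 * L' * ‖z' - z‖ := by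
    intro z' q' h
    refine norm_subgradient_sub_le (fun y => (hup' y).trans ?_) hqs h
    have : L ≤ L' := le_max_left _ _
    gcongr
  have hPx : P (z + q) = z := hP _ _ hqs
  have hdiff : DifferentiableAt ℝ P (z + q) := by
    by_contra hnd
    refine hpN ⟨z + q, hnd, ?_⟩
    change B (P (z + q)) + P (z + q) - (z + q) = p
    rw [hPx]; simp only [hq]; abel
  choose Q hQM hQ using hsub
  set A := fderiv ℝ P (z + q) with hA
  set X : E → E := fun h => (z + h + Q (z + h)) - (z + q) with hX
  have hXb : ∀ h, ‖X h‖ ≤ (1 + 4 * L') * ‖h‖ := by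
    intro h
    have h1 := hlip (z + h) (Q (z + h)) (hQ _)
    rw [add_sub_cancel_left] at h1
    calc ‖X h‖ = ‖h + (Q (z + h) - q)‖ := by rw [hX]; congr 1; abel_nf
      _ ≤ ‖h‖ + ‖Q (z + h) - q‖ := norm_add_le _ _
      _ ≤ _ := by linarith
  have hL'0 : 0 ≤ L' := le_max_right _ _
  have hAX : ∀ e > 0, ∀ᶠ h in 𝓝 (0 : E), ‖h - A (X h)‖ ≤ e * ‖h‖ := by
    intro e he
    have h1 := (hdiff.hasFDerivAt.isLittleO).def (c := e / (1 + 4 * L')) (by positivity)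
    have hX0 : Tendsto (fun h => z + q + X h) (𝓝 0) (𝓝 (z + q)) := by
      have : Tendsto X (𝓝 0) (𝓝 0) := by
        refine squeeze_zero_norm hXb ?_
        have : Continuous fun h : E => (1 + 4 * L') * ‖h‖ := by fun_prop
        simpa using this.tendsto 0
      simpa using this.const_add (z + q)
    filter_upwards [hX0.eventually h1] with h hh
    have h2 : z + q + X h = z + h + Q (z + h) := by simp [hX]
    rw [add_sub_cancel_left, h2, hP _ _ (hQ _), hPx, add_sub_cancel_left] at hh
    refine hh.trans ?_
    calc e / (1 + 4 * L') * ‖X h‖ ≤ e / (1 + 4 * L') * ((1 + 4 * L') * ‖h‖) := by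
          gcongr; exact hXb h
      _ = e * ‖h‖ := by field_simp
  have hsurj : Function.Surjective A := by
    intro v
    have hcl : IsClosed (LinearMap.range (A : E →ₗ[ℝ] E) : Set E) :=
      Submodule.closed_of_finiteDimensional _
    change v ∈ (LinearMap.range (A : E →ₗ[ℝ] E) : Set E)
    rw [← hcl.closure_eq, Metric.mem_closure_iff]
    intro e he
    have h1 := hAX (e / (2 * (‖v‖ + 1))) (by positivity)
    have h2 : Tendsto (fun s : ℝ => s • v) (𝓝[>] 0) (𝓝 0) := by
      have : Continuous fun s : ℝ => s • v := by fun_prop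
      have := this.tendsto 0
      rw [zero_smul] at this
      exact this.mono_left nhdsWithin_le_nhds
    obtain ⟨s, hs, hs0⟩ := ((h2.eventually h1).and self_mem_nhdsWithin).exists
    have hs0 : (0 : ℝ) < s := hs0
    refine ⟨s⁻¹ • A (X (s • v)), ⟨s⁻¹ • X (s • v), by simp⟩, ?_⟩
    rw [dist_eq_norm]
    have h3 : v - s⁻¹ • A (X (s • v)) = s⁻¹ • (s • v - A (X (s • v))) := by
      rw [smul_sub, smul_smul, inv_mul_cancel₀ hs0.ne', one_smul]
    rw [h3, norm_smul, Real.norm_eq_abs, abs_of_pos (by positivity)]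
    rw [norm_smul, Real.norm_eq_abs, abs_of_pos hs0] at hs
    calc s⁻¹ * ‖s • v - A (X (s • v))‖
        ≤ s⁻¹ * (e / (2 * (‖v‖ + 1)) * (s * ‖v‖)) := by gcongr
      _ = e / 2 * (‖v‖ / (‖v‖ + 1)) := by field_simp
      _ ≤ e / 2 * 1 := by
          gcongr; rw [div_le_one (by positivity)]; linarith
      _ < e := by linarith
  have hinj : Function.Injective (A : E →ₗ[ℝ] E) := LinearMap.injective_iff_surjective.2 hsurj
  set Ae : E ≃ₗ[ℝ] E := LinearEquiv.ofBijective (A : E →ₗ[ℝ] E) ⟨hinj, hsurj⟩ with hAe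
  set Ai : E →L[ℝ] E := LinearMap.toContinuousLinearMap (Ae.symm : E →ₗ[ℝ] E) with hAi
  have hAiA : ∀ v, Ai (A v) = v := fun v => Ae.symm_apply_apply v
  set R0 : E →L[ℝ] E := Ai - ContinuousLinearMap.id ℝ E with hR0
  have hQexp : ∀ e > 0, ∀ᶠ h in 𝓝 (0 : E), ‖Q (z + h) - q - R0 h‖ ≤ e * ‖h‖ := by
    intro e he
    filter_upwards [hAX (e / (‖Ai‖ + 1)) (by positivity)] with h hh
    have h1 : Q (z + h) - q - R0 h = -(Ai (h - A (X h))) := by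
      rw [map_sub, hAiA]; simp only [hR0, hX]; simp; abel
    rw [h1, norm_neg]
    calc ‖Ai (h - A (X h))‖ ≤ ‖Ai‖ * ‖h - A (X h)‖ := Ai.le_opNorm _
      _ ≤ ‖Ai‖ * (e / (‖Ai‖ + 1) * ‖h‖) := by gcongr
      _ = e * ‖h‖ * (‖Ai‖ / (‖Ai‖ + 1)) := by ring
      _ ≤ e * ‖h‖ * 1 := by
          gcongr; rw [div_le_one (by positivity)]; linarith
      _ = _ := mul_one _
  set R : E →L[ℝ] E := (1 / 2 : ℝ) • (R0 + ContinuousLinearMap.adjoint R0) with hR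
  have hRR : ∀ h, ⟪R h, h⟫ = ⟪R0 h, h⟫ := by
    intro h
    simp only [hR, smul_apply, add_apply,
      inner_smul_left, inner_add_left, ContinuousLinearMap.adjoint_inner_left]
    rw [real_inner_comm]
    simp; ring
  refine ⟨p, z, q, R, hpρ, hz, by rw [hq]; abel, huniq, ?_, ?_⟩
  · intro a a'
    simp only [hR, smul_apply, add_apply,
      inner_smul_left, inner_smul_right, inner_add_left, inner_add_right,
      ContinuousLinearMap.adjoint_inner_left, ContinuousLinearMap.adjoint_inner_right]
    simp; ring
  · intro e he
    obtain ⟨r, hr, hball⟩ := Metric.eventually_nhds_iff_ball.1 (hQexp e he)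
    filter_upwards [Metric.ball_mem_nhds (0 : E) hr] with h hh
    have hh' : ‖h‖ < r := by simpa using hh
    have hb : ∀ s ∈ Icc (0 : ℝ) 1,
        |⟪Q (z + s • h), h⟫ - (⟪q, h⟫ + ⟪R h, h⟫ * s)| ≤ e * ‖h‖ ^ 2 := by
      intro s hs
      have h1 : ‖s • h‖ ≤ ‖h‖ := by
        rw [norm_smul, Real.norm_eq_abs, abs_of_nonneg hs.1]
        exact mul_le_of_le_one_left (norm_nonneg _) hs.2
      have h2 := hball (s • h) (by simpa using h1.trans_lt hh')
      have h3 : ⟪Q (z + s • h), h⟫ - (⟪q, h⟫ + ⟪R h, h⟫ * s)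
          = ⟪Q (z + s • h) - q - R0 (s • h), h⟫ := by
        rw [inner_sub_left (Q (z + s • h) - q) _ h, inner_sub_left (Q (z + s • h)) q h, map_smul,
          real_inner_smul_left, hRR]
        ring
      rw [h3]
      refine (abs_real_inner_le_norm _ _).trans ?_
      calc ‖Q (z + s • h) - q - R0 (s • h)‖ * ‖h‖ ≤ (e * ‖h‖) * ‖h‖ := by
            gcongr; exact h2.trans (by gcongr)
        _ = _ := by ring
    have hs : ∀ s s' : ℝ, F (z + s • h) + ⟪Q (z + s • h), h⟫ * (s' - s) ≤ F (z + s' • h) := by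
      intro s s'
      have := hQ (z + s • h) (z + s' • h)
      rw [show z + s' • h - (z + s • h) = (s' - s) • h by rw [sub_smul]; abel,
        inner_smul_right] at this
      linarith
    have u1 := sub_le_of_subgradient_le (A := ⟪q, h⟫) (B := ⟪R h, h⟫) (e := e * ‖h‖ ^ 2) hs
      (fun s hs => by linarith [(abs_le.1 (hb s hs)).2])
    have u2 := le_sub_of_le_subgradient (A := ⟪q, h⟫) (B := ⟪R h, h⟫) (e := e * ‖h‖ ^ 2) hs
      (fun s hs => by linarith [(abs_le.1 (hb s hs)).1])
    simp only [one_smul, zero_smul, add_zero] at u1 u2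
    rw [abs_le]
    exact ⟨by linarith, by linarith⟩

/-- Perturbed maximum for a separated sum of two convex functions minus a quadratic coupling. -/
lemma exists_perturbed_max_of_convex_pair {E : Type*} [NormedAddCommGroup E]
    [InnerProductSpace ℝ E] [FiniteDimensional ℝ E] {f₁ f₂ : E → ℝ} {M : ℝ}
    (h₁ : ∀ z, ∃ q, ‖q‖ ≤ M ∧ ∀ y, f₁ z + ⟪q, y - z⟫ ≤ f₁ y)
    (h₂ : ∀ z, ∃ q, ‖q‖ ≤ M ∧ ∀ y, f₂ z + ⟪q, y - z⟫ ≤ f₂ y) {ρ : ℝ} (hρ : 0 < ρ) :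
    ∃ (p₁ p₂ z₁ z₂ q₁ q₂ : E) (R₁ R₂ : E →L[ℝ] E), ‖p₁‖ < ρ ∧ ‖p₂‖ < ρ ∧
      (∀ y₁ y₂, f₁ y₁ + f₂ y₂ - (‖y₁ - y₂‖ ^ 2 + 2 * ‖y₁‖ ^ 2 + 2 * ‖y₂‖ ^ 2)
          + ⟪p₁, y₁⟫ + ⟪p₂, y₂⟫ ≤
        f₁ z₁ + f₂ z₂ - (‖z₁ - z₂‖ ^ 2 + 2 * ‖z₁‖ ^ 2 + 2 * ‖z₂‖ ^ 2) + ⟪p₁, z₁⟫ + ⟪p₂, z₂⟫) ∧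
      (2 : ℝ) • (z₁ - z₂) + (4 : ℝ) • z₁ = q₁ + p₁ ∧
      -((2 : ℝ) • (z₁ - z₂)) + (4 : ℝ) • z₂ = q₂ + p₂ ∧
      (∀ q, (∀ y, f₁ z₁ + ⟪q, y - z₁⟫ ≤ f₁ y) → q = q₁) ∧
      (∀ q, (∀ y, f₂ z₂ + ⟪q, y - z₂⟫ ≤ f₂ y) → q = q₂) ∧
      (∀ a a', ⟪R₁ a, a'⟫ = ⟪a, R₁ a'⟫) ∧ (∀ a a', ⟪R₂ a, a'⟫ = ⟪a, R₂ a'⟫) ∧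
      (∀ e > 0, ∀ᶠ h in 𝓝 (0 : E),
        |f₁ (z₁ + h) - f₁ z₁ - ⟪q₁, h⟫ - 1 / 2 * ⟪R₁ h, h⟫| ≤ e * ‖h‖ ^ 2) ∧
      (∀ e > 0, ∀ᶠ h in 𝓝 (0 : E),
        |f₂ (z₂ + h) - f₂ z₂ - ⟪q₂, h⟫ - 1 / 2 * ⟪R₂ h, h⟫| ≤ e * ‖h‖ ^ 2) := by
  let F : (WithLp 2 (E × E)) → ℝ := fun Z => f₁ Z.fst + f₂ Z.snd
  let G : (WithLp 2 (E × E)) → ℝ := fun Z => ‖Z.fst - Z.snd‖ ^ 2 + 2 * ‖Z.fst‖ ^ 2 + 2 * ‖Z.snd‖ ^ 2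
  let Bl : (WithLp 2 (E × E)) →ₗ[ℝ] (WithLp 2 (E × E)) :=
    { toFun := fun Z => WithLp.toLp 2 ((2 : ℝ) • (Z.fst - Z.snd) + (4 : ℝ) • Z.fst,
        -((2 : ℝ) • (Z.fst - Z.snd)) + (4 : ℝ) • Z.snd)
      map_add' := fun x y => by
        apply (WithLp.equiv 2 (E × E)).injective; apply Prod.ext <;> simp <;> module
      map_smul' := fun c x => by
        apply (WithLp.equiv 2 (E × E)).injective; apply Prod.ext <;> simp <;> module }
  let B : (WithLp 2 (E × E)) →L[ℝ] (WithLp 2 (E × E)) := LinearMap.toContinuousLinearMap Bl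
  have hB : ∀ Z, B Z = WithLp.toLp 2 ((2 : ℝ) • (Z.fst - Z.snd) + (4 : ℝ) • Z.fst,
        -((2 : ℝ) • (Z.fst - Z.snd)) + (4 : ℝ) • Z.snd) := fun Z => rfl
  have hn : ∀ Z : (WithLp 2 (E × E)), ‖Z‖ ^ 2 = ‖Z.fst‖ ^ 2 + ‖Z.snd‖ ^ 2 := fun Z =>
    WithLp.prod_norm_sq_eq_of_L2 Z
  have hin : ∀ Z W : (WithLp 2 (E × E)), ⟪Z, W⟫ = ⟪Z.fst, W.fst⟫ + ⟪Z.snd, W.snd⟫ := fun Z W =>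
    WithLp.prod_inner_apply Z W
  have hinl : ∀ (a b : E) (W : WithLp 2 (E × E)),
      ⟪(WithLp.toLp 2 (a, b) : WithLp 2 (E × E)), W⟫ = ⟪a, W.fst⟫ + ⟪b, W.snd⟫ :=
    fun a b W => hin _ W
  have hinr : ∀ (a b : E) (W : WithLp 2 (E × E)),
      ⟪W, (WithLp.toLp 2 (a, b) : WithLp 2 (E × E))⟫ = ⟪W.fst, a⟫ + ⟪W.snd, b⟫ :=
    fun a b W => hin W _
  have hG : ∀ Z H, G (Z + H) = G Z + ⟪B Z, H⟫ + G H := by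
    intro Z H
    simp only [G, hB, hinl, WithLp.add_fst, WithLp.add_snd]
    rw [show Z.fst + H.fst - (Z.snd + H.snd) = (Z.fst - Z.snd) + (H.fst - H.snd) by abel,
      norm_add_sq_real, norm_add_sq_real, norm_add_sq_real]
    simp only [inner_add_left, inner_sub_left, inner_sub_right, inner_neg_left,
      real_inner_smul_left]
    ring
  have hGl : ∀ H, 2 * ‖H‖ ^ 2 ≤ G H := by
    intro H
    rw [hn]; simp only [G]
    nlinarith [sq_nonneg ‖H.fst - H.snd‖]
  have hGu : ∀ H, G H ≤ 4 * ‖H‖ ^ 2 := by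
    intro H
    rw [hn]; simp only [G]
    have := norm_sub_le H.fst H.snd
    nlinarith [sq_nonneg (‖H.fst‖ - ‖H.snd‖), norm_nonneg (H.fst - H.snd)]
  have hsub : ∀ Z : (WithLp 2 (E × E)), ∃ Q : (WithLp 2 (E × E)),
      ‖Q‖ ≤ 2 * M ∧ ∀ Y, F Z + ⟪Q, Y - Z⟫ ≤ F Y := by
    intro Z
    obtain ⟨q1, b1, s1⟩ := h₁ Z.fst
    obtain ⟨q2, b2, s2⟩ := h₂ Z.snd
    refine ⟨WithLp.toLp 2 (q1, q2), ?_, fun Y => ?_⟩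
    · have hM : 0 ≤ M := (norm_nonneg _).trans b1
      refine abs_le_of_sq_le_sq' ?_ (by positivity) |>.2
      rw [hn]
      have e1 := pow_le_pow_left₀ (norm_nonneg q1) b1 2
      have e2 := pow_le_pow_left₀ (norm_nonneg q2) b2 2
      change ‖q1‖ ^ 2 + ‖q2‖ ^ 2 ≤ _
      nlinarith [sq_nonneg M]
    · have := s1 Y.fst
      have := s2 Y.snd
      simp only [F, hinl, WithLp.sub_fst, WithLp.sub_snd]
      linarith
  obtain ⟨p, z, q, R, hp, hmax, hBq, huni, hRs, hexp⟩ :=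
    exists_perturbed_max_of_convex (by norm_num : (0 : ℝ) < 2) hsub hG hGl hGu hρ
  let i₁ : E →L[ℝ] (WithLp 2 (E × E)) := LinearMap.toContinuousLinearMap
    { toFun := fun h => WithLp.toLp 2 (h, 0)
      map_add' := fun x y => by apply (WithLp.equiv 2 (E × E)).injective; apply Prod.ext <;> simp
      map_smul' := fun c x => by apply (WithLp.equiv 2 (E × E)).injective; apply Prod.ext <;> simp }
  let i₂ : E →L[ℝ] (WithLp 2 (E × E)) := LinearMap.toContinuousLinearMap
    { toFun := fun h => WithLp.toLp 2 (0, h)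
      map_add' := fun x y => by apply (WithLp.equiv 2 (E × E)).injective; apply Prod.ext <;> simp
      map_smul' := fun c x => by apply (WithLp.equiv 2 (E × E)).injective; apply Prod.ext <;> simp }
  have hi₁ : ∀ h, i₁ h = WithLp.toLp 2 (h, 0) := fun h => rfl
  have hi₂ : ∀ h, i₂ h = WithLp.toLp 2 (0, h) := fun h => rfl
  have hpn := hn p
  have hBq1 := congrArg WithLp.fst hBq
  have hBq2 := congrArg WithLp.snd hBq
  rw [hB] at hBq1 hBq2
  have hself : ∀ (i : E →L[ℝ] (WithLp 2 (E × E))) (a a' : E),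
      ⟪(ContinuousLinearMap.adjoint i ∘L R ∘L i) a, a'⟫
      = ⟪a, (ContinuousLinearMap.adjoint i ∘L R ∘L i) a'⟫ := by
    intro i a a'
    simp only [ContinuousLinearMap.comp_apply, ContinuousLinearMap.adjoint_inner_left,
      ContinuousLinearMap.adjoint_inner_right, hRs]
  refine ⟨p.fst, p.snd, z.fst, z.snd, q.fst, q.snd,
    ContinuousLinearMap.adjoint i₁ ∘L R ∘L i₁, ContinuousLinearMap.adjoint i₂ ∘L R ∘L i₂,
    ?_, ?_, ?_, hBq1, hBq2, ?_, ?_, hself i₁, hself i₂, ?_, ?_⟩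
  · refine lt_of_le_of_lt (abs_le_of_sq_le_sq' ?_ (norm_nonneg _)).2 hp
    nlinarith [sq_nonneg ‖p.snd‖]
  · refine lt_of_le_of_lt (abs_le_of_sq_le_sq' ?_ (norm_nonneg _)).2 hp
    nlinarith [sq_nonneg ‖p.fst‖]
  · intro y₁ y₂
    have := hmax (WithLp.toLp 2 (y₁, y₂))
    simp only [F, G] at this
    rw [hin p z, hinr] at this
    rw [add_assoc, add_assoc (f₁ z.fst + f₂ z.snd - _)]
    exact this
  · intro q' h
    obtain ⟨q2, -, s2⟩ := h₂ z.snd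
    have := huni (WithLp.toLp 2 (q', q2)) fun Y => by
      have := h Y.fst
      have := s2 Y.snd
      simp only [F, hinl, WithLp.sub_fst, WithLp.sub_snd]
      linarith
    exact congrArg WithLp.fst this
  · intro q' h
    obtain ⟨q2, -, s2⟩ := h₁ z.fst
    have := huni (WithLp.toLp 2 (q2, q')) fun Y => by
      have := h Y.snd
      have := s2 Y.fst
      simp only [F, hinl, WithLp.sub_fst, WithLp.sub_snd]
      linarith
    exact congrArg WithLp.snd this
  · intro e he
    have ht : Tendsto i₁ (𝓝 0) (𝓝 0) := by simpa using i₁.continuous.tendsto 0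
    filter_upwards [ht.eventually (hexp e he)] with h hh
    rw [hn] at hh
    simp only [F, hin, hi₁, WithLp.add_fst, WithLp.add_snd] at hh
    simp only [ContinuousLinearMap.comp_apply, ContinuousLinearMap.adjoint_inner_left, hin, hi₁]
    simpa using hh
  · intro e he
    have ht : Tendsto i₂ (𝓝 0) (𝓝 0) := by simpa using i₂.continuous.tendsto 0
    filter_upwards [ht.eventually (hexp e he)] with h hh
    rw [hn] at hh
    simp only [F, hin, hi₂, WithLp.add_fst, WithLp.add_snd] at hh
    simp only [ContinuousLinearMap.comp_apply, ContinuousLinearMap.adjoint_inner_left, hin, hi₂]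
    simpa using hh

lemma exists_quadratic_sup_transform {E : Type*} [NormedAddCommGroup E] [InnerProductSpace ℝ E]
    {S : Set E} (hS : IsCompact S) (hne : S.Nonempty) {u : E → ℝ}
    (hu : UpperSemicontinuousOn u S) :
    ∃ (w : E → ℝ) (ξ : E → E), ∀ z, ξ z ∈ S ∧
      w z = u (ξ z) - 2 * ‖ξ z‖ ^ 2 + 4 * ⟪ξ z, z⟫ ∧
      (∀ ζ ∈ S, u ζ - 2 * ‖ζ‖ ^ 2 + 4 * ⟪ζ, z⟫ ≤ w z) ∧
      ∀ y, w z + ⟪(4 : ℝ) • ξ z, y - z⟫ ≤ w y := by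
  have h : ∀ z : E, ∃ ξ ∈ S, ∀ ζ ∈ S,
      u ζ + (-2 * ‖ζ‖ ^ 2 + 4 * ⟪ζ, z⟫) ≤ u ξ + (-2 * ‖ξ‖ ^ 2 + 4 * ⟪ξ, z⟫) := by
    intro z
    have h1 : UpperSemicontinuousOn (fun ζ => u ζ + (-2 * ‖ζ‖ ^ 2 + 4 * ⟪ζ, z⟫)) S := by
      apply hu.add
      have : Continuous fun ζ : E => -2 * ‖ζ‖ ^ 2 + 4 * ⟪ζ, z⟫ := by fun_prop
      exact this.upperSemicontinuous.upperSemicontinuousOn _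
    obtain ⟨ξ, hξ, hm⟩ := h1.exists_isMaxOn hne hS
    exact ⟨ξ, hξ, fun ζ hζ => hm hζ⟩
  choose ξ hξ hm using h
  refine ⟨fun z => u (ξ z) - 2 * ‖ξ z‖ ^ 2 + 4 * ⟪ξ z, z⟫, ξ, fun z =>
    ⟨hξ z, rfl, fun ζ hζ => ?_, fun y => ?_⟩⟩
  · have := hm z ζ hζ; linarith
  · have := hm y (ξ z) (hξ z)
    rw [real_inner_smul_left, inner_sub_right]
    linarith

lemma norm_coupling_add_smul {E : Type*} [NormedAddCommGroup E] [InnerProductSpace ℝ E]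
    (z₁ z₂ h k : E) {s : ℝ} (hs : 0 ≤ s) :
    ‖z₁ + s • h - (z₂ + s • k)‖ ^ 2 + 2 * ‖z₁ + s • h‖ ^ 2 + 2 * ‖z₂ + s • k‖ ^ 2
      = (‖z₁ - z₂‖ ^ 2 + 2 * ‖z₁‖ ^ 2 + 2 * ‖z₂‖ ^ 2)
      + s * (⟪(2 : ℝ) • (z₁ - z₂) + (4 : ℝ) • z₁, h⟫
        + ⟪-((2 : ℝ) • (z₁ - z₂)) + (4 : ℝ) • z₂, k⟫)
      + s ^ 2 * (‖h - k‖ ^ 2 + 2 * ‖h‖ ^ 2 + 2 * ‖k‖ ^ 2) := by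
  have hn : ∀ x : E, ‖s • x‖ = s * ‖x‖ := fun x => by
    rw [norm_smul, Real.norm_eq_abs, abs_of_nonneg hs]
  rw [show z₁ + s • h - (z₂ + s • k) = (z₁ - z₂) + s • (h - k) by module,
    norm_add_sq_real, norm_add_sq_real, norm_add_sq_real, hn, hn, hn]
  simp only [inner_add_left, inner_neg_left, inner_sub_left, inner_sub_right,
    real_inner_smul_left, real_inner_smul_right]
  generalize ⟪z₁, h⟫ = a
  generalize ⟪z₂, h⟫ = b
  generalize ⟪z₁, k⟫ = c
  generalize ⟪z₂, k⟫ = d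
  ring

lemma quadratic_le_coupling {E : Type*} [NormedAddCommGroup E] [InnerProductSpace ℝ E]
    {f₁ f₂ : E → ℝ} {p₁ p₂ z₁ z₂ q₁ q₂ : E} {R₁ R₂ : E →L[ℝ] E}
    (hmax : ∀ y₁ y₂, f₁ y₁ + f₂ y₂ - (‖y₁ - y₂‖ ^ 2 + 2 * ‖y₁‖ ^ 2 + 2 * ‖y₂‖ ^ 2)
          + ⟪p₁, y₁⟫ + ⟪p₂, y₂⟫ ≤
        f₁ z₁ + f₂ z₂ - (‖z₁ - z₂‖ ^ 2 + 2 * ‖z₁‖ ^ 2 + 2 * ‖z₂‖ ^ 2) + ⟪p₁, z₁⟫ + ⟪p₂, z₂⟫)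
    (hz₁ : (2 : ℝ) • (z₁ - z₂) + (4 : ℝ) • z₁ = q₁ + p₁)
    (hz₂ : -((2 : ℝ) • (z₁ - z₂)) + (4 : ℝ) • z₂ = q₂ + p₂)
    (he₁ : ∀ e > 0, ∀ᶠ h in 𝓝 (0 : E),
        |f₁ (z₁ + h) - f₁ z₁ - ⟪q₁, h⟫ - 1 / 2 * ⟪R₁ h, h⟫| ≤ e * ‖h‖ ^ 2)
    (he₂ : ∀ e > 0, ∀ᶠ h in 𝓝 (0 : E),
        |f₂ (z₂ + h) - f₂ z₂ - ⟪q₂, h⟫ - 1 / 2 * ⟪R₂ h, h⟫| ≤ e * ‖h‖ ^ 2) (h k : E) :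
    1 / 2 * ⟪R₁ h, h⟫ + 1 / 2 * ⟪R₂ k, k⟫ ≤ ‖h - k‖ ^ 2 + 2 * ‖h‖ ^ 2 + 2 * ‖k‖ ^ 2 := by
  have hnsm : ∀ (c : ℝ) (x : E), 0 ≤ c → ‖c • x‖ = c * ‖x‖ := fun c x hc => by
    rw [norm_smul, Real.norm_eq_abs, abs_of_nonneg hc]
  have key : ∀ e > 0, 1 / 2 * ⟪R₁ h, h⟫ + 1 / 2 * ⟪R₂ k, k⟫ ≤
      (‖h - k‖ ^ 2 + 2 * ‖h‖ ^ 2 + 2 * ‖k‖ ^ 2) + e * (‖h‖ ^ 2 + ‖k‖ ^ 2) := by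
    intro e he
    have hlim : ∀ x : E, Tendsto (fun s : ℝ => s • x) (𝓝[>] 0) (𝓝 0) := by
      intro x
      have : Continuous fun s : ℝ => s • x := by fun_prop
      have := this.tendsto 0
      rw [zero_smul] at this
      exact this.mono_left nhdsWithin_le_nhds
    obtain ⟨s, ⟨a1, a2⟩, hs⟩ := ((((hlim h).eventually (he₁ e he)).and
      ((hlim k).eventually (he₂ e he))).and self_mem_nhdsWithin).exists
    have hs : (0 : ℝ) < s := hs
    have m := hmax (z₁ + s • h) (z₂ + s • k)
    have a1 := (abs_le.1 a1).1
    have a2 := (abs_le.1 a2).1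
    have hb1 := congrArg (fun x => ⟪x, h⟫) hz₁
    have hb2 := congrArg (fun x => ⟪x, k⟫) hz₂
    have c1 : ‖z₁ + s • h - (z₂ + s • k)‖ ^ 2 + 2 * ‖z₁ + s • h‖ ^ 2 + 2 * ‖z₂ + s • k‖ ^ 2
        = (‖z₁ - z₂‖ ^ 2 + 2 * ‖z₁‖ ^ 2 + 2 * ‖z₂‖ ^ 2)
        + s * (⟪(2 : ℝ) • (z₁ - z₂) + (4 : ℝ) • z₁, h⟫
          + ⟪-((2 : ℝ) • (z₁ - z₂)) + (4 : ℝ) • z₂, k⟫)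
        + s ^ 2 * (‖h - k‖ ^ 2 + 2 * ‖h‖ ^ 2 + 2 * ‖k‖ ^ 2) :=
      norm_coupling_add_smul z₁ z₂ h k hs.le
    rw [c1, hz₁, hz₂] at m
    simp only [map_smul, inner_add_left, inner_add_right, real_inner_smul_left,
      real_inner_smul_right, hnsm _ _ hs.le] at a1 a2 m
    have : s ^ 2 * (1 / 2 * ⟪R₁ h, h⟫ + 1 / 2 * ⟪R₂ k, k⟫) ≤
      s ^ 2 * ((‖h - k‖ ^ 2 + 2 * ‖h‖ ^ 2 + 2 * ‖k‖ ^ 2) + e * (‖h‖ ^ 2 + ‖k‖ ^ 2)) := by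
      linarith
    exact le_of_mul_le_mul_left this (by positivity)
  refine le_of_forall_pos_le_add fun e he => ?_
  refine (key (e / (‖h‖ ^ 2 + ‖k‖ ^ 2 + 1)) (by positivity)).trans ?_
  gcongr
  rw [div_mul_eq_mul_div, div_le_iff₀ (by positivity)]
  nlinarith

lemma upper_jet_of_sup_transform {E : Type*} [NormedAddCommGroup E] [InnerProductSpace ℝ E]
    {S : Set E} {u w : E → ℝ} {x : E → E} {z : E} {R : E →L[ℝ] E}
    (hw : ∀ z, x z ∈ S ∧ w z = u (x z) - 2 * ‖x z‖ ^ 2 + 4 * ⟪x z, z⟫ ∧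
      (∀ ζ ∈ S, u ζ - 2 * ‖ζ‖ ^ 2 + 4 * ⟪ζ, z⟫ ≤ w z) ∧
      ∀ y, w z + ⟪(4 : ℝ) • x z, y - z⟫ ≤ w y)
    (hexp : ∀ e > 0, ∀ᶠ h in 𝓝 (0 : E),
      |w (z + h) - w z - ⟪(4 : ℝ) • x z, h⟫ - 1 / 2 * ⟪R h, h⟫| ≤ e * ‖h‖ ^ 2) :
    ∀ e > 0, ∀ᶠ ζ in 𝓝[S] (x z), u ζ ≤ u (x z) + ⟪(4 : ℝ) • (x z - z), ζ - x z⟫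
        + 1 / 2 * ⟪(R - (4 : ℝ) • ContinuousLinearMap.id ℝ E) (ζ - x z), ζ - x z⟫
        + e * ‖ζ - x z‖ ^ 2 := by
  intro e he
  have ht : Tendsto (fun ζ => ζ - x z) (𝓝[S] (x z)) (𝓝 0) := by
    have : Continuous fun ζ : E => ζ - x z := by fun_prop
    have := this.tendsto (x z)
    rw [sub_self] at this
    exact this.mono_left nhdsWithin_le_nhds
  filter_upwards [ht.eventually (hexp e he), self_mem_nhdsWithin] with ζ hζ hζS
  set h := ζ - x z with hh
  have e1 := (abs_le.1 hζ).2
  have e2 := (hw (z + h)).2.2.1 ζ hζS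
  have e3 := (hw z).2.1
  have e4 : ζ = x z + h := by rw [hh]; abel
  have e5 : (R - (4 : ℝ) • ContinuousLinearMap.id ℝ E) h = R h - (4 : ℝ) • h := by simp
  have e6 : -2 * ‖ζ‖ ^ 2 + 4 * ⟪ζ, z + h⟫ = -2 * ‖x z‖ ^ 2 + 4 * ⟪x z, z⟫
      + 4 * ⟪h, z⟫ + 2 * ‖h‖ ^ 2 := by
    rw [e4, norm_add_sq_real]
    simp only [inner_add_left, inner_add_right, real_inner_self_eq_norm_sq]
    rw [real_inner_comm h (x z)]
    ring
  rw [e5, inner_sub_left, real_inner_smul_left, real_inner_smul_left,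
    real_inner_self_eq_norm_sq, inner_sub_left]
  rw [real_inner_smul_left] at e1
  rw [real_inner_comm h z]
  linarith

set_option maxHeartbeats 1000000 in
/-- The theorem on sums for a unit quadratic penalization, at a perturbed maximum. -/
lemma exists_jets_at_perturbed_max {E : Type*} [NormedAddCommGroup E] [InnerProductSpace ℝ E]
    [FiniteDimensional ℝ E] {S : Set E} (hS : IsCompact S) (hne : S.Nonempty) {u v : E → ℝ}
    (hu : UpperSemicontinuousOn u S) (hv : UpperSemicontinuousOn v S) {ρ : ℝ} (hρ : 0 < ρ) :
    ∃ ξ ∈ S, ∃ ξ' ∈ S, ∃ (P P' : E) (Q Q' : E →L[ℝ] E),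
      (∀ ζ ∈ S, ∀ ζ' ∈ S, u ζ + v ζ' - 1 / 2 * ‖ζ - ζ'‖ ^ 2 ≤
        u ξ + v ξ' - 1 / 2 * ‖ξ - ξ'‖ ^ 2 + ρ) ∧
      ‖P - (ξ - ξ')‖ ≤ ρ ∧ ‖P' + (ξ - ξ')‖ ≤ ρ ∧
      (∀ a a', ⟪Q a, a'⟫ = ⟪a, Q a'⟫) ∧ (∀ a a', ⟪Q' a, a'⟫ = ⟪a, Q' a'⟫) ∧
      (∀ e > 0, ∀ᶠ ζ in 𝓝[S] ξ,
        u ζ ≤ u ξ + ⟪P, ζ - ξ⟫ + 1 / 2 * ⟪Q (ζ - ξ), ζ - ξ⟫ + e * ‖ζ - ξ‖ ^ 2) ∧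
      (∀ e > 0, ∀ᶠ ζ in 𝓝[S] ξ',
        v ζ ≤ v ξ' + ⟪P', ζ - ξ'⟫ + 1 / 2 * ⟪Q' (ζ - ξ'), ζ - ξ'⟫ + e * ‖ζ - ξ'‖ ^ 2) ∧
      ∀ h k, ⟪Q h, h⟫ + ⟪Q' k, k⟫ ≤ 2 * ‖h - k‖ ^ 2 := by
  obtain ⟨wu, xu, hwu⟩ := exists_quadratic_sup_transform hS hne hu
  obtain ⟨wv, xv, hwv⟩ := exists_quadratic_sup_transform hS hne hv
  obtain ⟨r, hr⟩ := hS.isBounded.exists_norm_le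
  have hr0 : 0 ≤ r := by obtain ⟨x, hx⟩ := hne; exact (norm_nonneg x).trans (hr x hx)
  have hbd : ∀ x ∈ S, ‖(4 : ℝ) • x‖ ≤ 4 * r := fun x hx => by
    rw [norm_smul]; simpa using hr x hx
  set τ : ℝ := min (min 1 (ρ / 2)) (ρ / (2 * (2 * r + 1))) with hτ
  have hτ0 : 0 < τ := by positivity
  have hτ1 : τ ≤ 1 := (min_le_left _ _).trans (min_le_left _ _)
  have hτ2 : τ ≤ ρ / 2 := (min_le_left _ _).trans (min_le_right _ _)
  have hτ3 : τ * (2 * (2 * r + 1)) ≤ ρ := by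
    rw [← le_div_iff₀ (by positivity)]; exact min_le_right _ _
  obtain ⟨p₁, p₂, z₁, z₂, q₁, q₂, R₁, R₂, hp₁, hp₂, hmax, hz₁, hz₂, hq₁, hq₂, hs₁, hs₂, he₁, he₂⟩ :=
    exists_perturbed_max_of_convex_pair (M := 4 * r)
    (fun z => ⟨_, hbd _ (hwu z).1, (hwu z).2.2.2⟩)
    (fun z => ⟨_, hbd _ (hwv z).1, (hwv z).2.2.2⟩) hτ0
  obtain ⟨hξ, hwz₁, hw₁, hg₁⟩ := hwu z₁
  obtain ⟨hξ', hwz₂, hw₂, hg₂⟩ := hwv z₂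
  set ξ := xu z₁
  set ξ' := xv z₂
  have hQ₁ := hq₁ _ hg₁
  have hQ₂ := hq₂ _ hg₂
  rw [← hQ₁] at hz₁ he₁
  rw [← hQ₂] at hz₂ he₂
  have hZ₁ : z₁ = (1 / 2 : ℝ) • (ξ + ξ') + (1 / 4 : ℝ) • (ξ - ξ') + (1 / 8 : ℝ) • (p₁ + p₂)
      + (1 / 16 : ℝ) • (p₁ - p₂) := by
    have e1 := congrArg (fun x => (3 / 16 : ℝ) • x) hz₁
    have e2 := congrArg (fun x => (1 / 16 : ℝ) • x) hz₂
    have e3 := congrArg₂ (· + ·) e1 e2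
    calc z₁ = _ := by module
      _ = _ := e3
      _ = _ := by module
  have hZ₂ : z₂ = (1 / 2 : ℝ) • (ξ + ξ') - (1 / 4 : ℝ) • (ξ - ξ') + (1 / 8 : ℝ) • (p₁ + p₂)
      - (1 / 16 : ℝ) • (p₁ - p₂) := by
    have e1 := congrArg (fun x => (1 / 16 : ℝ) • x) hz₁
    have e2 := congrArg (fun x => (3 / 16 : ℝ) • x) hz₂
    have e3 := congrArg₂ (· + ·) e1 e2
    calc z₂ = _ := by module
      _ = _ := e3
      _ = _ := by module
  have hnsm : ∀ (c : ℝ) (x : E), 0 ≤ c → ‖c • x‖ = c * ‖x‖ := fun c x hc => by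
    rw [norm_smul, Real.norm_eq_abs, abs_of_nonneg hc]
  have hzn₁ : ‖z₁‖ ≤ r + τ := by
    rw [hZ₁, show (1 / 2 : ℝ) • (ξ + ξ') + (1 / 4 : ℝ) • (ξ - ξ') + (1 / 8 : ℝ) • (p₁ + p₂)
      + (1 / 16 : ℝ) • (p₁ - p₂) = (3 / 4 : ℝ) • ξ + (1 / 4 : ℝ) • ξ' + (3 / 16 : ℝ) • p₁
      + (1 / 16 : ℝ) • p₂ by module]
    refine (norm_add₄_le).trans ?_
    rw [hnsm _ _ (by norm_num), hnsm _ _ (by norm_num), hnsm _ _ (by norm_num),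
      hnsm _ _ (by norm_num)]
    linarith [hr _ hξ, hr _ hξ']
  have hzn₂ : ‖z₂‖ ≤ r + τ := by
    rw [hZ₂, show (1 / 2 : ℝ) • (ξ + ξ') - (1 / 4 : ℝ) • (ξ - ξ') + (1 / 8 : ℝ) • (p₁ + p₂)
      - (1 / 16 : ℝ) • (p₁ - p₂) = (1 / 4 : ℝ) • ξ + (3 / 4 : ℝ) • ξ' + (1 / 16 : ℝ) • p₁
      + (3 / 16 : ℝ) • p₂ by module]
    refine (norm_add₄_le).trans ?_
    rw [hnsm _ _ (by norm_num), hnsm _ _ (by norm_num), hnsm _ _ (by norm_num),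
      hnsm _ _ (by norm_num)]
    linarith [hr _ hξ, hr _ hξ']
  refine ⟨ξ, hξ, ξ', hξ', (4 : ℝ) • (ξ - z₁), (4 : ℝ) • (ξ' - z₂),
    R₁ - (4 : ℝ) • ContinuousLinearMap.id ℝ E, R₂ - (4 : ℝ) • ContinuousLinearMap.id ℝ E,
    ?_, ?_, ?_, ?_, ?_, upper_jet_of_sup_transform hwu he₁,
    upper_jet_of_sup_transform hwv he₂, ?_⟩
  · intro ζ hζ ζ' hζ'
    set y₁ : E := (3 / 4 : ℝ) • ζ + (1 / 4 : ℝ) • ζ' with hy₁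
    set y₂ : E := (1 / 4 : ℝ) • ζ + (3 / 4 : ℝ) • ζ' with hy₂
    have m1 := hmax y₁ y₂
    have m2 := (hwu y₁).2.2.1 ζ hζ
    have m3 := (hwv y₂).2.2.1 ζ' hζ'
    have id1 : -2 * ‖ζ‖ ^ 2 + 4 * ⟪ζ, y₁⟫ + (-2 * ‖ζ'‖ ^ 2 + 4 * ⟪ζ', y₂⟫)
        - (‖y₁ - y₂‖ ^ 2 + 2 * ‖y₁‖ ^ 2 + 2 * ‖y₂‖ ^ 2) = - (1 / 2 * ‖ζ - ζ'‖ ^ 2) := by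
      simp only [hy₁, hy₂, ← real_inner_self_eq_norm_sq, inner_add_left, inner_add_right,
        inner_sub_left, inner_sub_right, real_inner_smul_left, real_inner_smul_right]
      rw [real_inner_comm ζ ζ']
      ring
    have id2 : -2 * ‖ξ‖ ^ 2 + 4 * ⟪ξ, z₁⟫ + (-2 * ‖ξ'‖ ^ 2 + 4 * ⟪ξ', z₂⟫)
        - (‖z₁ - z₂‖ ^ 2 + 2 * ‖z₁‖ ^ 2 + 2 * ‖z₂‖ ^ 2) ≤ - (1 / 2 * ‖ξ - ξ'‖ ^ 2) := by
      have k1 : ‖ξ - ξ'‖ ≤ ‖z₁ - z₂‖ + (‖ξ - z₁‖ + ‖ξ' - z₂‖) := by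
        calc ‖ξ - ξ'‖ = ‖(z₁ - z₂) + ((ξ - z₁) - (ξ' - z₂))‖ := by congr 1; abel
          _ ≤ ‖z₁ - z₂‖ + ‖(ξ - z₁) - (ξ' - z₂)‖ := norm_add_le _ _
          _ ≤ _ := by gcongr; exact norm_sub_le _ _
      have k2 := norm_sub_sq_real ξ z₁
      have k3 := norm_sub_sq_real ξ' z₂
      have k4 := pow_le_pow_left₀ (norm_nonneg _) k1 2
      nlinarith [sq_nonneg (‖z₁ - z₂‖ - (‖ξ - z₁‖ + ‖ξ' - z₂‖)),
        sq_nonneg (‖ξ - z₁‖ - ‖ξ' - z₂‖)]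
    have hy₁n : ‖y₁‖ ≤ r := by
      refine (norm_add_le _ _).trans ?_
      rw [hnsm _ _ (by norm_num), hnsm _ _ (by norm_num)]
      linarith [hr _ hζ, hr _ hζ']
    have hy₂n : ‖y₂‖ ≤ r := by
      refine (norm_add_le _ _).trans ?_
      rw [hnsm _ _ (by norm_num), hnsm _ _ (by norm_num)]
      linarith [hr _ hζ, hr _ hζ']
    have hb : ∀ p y z : E, ‖p‖ < τ → ‖y‖ ≤ r → ‖z‖ ≤ r + τ → ⟪p, z⟫ - ⟪p, y⟫ ≤ ρ / 2 := by
      intro p y z hp hy hz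
      rw [← inner_sub_right]
      calc ⟪p, z - y⟫ ≤ ‖p‖ * ‖z - y‖ := real_inner_le_norm _ _
        _ ≤ τ * (2 * r + 1) := by
            gcongr
            linarith [norm_sub_le z y]
        _ ≤ ρ / 2 := by linarith
    have b1 := hb p₁ y₁ z₁ hp₁ hy₁n hzn₁
    have b2 := hb p₂ y₂ z₂ hp₂ hy₂n hzn₂
    linarith
  · have : (4 : ℝ) • (ξ - z₁) - (ξ - ξ') = (-3 / 4 : ℝ) • p₁ - (1 / 4 : ℝ) • p₂ := by
      rw [hZ₁]; module
    rw [this]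
    refine (norm_sub_le _ _).trans ?_
    rw [norm_smul, norm_smul]
    norm_num
    linarith
  · have : (4 : ℝ) • (ξ' - z₂) + (ξ - ξ') = (-1 / 4 : ℝ) • p₁ - (3 / 4 : ℝ) • p₂ := by
      rw [hZ₂]; module
    rw [this]
    refine (norm_sub_le _ _).trans ?_
    rw [norm_smul, norm_smul]
    norm_num
    linarith
  · intro a a'
    simp [inner_sub_left, inner_sub_right, real_inner_smul_left, real_inner_smul_right, hs₁]
  · intro a a'
    simp [inner_sub_left, inner_sub_right, real_inner_smul_left, real_inner_smul_right, hs₂]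
  · intro h k
    have key' := quadratic_le_coupling hmax hz₁ hz₂ he₁ he₂ h k
    simp only [sub_apply, smul_apply, ContinuousLinearMap.id_apply, inner_sub_left,
      real_inner_smul_left, real_inner_self_eq_norm_sq]
    linarith

lemma inner_map_toLp_le {F : Type*} [NormedAddCommGroup F] [InnerProductSpace ℝ F]
    (Q : WithLp 2 (ℝ × F) →L[ℝ] WithLp 2 (ℝ × F))
    (hQ : ∀ a a', ⟪Q a, a'⟫ = ⟪a, Q a'⟫) {ω : ℝ} (hω : 0 < ω) (τ : ℝ) (y : F) :
    ⟪Q (WithLp.toLp 2 (τ, y)), WithLp.toLp 2 (τ, y)⟫ ≤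
      (‖Q‖ + ‖Q‖ ^ 2 / ω) * τ ^ 2 + ω * ‖y‖ ^ 2
        + ⟪Q (WithLp.toLp 2 (0, y)), WithLp.toLp 2 (0, y)⟫ := by
  have hn : ∀ Z : WithLp 2 (ℝ × F), ‖Z‖ ^ 2 = ‖Z.fst‖ ^ 2 + ‖Z.snd‖ ^ 2 := fun Z =>
    WithLp.prod_norm_sq_eq_of_L2 Z
  set A : WithLp 2 (ℝ × F) := WithLp.toLp 2 (τ, 0) with hA
  set B : WithLp 2 (ℝ × F) := WithLp.toLp 2 (0, y) with hB
  have hAB : (WithLp.toLp 2 (τ, y) : WithLp 2 (ℝ × F)) = A + B := by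
    apply (WithLp.equiv 2 (ℝ × F)).injective; apply Prod.ext <;> simp [hA, hB]
  have hAn : ‖A‖ = |τ| := by
    have := hn A
    simp only [hA] at this
    rw [← Real.norm_eq_abs, ← sq_eq_sq₀ (norm_nonneg _) (norm_nonneg _), this]
    simp
  have hBn : ‖B‖ = ‖y‖ := by
    have := hn B
    simp only [hB] at this
    rw [← sq_eq_sq₀ (norm_nonneg _) (norm_nonneg _), this]
    simp
  rw [hAB, map_add, inner_add_left, inner_add_right, inner_add_right, hQ B A,
    real_inner_comm (Q A) B]
  have h1 : ⟪Q A, A⟫ ≤ ‖Q‖ * τ ^ 2 := by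
    calc ⟪Q A, A⟫ ≤ ‖Q A‖ * ‖A‖ := real_inner_le_norm _ _
      _ ≤ ‖Q‖ * ‖A‖ * ‖A‖ := by gcongr; exact Q.le_opNorm _
      _ = _ := by rw [hAn, mul_assoc, abs_mul_abs_self]; ring
  have h2 : ⟪Q A, B⟫ ≤ ‖Q‖ * |τ| * ‖y‖ := by
    calc ⟪Q A, B⟫ ≤ ‖Q A‖ * ‖B‖ := real_inner_le_norm _ _
      _ ≤ ‖Q‖ * ‖A‖ * ‖B‖ := by gcongr; exact Q.le_opNorm _
      _ = _ := by rw [hAn, hBn]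
  have h3 : 2 * (‖Q‖ * |τ| * ‖y‖) ≤ ‖Q‖ ^ 2 / ω * τ ^ 2 + ω * ‖y‖ ^ 2 := by
    have h4 : ‖Q‖ ^ 2 / ω * τ ^ 2 + ω * ‖y‖ ^ 2 - 2 * (‖Q‖ * |τ| * ‖y‖)
        = (‖Q‖ * |τ| - ω * ‖y‖) ^ 2 / ω := by
      rw [← sq_abs τ]; field_simp; ring
    have h5 : 0 ≤ (‖Q‖ * |τ| - ω * ‖y‖) ^ 2 / ω := by positivity
    linarith
  linarith

/-- The theorem on sums in the parabolic setting, at a perturbed maximum. -/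
lemma exists_parabolic_jets_at_perturbed_max {F : Type*} [NormedAddCommGroup F]
    [InnerProductSpace ℝ F] [FiniteDimensional ℝ F] {S : Set (ℝ × F)} (hS : IsCompact S)
    (hne : S.Nonempty) {u v : ℝ × F → ℝ}
    (hu : UpperSemicontinuousOn u S) (hv : UpperSemicontinuousOn v S) {κ δ ρ : ℝ}
    (hκ : 0 < κ) (hδ : 0 < δ) (hρ : 0 < ρ) :
    ∃ z ∈ S, ∃ z' ∈ S, ∃ (a a' c₀ c₀' : ℝ) (p p' : F) (X X' : F →L[ℝ] F),
      (∀ w ∈ S, ∀ w' ∈ S,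
        u w + v w' - ((w.1 - w'.1) ^ 2 / (2 * κ) + ‖w.2 - w'.2‖ ^ 2 / (2 * δ)) ≤
        u z + v z' - ((z.1 - z'.1) ^ 2 / (2 * κ) + ‖z.2 - z'.2‖ ^ 2 / (2 * δ)) + ρ) ∧
      |a + a'| ≤ ρ ∧ ‖p - (1 / δ) • (z.2 - z'.2)‖ ≤ ρ ∧ ‖p' + (1 / δ) • (z.2 - z'.2)‖ ≤ ρ ∧
      (∀ h k, ⟪X h, k⟫ = ⟪h, X k⟫) ∧ (∀ h k, ⟪X' h, k⟫ = ⟪h, X' k⟫) ∧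
      (∀ᶠ w in 𝓝[S] z, u w ≤ u z + a * (w.1 - z.1) + c₀ * (w.1 - z.1) ^ 2
        + ⟪p, w.2 - z.2⟫ + 1 / 2 * ⟪X (w.2 - z.2), w.2 - z.2⟫) ∧
      (∀ᶠ w in 𝓝[S] z', v w ≤ v z' + a' * (w.1 - z'.1) + c₀' * (w.1 - z'.1) ^ 2
        + ⟪p', w.2 - z'.2⟫ + 1 / 2 * ⟪X' (w.2 - z'.2), w.2 - z'.2⟫) ∧
      ∀ h k, ⟪X h, h⟫ + ⟪X' k, k⟫ ≤ 2 / δ * ‖h - k‖ ^ 2 + ρ * (‖h‖ ^ 2 + ‖k‖ ^ 2) := by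
  set r := √κ with hr
  set s := √δ with hs
  have hr0 : 0 < r := Real.sqrt_pos.2 hκ
  have hs0 : 0 < s := Real.sqrt_pos.2 hδ
  have hr2 : r ^ 2 = κ := Real.sq_sqrt hκ.le
  have hs2 : s ^ 2 = δ := Real.sq_sqrt hδ.le
  have hn : ∀ Z : WithLp 2 (ℝ × F), ‖Z‖ ^ 2 = ‖Z.fst‖ ^ 2 + ‖Z.snd‖ ^ 2 := fun Z =>
    WithLp.prod_norm_sq_eq_of_L2 Z
  have hin : ∀ Z W : WithLp 2 (ℝ × F), ⟪Z, W⟫ = Z.fst * W.fst + ⟪Z.snd, W.snd⟫ := fun Z W => by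
    rw [mul_comm]; exact WithLp.prod_inner_apply Z W
  let Θ : ℝ × F → WithLp 2 (ℝ × F) := fun w => WithLp.toLp 2 (r⁻¹ * w.1, s⁻¹ • w.2)
  let Ψ : WithLp 2 (ℝ × F) → ℝ × F := fun Z => (r * Z.fst, s • Z.snd)
  have hΘc : Continuous Θ := by
    have : Continuous fun w : ℝ × F => (r⁻¹ * w.1, s⁻¹ • w.2) := by fun_prop
    exact (WithLp.prod_continuous_toLp 2 ℝ F).comp this
  have hΨc : Continuous Ψ := by
    have h1 := WithLp.prod_continuous_ofLp 2 ℝ F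
    have : Continuous fun w : ℝ × F => (r * w.1, s • w.2) := by fun_prop
    exact this.comp h1
  have hΨΘ : ∀ w, Ψ (Θ w) = w := fun w => by
    apply Prod.ext
    · change r * (r⁻¹ * w.1) = w.1
      field_simp
    · change s • (s⁻¹ • w.2) = w.2
      rw [smul_smul, mul_inv_cancel₀ hs0.ne', one_smul]
  set S' := Θ '' S with hS'
  have hmaps : MapsTo Ψ S' S := by
    rintro _ ⟨w, hw, rfl⟩; rw [hΨΘ]; exact hw
  have husc : ∀ f : ℝ × F → ℝ, UpperSemicontinuousOn f S →
      UpperSemicontinuousOn (fun Z => f (Ψ Z)) S' := fun f hf =>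
    hf.comp hΨc.continuousOn hmaps
  set ρ₁ := min (ρ * r / 2) (min (ρ * s) ρ) with hρ₁
  have hρ₁0 : 0 < ρ₁ := by positivity
  have hρ₁a : ρ₁ ≤ ρ * r / 2 := min_le_left _ _
  have hρ₁b : ρ₁ ≤ ρ * s := (min_le_right _ _).trans (min_le_left _ _)
  have hρ₁c : ρ₁ ≤ ρ := (min_le_right _ _).trans (min_le_right _ _)
  obtain ⟨ξ, ⟨z, hz, rfl⟩, ξ', ⟨z', hz', rfl⟩, P, P', Q, Q', hmax, hP, hP', hQs, hQs', hj,
    hj', hQQ⟩ :=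
    exists_jets_at_perturbed_max (hS.image hΘc) (hne.image Θ) (husc u hu) (husc v hv) hρ₁0
  set ω : ℝ := ρ * δ / 3 with hω
  have hω0 : 0 < ω := by positivity
  have hΘsub : ∀ w w' : ℝ × F, Θ w - Θ w' =
      WithLp.toLp 2 (r⁻¹ * (w.1 - w'.1), s⁻¹ • (w.2 - w'.2)) := fun w w' => by
    apply (WithLp.equiv 2 (ℝ × F)).injective
    apply Prod.ext
    · simp [Θ]; ring
    · simp [Θ, smul_sub]
  have hpen : ∀ w w' : ℝ × F, 1 / 2 * ‖Θ w - Θ w'‖ ^ 2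
      = (w.1 - w'.1) ^ 2 / (2 * κ) + ‖w.2 - w'.2‖ ^ 2 / (2 * δ) := fun w w' => by
    rw [hΘsub, hn]
    change 1 / 2 * (‖r⁻¹ * (w.1 - w'.1)‖ ^ 2 + ‖s⁻¹ • (w.2 - w'.2)‖ ^ 2) = _
    rw [norm_smul, mul_pow, norm_mul, mul_pow, norm_inv, norm_inv, Real.norm_eq_abs,
      Real.norm_eq_abs, Real.norm_eq_abs, inv_pow, inv_pow, sq_abs, sq_abs, sq_abs, hr2, hs2]
    field_simp
  let i₂ : F →L[ℝ] WithLp 2 (ℝ × F) := LinearMap.toContinuousLinearMap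
    { toFun := fun h => WithLp.toLp 2 (0, h)
      map_add' := fun x y => by
        apply (WithLp.equiv 2 (ℝ × F)).injective; apply Prod.ext <;> simp
      map_smul' := fun c x => by
        apply (WithLp.equiv 2 (ℝ × F)).injective; apply Prod.ext <;> simp }
  have hi₂ : ∀ h, i₂ h = WithLp.toLp 2 (0, h) := fun h => rfl
  let Y : (WithLp 2 (ℝ × F) →L[ℝ] WithLp 2 (ℝ × F)) → F →L[ℝ] F := fun Q =>
    (1 / δ) • (ContinuousLinearMap.adjoint i₂ ∘L Q ∘L i₂ + (3 * ω) • ContinuousLinearMap.id ℝ F)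
  have hY : ∀ Q h k, ⟪Y Q h, k⟫ = 1 / δ * (⟪Q (i₂ h), i₂ k⟫ + 3 * ω * ⟪h, k⟫) := fun Q h k => by
    simp only [Y, smul_apply, add_apply, ContinuousLinearMap.comp_apply, inner_add_left,
      real_inner_smul_left, ContinuousLinearMap.adjoint_inner_left, ContinuousLinearMap.id_apply]
  have hYs : ∀ Q : WithLp 2 (ℝ × F) →L[ℝ] WithLp 2 (ℝ × F), (∀ a a', ⟪Q a, a'⟫ = ⟪a, Q a'⟫) →
      ∀ h k, ⟪Y Q h, k⟫ = ⟪h, Y Q k⟫ := fun Q hQ h k => by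
    rw [real_inner_comm (Y Q k) h, hY, hY, hQ, real_inner_comm (i₂ h) (Q (i₂ k)),
      real_inner_comm h k]
  have jet : ∀ (f : ℝ × F → ℝ) (w₀ : ℝ × F) (P : WithLp 2 (ℝ × F))
      (Q : WithLp 2 (ℝ × F) →L[ℝ] WithLp 2 (ℝ × F)), (∀ a a', ⟪Q a, a'⟫ = ⟪a, Q a'⟫) →
      (∀ e > 0, ∀ᶠ ζ in 𝓝[S'] (Θ w₀), f (Ψ ζ) ≤ f (Ψ (Θ w₀)) + ⟪P, ζ - Θ w₀⟫
        + 1 / 2 * ⟪Q (ζ - Θ w₀), ζ - Θ w₀⟫ + e * ‖ζ - Θ w₀‖ ^ 2) →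
      ∀ᶠ w in 𝓝[S] w₀, f w ≤ f w₀ + P.fst / r * (w.1 - w₀.1)
        + ((‖Q‖ + ‖Q‖ ^ 2 / ω) / 2 + ω) / κ * (w.1 - w₀.1) ^ 2
        + ⟪s⁻¹ • P.snd, w.2 - w₀.2⟫ + 1 / 2 * ⟪Y Q (w.2 - w₀.2), w.2 - w₀.2⟫ := by
    intro f w₀ P Q hQ hf
    have ht : Tendsto Θ (𝓝[S] w₀) (𝓝[S'] (Θ w₀)) :=
      hΘc.continuousWithinAt.tendsto_nhdsWithin (mapsTo_image Θ S)
    filter_upwards [ht.eventually (hf ω hω0)] with w hw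
    have hb := inner_map_toLp_le Q hQ hω0 (r⁻¹ * (w.1 - w₀.1)) (s⁻¹ • (w.2 - w₀.2))
    rw [hΨΘ, hΨΘ, hn, hΘsub, hin] at hw
    change f w ≤ f w₀ + (P.fst * (r⁻¹ * (w.1 - w₀.1)) + ⟪P.snd, s⁻¹ • (w.2 - w₀.2)⟫) + _ +
      ω * (‖r⁻¹ * (w.1 - w₀.1)‖ ^ 2 + ‖s⁻¹ • (w.2 - w₀.2)‖ ^ 2) at hw
    rw [← hi₂, map_smul, map_smul, real_inner_smul_left, real_inner_smul_right] at hb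
    rw [hY, real_inner_self_eq_norm_sq, real_inner_smul_left]
    rw [real_inner_smul_right] at hw
    have e1 : ‖r⁻¹ * (w.1 - w₀.1)‖ ^ 2 = (w.1 - w₀.1) ^ 2 / κ := by
      rw [Real.norm_eq_abs, sq_abs, mul_pow, inv_pow, hr2]; field_simp
    have e2 : ‖s⁻¹ • (w.2 - w₀.2)‖ ^ 2 = ‖w.2 - w₀.2‖ ^ 2 / δ := by
      rw [norm_smul, mul_pow, Real.norm_eq_abs, sq_abs, inv_pow, hs2]; field_simp
    have e3 : (r⁻¹ * (w.1 - w₀.1)) ^ 2 = (w.1 - w₀.1) ^ 2 / κ := by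
      rw [mul_pow, inv_pow, hr2]; field_simp
    rw [e1, e2] at hw
    rw [e2, e3, ← mul_assoc, ← mul_inv, ← sq, hs2] at hb
    have e4 : P.fst * (r⁻¹ * (w.1 - w₀.1)) = P.fst / r * (w.1 - w₀.1) := by field_simp
    rw [e4] at hw
    have e5 : ((‖Q‖ + ‖Q‖ ^ 2 / ω) / 2 + ω) / κ * (w.1 - w₀.1) ^ 2
      = 1 / 2 * ((‖Q‖ + ‖Q‖ ^ 2 / ω) * ((w.1 - w₀.1) ^ 2 / κ)) + ω * ((w.1 - w₀.1) ^ 2 / κ) := by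
      ring
    have e6 : 1 / 2 * (1 / δ * (⟪Q (i₂ (w.2 - w₀.2)), i₂ (w.2 - w₀.2)⟫
        + 3 * ω * ‖w.2 - w₀.2‖ ^ 2)) = 1 / 2 * (δ⁻¹ * ⟪Q (i₂ (w.2 - w₀.2)), i₂ (w.2 - w₀.2)⟫)
        + 1 / 2 * (ω * (‖w.2 - w₀.2‖ ^ 2 / δ)) + ω * (‖w.2 - w₀.2‖ ^ 2 / δ) := by
      ring
    rw [e5, e6]
    linarith
  have hfst : ∀ Z : WithLp 2 (ℝ × F), |Z.fst| ≤ ‖Z‖ := fun Z => by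
    refine (abs_le_of_sq_le_sq' ?_ (norm_nonneg _)).2
    rw [hn, Real.norm_eq_abs]; nlinarith [sq_nonneg ‖Z.snd‖]
  have hsnd : ∀ Z : WithLp 2 (ℝ × F), ‖Z.snd‖ ≤ ‖Z‖ := fun Z => by
    refine (abs_le_of_sq_le_sq' ?_ (norm_nonneg _)).2
    rw [hn]; nlinarith [sq_nonneg ‖Z.fst‖]
  have hdiv : ∀ W : F, ‖W‖ ≤ ρ₁ → ‖s⁻¹ • W‖ ≤ ρ := fun W hW => by
    rw [norm_smul, norm_inv, Real.norm_eq_abs, abs_of_pos hs0, inv_mul_le_iff₀ hs0]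
    linarith
  refine ⟨z, hz, z', hz', P.fst / r, P'.fst / r, _, _, s⁻¹ • P.snd, s⁻¹ • P'.snd, Y Q, Y Q',
    ?_, ?_, ?_, ?_, hYs Q hQs, hYs Q' hQs', jet u z P Q hQs hj, jet v z' P' Q' hQs' hj', ?_⟩
  · intro w hw w' hw'
    have := hmax (Θ w) (mem_image_of_mem _ hw) (Θ w') (mem_image_of_mem _ hw')
    rw [hpen, hpen, hΨΘ, hΨΘ, hΨΘ, hΨΘ] at this
    linarith
  · have h1 := (hfst _).trans hP
    have h2 := (hfst _).trans hP'
    rw [WithLp.sub_fst] at h1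
    rw [WithLp.add_fst] at h2
    rw [← add_div, abs_div, abs_of_pos hr0, div_le_iff₀ hr0]
    have h3 : P.fst + P'.fst = (P.fst - (Θ z - Θ z').fst) + (P'.fst + (Θ z - Θ z').fst) := by ring
    rw [h3]
    refine (abs_add_le _ _).trans ?_
    linarith
  · have h1 := (hsnd _).trans hP
    have h2 : s⁻¹ • P.snd - (1 / δ) • (z.2 - z'.2) = s⁻¹ • (P - (Θ z - Θ z')).snd := by
      have h3 : (Θ z - Θ z').snd = s⁻¹ • (z.2 - z'.2) := by
        rw [hΘsub]; rfl
      rw [WithLp.sub_snd, h3, smul_sub s⁻¹ P.snd, smul_smul, ← mul_inv, ← sq, hs2, one_div]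
    rw [h2]
    exact hdiv _ h1
  · have h1 := (hsnd _).trans hP'
    have h2 : s⁻¹ • P'.snd + (1 / δ) • (z.2 - z'.2) = s⁻¹ • (P' + (Θ z - Θ z')).snd := by
      have h3 : (Θ z - Θ z').snd = s⁻¹ • (z.2 - z'.2) := by
        rw [hΘsub]; rfl
      rw [WithLp.add_snd, h3, smul_add s⁻¹ P'.snd, smul_smul, ← mul_inv, ← sq, hs2, one_div]
    rw [h2]
    exact hdiv _ h1
  · intro h k
    have h1 := hQQ (i₂ h) (i₂ k)
    have h2 : ‖i₂ h - i₂ k‖ ^ 2 = ‖h - k‖ ^ 2 := by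
      rw [← map_sub, hn, hi₂]; simp
    rw [hY, hY, real_inner_self_eq_norm_sq, real_inner_self_eq_norm_sq]
    rw [h2] at h1
    have h3 : 1 / δ * (⟪Q (i₂ h), i₂ h⟫ + 3 * ω * ‖h‖ ^ 2)
        + 1 / δ * (⟪Q' (i₂ k), i₂ k⟫ + 3 * ω * ‖k‖ ^ 2)
        = 1 / δ * (⟪Q (i₂ h), i₂ h⟫ + ⟪Q' (i₂ k), i₂ k⟫) + ρ * (‖h‖ ^ 2 + ‖k‖ ^ 2) := by
      rw [hω]; field_simp; ring
    rw [h3]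
    have h4 : 1 / δ * (⟪Q (i₂ h), i₂ h⟫ + ⟪Q' (i₂ k), i₂ k⟫) ≤ 1 / δ * (2 * ‖h - k‖ ^ 2) := by
      gcongr
    have h5 : 1 / δ * (2 * ‖h - k‖ ^ 2) = 2 / δ * ‖h - k‖ ^ 2 := by ring
    linarith

lemma hasGradientAt_sum_basis {d : ℕ} {Φ : ℝ × Vec d → ℝ} (hΦ : Differentiable ℝ Φ) (t : ℝ)
    (x : Vec d) :
    HasGradientAt (fun y => Φ (t, y))
      (∑ i, fderiv ℝ Φ (t, x) (0, EuclideanSpace.single i 1) • EuclideanSpace.single i (1 : ℝ))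
      x := by
  rw [hasGradientAt_iff_hasFDerivAt]
  have h1 : HasFDerivAt (fun y => Φ (t, y))
      ((fderiv ℝ Φ (t, x)).comp (ContinuousLinearMap.inr ℝ ℝ (Vec d))) x :=
    (hΦ (t, x)).hasFDerivAt.comp x (hasFDerivAt_prodMk_right t x)
  refine h1.congr_fderiv ?_
  apply ContinuousLinearMap.ext
  intro v
  have hv : v = ∑ i, v i • EuclideanSpace.single i (1 : ℝ) := by
    ext i; simp [Finset.sum_apply, Pi.single_apply]
  have h2 : (fderiv ℝ Φ (t, x)).comp (ContinuousLinearMap.inr ℝ ℝ (Vec d)) v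
      = ∑ i, v i * fderiv ℝ Φ (t, x) (0, EuclideanSpace.single i 1) := by
    conv_lhs => rw [hv]
    rw [map_sum]
    refine Finset.sum_congr rfl fun i _ => ?_
    rw [map_smul]; simp
  rw [h2, InnerProductSpace.toDual_apply_apply, sum_inner]
  symm
  refine Finset.sum_congr rfl fun i _ => ?_
  rw [real_inner_smul_left, EuclideanSpace.inner_single_left]
  simp [mul_comm]

/-- The matrix of a linear endomorphism of Euclidean space, entrywise. -/
lemma toEuclideanLin_of_apply_single {d : ℕ} (L : Vec d →L[ℝ] Vec d) :
    (Matrix.toEuclideanLin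
      (Matrix.of fun i j => L (EuclideanSpace.single j 1) i)).toContinuousLinearMap = L := by
  apply ContinuousLinearMap.ext
  intro v
  have hv : v = ∑ i, v i • EuclideanSpace.single i (1 : ℝ) := by
    ext i; simp [Finset.sum_apply, Pi.single_apply]
  conv_rhs => rw [hv]
  rw [map_sum]
  ext i
  simp [Matrix.toLpLin_apply, Matrix.mulVec, dotProduct, mul_comm]

/-- A twice continuously differentiable function of time and space as a test function. -/
def C12.ofContDiff {d : ℕ} (Φ : ℝ × Vec d → ℝ) (hΦ : ContDiff ℝ 2 Φ) : C12 d :=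
  let G : ℝ × Vec d → Vec d := fun p =>
    ∑ i, fderiv ℝ Φ p (0, EuclideanSpace.single i 1) • EuclideanSpace.single i (1 : ℝ)
  have hG : ContDiff ℝ 1 G := by
    refine ContDiff.sum fun i _ => ?_
    refine ContDiff.fun_smul ?_ contDiff_const
    exact (hΦ.fderiv_right (m := 1) (by norm_num)).clm_apply contDiff_const
  { toFun := fun t x => Φ (t, x)
    dt := fun t x => fderiv ℝ Φ (t, x) (1, 0)
    grad := fun t x => G (t, x)
    hess := fun t x => Matrix.of fun i j =>
      fderiv ℝ G (t, x) (0, EuclideanSpace.single j 1) i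
    hasDt := fun t x => by
      have h1 := (hΦ.differentiable (by norm_num) (t, x)).hasFDerivAt
      have h2 : HasDerivAt (fun s : ℝ => (s, x)) ((1 : ℝ), (0 : Vec d)) t :=
        (hasDerivAt_id t).prodMk (hasDerivAt_const t x)
      exact h1.comp_hasDerivAt t h2
    hasGrad := fun t x => hasGradientAt_sum_basis (hΦ.differentiable (by norm_num)) t x
    hasHess := fun t x => by
      have h1 : HasFDerivAt (fun y => G (t, y))
          ((fderiv ℝ G (t, x)).comp (ContinuousLinearMap.inr ℝ ℝ (Vec d))) x :=
        (hG.differentiable (by norm_num) (t, x)).hasFDerivAt.comp x (hasFDerivAt_prodMk_right t x)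
      have h2 := toEuclideanLin_of_apply_single
        ((fderiv ℝ G (t, x)).comp (ContinuousLinearMap.inr ℝ ℝ (Vec d)))
      rw [← h2] at h1
      exact h1
    cont := hΦ.continuous
    cont_dt := (hΦ.continuous_fderiv (by norm_num)).clm_apply continuous_const
    cont_grad := hG.continuous
    cont_hess := by
      refine continuous_matrix fun i j => ?_
      have h1 : Continuous fun p : ℝ × Vec d =>
          fderiv ℝ G p (0, EuclideanSpace.single j 1) :=
        (hG.continuous_fderiv (by norm_num)).clm_apply continuous_const
      exact (EuclideanSpace.proj i).continuous.comp h1 }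

/-- The opposite of a test function. -/
def C12.neg {d : ℕ} (φ : C12 d) : C12 d where
  toFun := fun t x => -φ.toFun t x
  dt := fun t x => -φ.dt t x
  grad := fun t x => -φ.grad t x
  hess := fun t x => -φ.hess t x
  hasDt := fun t x => (φ.hasDt t x).neg
  hasGrad := fun t x => by
    have h := (φ.hasGrad t x)
    rw [hasGradientAt_iff_hasFDerivAt] at h ⊢
    rw [map_neg]
    exact h.neg
  hasHess := fun t x => by
    have h := (φ.hasHess t x).neg
    refine h.congr_fderiv ?_
    rw [map_neg, map_neg]
  cont := φ.cont.neg
  cont_dt := φ.cont_dt.neg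
  cont_grad := φ.cont_grad.neg
  cont_hess := φ.cont_hess.neg

/-- The derivatives of a test function are determined by its germ. -/
lemma C12.derivs_eq {d : ℕ} (φ : C12 d) {Φ : ℝ × Vec d → ℝ} {t₀ : ℝ} {x₀ : Vec d}
    (h : ∀ᶠ z in 𝓝 (t₀, x₀), φ.toFun z.1 z.2 = Φ z) {a : ℝ} {G : Vec d → Vec d}
    {X : Vec d →L[ℝ] Vec d} (ha : HasDerivAt (fun t => Φ (t, x₀)) a t₀)
    (hG : ∀ x, HasGradientAt (fun y => Φ (t₀, y)) (G x) x) (hX : HasFDerivAt G X x₀) :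
    φ.dt t₀ x₀ = a ∧ φ.grad t₀ x₀ = G x₀ ∧
      (Matrix.toEuclideanLin (φ.hess t₀ x₀)).toContinuousLinearMap = X := by
  have h1 : ∀ᶠ t in 𝓝 t₀, φ.toFun t x₀ = Φ (t, x₀) :=
    (Continuous.prodMk_left x₀).continuousAt.eventually h
  have h2 : ∀ᶠ x in 𝓝 x₀, φ.toFun t₀ x = Φ (t₀, x) :=
    (Continuous.prodMk_right t₀).continuousAt.eventually h
  have h3 : ∀ᶠ x in 𝓝 x₀, φ.grad t₀ x = G x := by
    filter_upwards [eventually_eventually_nhds.2 h2] with x hx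
    exact (φ.hasGrad t₀ x).unique ((hG x).congr_of_eventuallyEq hx)
  exact ⟨(φ.hasDt t₀ x₀).unique (ha.congr_of_eventuallyEq h1), h3.self_of_nhds,
    (φ.hasHess t₀ x₀).unique (hX.congr_of_eventuallyEq h3)⟩

/-- Bounded upper semicontinuous functions are limits of smooth functions from above. -/
lemma exists_contDiff_tendsto_of_upperSemicontinuousOn {E : Type*} [NormedAddCommGroup E]
    [NormedSpace ℝ E] [FiniteDimensional ℝ E] {K : Set E} {u : E → ℝ} {M : ℝ}
    (hK : K.Nonempty) (hM : ∀ z ∈ K, |u z| ≤ M) (hu : UpperSemicontinuousOn u K) :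
    ∃ ψ : ℕ → E → ℝ, (∀ n, ContDiff ℝ 2 (ψ n)) ∧ (∀ n, ∀ z ∈ K, u z ≤ ψ n z) ∧
      (∀ n, ∀ z ∈ K, |ψ n z| ≤ M + 2) ∧ ∀ z ∈ K, Tendsto (fun n => ψ n z) atTop (𝓝 (u z)) := by
  have : Nonempty K := hK.to_subtype
  set U : ℕ → E → ℝ := fun n z => ⨆ w : K, (u w - n * dist z w) with hU
  have hbd : ∀ (n : ℕ) (z : E), BddAbove (range fun w : K => u w - n * dist z w) := fun n z => by
    refine ⟨M, ?_⟩
    rintro _ ⟨w, rfl⟩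
    have h1 := (abs_le.1 (hM w w.2)).2
    have h2 : 0 ≤ (n : ℝ) * dist z w := by positivity
    dsimp only; linarith
  have hUM : ∀ (n : ℕ) (z : E), U n z ≤ M := fun n z => ciSup_le fun w => by
    have h1 := (abs_le.1 (hM w w.2)).2
    have h2 : 0 ≤ (n : ℝ) * dist z w := by positivity
    linarith
  have huU : ∀ n : ℕ, ∀ z ∈ K, u z ≤ U n z := fun n z hz => by
    have := le_ciSup (hbd n z) ⟨z, hz⟩
    simpa using this
  have hlip : ∀ n : ℕ, LipschitzWith n (U n) := fun n => by
    refine LipschitzWith.of_le_add_mul _ fun x y => ?_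
    refine ciSup_le fun w => ?_
    have h1 := le_ciSup (hbd n y) w
    have h2 := dist_triangle y x w
    rw [dist_comm y x] at h2
    have h3 : (n : ℝ) * dist y w ≤ n * (dist x y + dist x w) := by gcongr
    simp only [NNReal.coe_natCast]
    linarith
  have hsm : ∀ n : ℕ, ∃ g : E → ℝ, ContDiff ℝ (⊤ : ℕ∞) g ∧
      ∀ a, dist (g a) (U n a) < 1 / ((n : ℝ) + 1) := fun n =>
    (hlip n).uniformContinuous.exists_contDiff_dist_le (by positivity)
  choose g hg hgd using hsm
  have hgd' : ∀ (n : ℕ) (a : E), |g n a - U n a| < 1 / ((n : ℝ) + 1) := fun n a => hgd n a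
  have hn1 : ∀ n : ℕ, 1 / ((n : ℝ) + 1) ≤ 1 := fun n => by
    rw [div_le_one (by positivity)]; linarith [(Nat.cast_nonneg n : (0:ℝ) ≤ n)]
  refine ⟨fun n z => g n z + 1 / ((n : ℝ) + 1), fun n => ?_, fun n z hz => ?_, fun n z hz => ?_,
    fun z hz => ?_⟩
  · exact ((hg n).of_le (by
      have h2 : ((2 : ℕ) : WithTop ℕ∞) ≤ ((⊤ : ℕ∞) : WithTop ℕ∞) :=
        WithTop.coe_le_coe.2 le_top
      exact h2)).add contDiff_const
  · have h1 := abs_lt.1 (hgd' n z)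
    have h2 := huU n z hz
    dsimp only; linarith
  · have h1 := abs_lt.1 (hgd' n z)
    have h2 := huU n z hz
    have h3 := hUM n z
    have h4 := (abs_le.1 (hM z hz)).1
    have h5 := hn1 n
    rw [abs_le]; constructor <;> linarith
  · have hlim : Tendsto (fun n : ℕ => 1 / ((n : ℝ) + 1)) atTop (𝓝 0) :=
      tendsto_one_div_add_atTop_nhds_zero_nat
    have hUt : Tendsto (fun n => U n z) atTop (𝓝 (u z)) := by
      refine tendsto_order.2 ⟨fun c hc => Eventually.of_forall fun n => hc.trans_le (huU n z hz),
        fun c hc => ?_⟩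
      obtain ⟨c', hc1, hc2⟩ := exists_between hc
      have h1 := hu z hz c' hc1
      obtain ⟨r, hr, hball⟩ := Metric.mem_nhdsWithin_iff.1 h1
      obtain ⟨N, hN⟩ := exists_nat_gt ((M - c') / r)
      filter_upwards [eventually_ge_atTop N] with n hn
      refine lt_of_le_of_lt (ciSup_le fun w => ?_) hc2
      by_cases hw : dist (w : E) z < r
      · have h2 : u w < c' := hball ⟨hw, w.2⟩
        have h3 : 0 ≤ (n : ℝ) * dist z w := by positivity
        linarith
      · rw [not_lt, dist_comm] at hw
        have h2 := (abs_le.1 (hM w w.2)).2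
        have h3 : (N : ℝ) ≤ n := by exact_mod_cast hn
        have h4 : M - c' < N * r := (div_lt_iff₀ hr).1 hN
        have h5 : (N : ℝ) * r ≤ n * dist z w := by gcongr
        linarith
    have hgt : Tendsto (fun n => g n z - U n z) atTop (𝓝 0) :=
      squeeze_zero_norm (fun n => (hgd' n z).le) hlim
    have := (hgt.add hUt).add hlim
    simpa using this

/-- A function touching `u` from above locally is extended to smooth functions lying above `u` and
converging to `u`. -/
lemma exists_contDiff_tendsto_of_touching {E : Type*} [NormedAddCommGroup E]
    [NormedSpace ℝ E] [FiniteDimensional ℝ E] {K : Set E} {u Φ : E → ℝ} {M : ℝ} {z₀ : E}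
    (hz₀ : z₀ ∈ K) (hM : ∀ z ∈ K, |u z| ≤ M) (hu : UpperSemicontinuousOn u K)
    (hΦ : ContDiff ℝ 2 Φ) (h0 : Φ z₀ = u z₀) (hle : ∀ᶠ z in 𝓝[K] z₀, u z ≤ Φ z) :
    ∃ φ : ℕ → E → ℝ, ∃ B : ℝ, (∀ n, ContDiff ℝ 2 (φ n)) ∧ (∀ n, ∀ z ∈ K, u z ≤ φ n z) ∧
      (∀ n, ∀ z ∈ K, |φ n z| ≤ B) ∧ (∀ n, ∀ᶠ z in 𝓝 z₀, φ n z = Φ z) ∧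
      ∀ z ∈ K, Tendsto (fun n => φ n z) atTop (𝓝 (u z)) := by
  obtain ⟨ψ, hψ, huψ, hψM, hψt⟩ :=
    exists_contDiff_tendsto_of_upperSemicontinuousOn ⟨z₀, hz₀⟩ hM hu
  obtain ⟨r, hr, hball⟩ := Metric.mem_nhdsWithin_iff.1 hle
  obtain ⟨B, hB⟩ := (isCompact_closedBall z₀ r).exists_bound_of_continuousOn
    hΦ.continuous.continuousOn
  have hrn : ∀ n : ℕ, 0 < r / ((n : ℝ) + 1) := fun n => by positivity
  let θ : ∀ _ : ℕ, ContDiffBump z₀ := fun n =>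
    { rIn := r / ((n : ℝ) + 1) / 2, rOut := r / ((n : ℝ) + 1)
      rIn_pos := half_pos (hrn n), rIn_lt_rOut := half_lt_self (hrn n) }
  have hrr : ∀ n : ℕ, r / ((n : ℝ) + 1) ≤ r := fun n =>
    div_le_self hr.le (by linarith [(Nat.cast_nonneg n : (0:ℝ) ≤ n)])
  have hzero : ∀ (n : ℕ) (z : E), r / ((n : ℝ) + 1) ≤ dist z z₀ → θ n z = 0 := fun n z h =>
    (θ n).zero_of_le_dist h
  refine ⟨fun n z => θ n z * Φ z + (1 - θ n z) * ψ n z, max B (M + 2), fun n => ?_,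
    fun n z hz => ?_, fun n z hz => ?_, fun n => ?_, fun z hz => ?_⟩
  · exact ((θ n).contDiff.mul hΦ).add ((contDiff_const.sub (θ n).contDiff).mul (hψ n))
  · have h1 : θ n z * u z ≤ θ n z * Φ z := by
      rcases lt_or_ge (dist z z₀) (r / ((n : ℝ) + 1)) with h | h
      · exact mul_le_mul_of_nonneg_left (hball ⟨h.trans_le (hrr n), hz⟩) (θ n).nonneg
      · rw [hzero n z h]; simp
    have h2 : (1 - θ n z) * u z ≤ (1 - θ n z) * ψ n z :=
      mul_le_mul_of_nonneg_left (huψ n z hz) (by linarith [(θ n).le_one (x := z)])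
    dsimp only; linarith
  · have hθ0 : 0 ≤ θ n z := (θ n).nonneg
    have hθ1 : θ n z ≤ 1 := (θ n).le_one
    have h1 : θ n z * |Φ z| ≤ θ n z * max B (M + 2) := by
      rcases lt_or_ge (dist z z₀) (r / ((n : ℝ) + 1)) with h | h
      · exact mul_le_mul_of_nonneg_left
          ((hB z (mem_closedBall.2 (h.le.trans (hrr n)))).trans (le_max_left _ _)) hθ0
      · rw [hzero n z h]; simp
    have h2 : (1 - θ n z) * |ψ n z| ≤ (1 - θ n z) * max B (M + 2) :=
      mul_le_mul_of_nonneg_left ((hψM n z hz).trans (le_max_right _ _)) (by linarith)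
    calc |θ n z * Φ z + (1 - θ n z) * ψ n z| ≤ |θ n z * Φ z| + |(1 - θ n z) * ψ n z| :=
          abs_add_le _ _
      _ = θ n z * |Φ z| + (1 - θ n z) * |ψ n z| := by
          rw [abs_mul, abs_mul, abs_of_nonneg hθ0, abs_of_nonneg (by linarith : 0 ≤ 1 - θ n z)]
      _ ≤ max B (M + 2) := by linarith
  · filter_upwards [(θ n).eventuallyEq_one] with z hz
    rw [hz]; simp
  · by_cases hzz : z = z₀
    · subst hzz
      refine tendsto_const_nhds.congr fun n => ?_
      have h1 : θ n z = 1 := (θ n).eventuallyEq_one.self_of_nhds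
      simp [h0, h1]
    · have hd : 0 < dist z z₀ := dist_pos.2 hzz
      refine (hψt z hz).congr' ?_
      obtain ⟨N, hN⟩ := exists_nat_gt (r / dist z z₀)
      filter_upwards [eventually_ge_atTop N] with n hn
      have h1 : (N : ℝ) ≤ n := by exact_mod_cast hn
      rw [hzero n z]
      · simp
      · rw [div_lt_iff₀ hd] at hN
        rw [div_le_iff₀ (by positivity)]
        nlinarith

/-- A column of a square matrix as a Euclidean vector. -/
def colE {d : ℕ} (M : Matrix (Fin d) (Fin d) ℝ) (k : Fin d) : Vec d :=
  WithLp.toLp 2 fun i => M i k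

lemma trace_mul_transpose_mul {d : ℕ} (M H : Matrix (Fin d) (Fin d) ℝ) {X : Vec d →L[ℝ] Vec d}
    (hX : (Matrix.toEuclideanLin H).toContinuousLinearMap = X) :
    Matrix.trace (M * Mᵀ * H) = ∑ k, ⟪X (colE M k), colE M k⟫ := by
  rw [Matrix.mul_assoc, Matrix.trace_mul_comm, ← hX]
  simp only [Matrix.trace, Matrix.diag_apply]
  refine Finset.sum_congr rfl fun k _ => ?_
  rw [real_inner_comm]
  simp only [colE, PiLp.inner_apply, LinearMap.coe_toContinuousLinearMap', Matrix.toLpLin_apply,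
    RCLike.inner_apply, conj_trivial]
  rw [Matrix.mul_assoc, Matrix.mul_apply]
  refine Finset.sum_congr rfl fun i _ => ?_
  rw [Matrix.transpose_apply, Matrix.mul_apply, mul_comm]
  rfl

lemma mvE_transpose_apply {d : ℕ} (M : Matrix (Fin d) (Fin d) ℝ) (v : Vec d) (k : Fin d) :
    mvE Mᵀ v k = ⟪colE M k, v⟫ := by
  simp [mvE, colE, PiLp.inner_apply, Matrix.mulVec, dotProduct, mul_comm]

lemma norm_le_sum_abs {d : ℕ} (v : Vec d) : ‖v‖ ≤ ∑ i, |v i| := by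
  have hv : v = ∑ i, v i • EuclideanSpace.single i (1 : ℝ) := by
    ext i; simp [Finset.sum_apply, Pi.single_apply]
  conv_lhs => rw [hv]
  refine (norm_sum_le _ _).trans (Finset.sum_le_sum fun i _ => ?_)
  rw [norm_smul]; simp

lemma norm_mvE_transpose_sub_le {d : ℕ} (M N : Matrix (Fin d) (Fin d) ℝ) (v w : Vec d) :
    ‖mvE Mᵀ v - mvE Nᵀ w‖ ≤
      (∑ k, ‖colE M k - colE N k‖) * ‖v‖ + (∑ k, ‖colE N k‖) * ‖v - w‖ := by
  refine (norm_le_sum_abs _).trans ?_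
  rw [Finset.sum_mul, Finset.sum_mul, ← Finset.sum_add_distrib]
  refine Finset.sum_le_sum fun k _ => ?_
  have h1 : (mvE Mᵀ v - mvE Nᵀ w) k = ⟪colE M k - colE N k, v⟫ + ⟪colE N k, v - w⟫ := by
    rw [PiLp.sub_apply, mvE_transpose_apply, mvE_transpose_apply, inner_sub_left, inner_sub_right]
    ring
  rw [h1]
  exact (abs_add_le _ _).trans
    (add_le_add (abs_real_inner_le_norm _ _) (abs_real_inner_le_norm _ _))

lemma norm_mvE_transpose_le {d : ℕ} (M : Matrix (Fin d) (Fin d) ℝ) (v : Vec d) :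
    ‖mvE Mᵀ v‖ ≤ (∑ k, ‖colE M k‖) * ‖v‖ := by
  have h := norm_mvE_transpose_sub_le M M v 0
  have h0 : mvE Mᵀ (0 : Vec d) = 0 := by
    ext k; rw [mvE_transpose_apply, inner_zero_right]; rfl
  rw [h0] at h
  simpa using h

lemma mvE_smul {d : ℕ} (M : Matrix (Fin d) (Fin d) ℝ) (r : ℝ) (v : Vec d) :
    mvE Mᵀ (r • v) = r • mvE Mᵀ v := by
  ext k
  rw [PiLp.smul_apply, mvE_transpose_apply, mvE_transpose_apply, real_inner_smul_right]
  rfl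

/-- The truncated compensated nonlocal operator applied to a measurable function, with a given
gradient. -/
def Kfun (ν : Measure (Vec n)) (η : Vec m → Vec d → Vec n → Vec d) (ε : ℝ) (α : Vec m)
    (u : Vec d → ℝ) (x p : Vec d) : ℝ :=
  ∫ e, (u (x + η α x e) - u x - ⟪η α x e, p⟫) ∂(ν.restrict {e : Vec n | ε < ‖e‖})

/-- The truncated weighted nonlocal operator applied to a measurable function. -/
def Bfun (ν : Measure (Vec n)) (η : Vec m → Vec d → Vec n → Vec d) (γ : Vec d → Vec n → ℝ)
    (ε : ℝ) (α : Vec m) (u : Vec d → ℝ) (x : Vec d) : ℝ :=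
  ∫ e, (u (x + η α x e) - u x) * γ x e ∂(ν.restrict {e : Vec n | ε < ‖e‖})

lemma isFiniteMeasure_restrict_norm_gt {ν : Measure (Vec n)}
    (hν : Integrable (fun e => min 1 (‖e‖ ^ 2)) ν) {ε : ℝ} (hε : ε ∈ Ioo (0:ℝ) 1) :
    IsFiniteMeasure (ν.restrict {e : Vec n | ε < ‖e‖}) := by
  refine ⟨?_⟩
  rw [Measure.restrict_apply_univ]
  have h := hν.measure_gt_lt_top (ε := ε ^ 2 / 2) (by have := hε.1; positivity)
  refine lt_of_le_of_lt (measure_mono fun e he => ?_) h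
  have he' : ε < ‖e‖ := he
  have h1 := hε.1
  have h2 := hε.2
  change ε ^ 2 / 2 < min 1 (‖e‖ ^ 2)
  refine lt_min ?_ ?_ <;> nlinarith

lemma tendsto_integral_increment {μ : Measure (Vec n)} [IsFiniteMeasure μ] {φ : ℕ → Vec d → ℝ}
    {u : Vec d → ℝ} {B R : ℝ} (hφ : ∀ k, Continuous (φ k)) (hB : ∀ k x, |φ k x| ≤ B)
    (hlim : ∀ x, Tendsto (fun k => φ k x) atTop (𝓝 (u x))) {h : Vec n → Vec d}
    (hh : Measurable h) {w l : Vec n → ℝ} (hw : Measurable w) (hl : Measurable l)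
    (hwR : ∀ e, |w e| ≤ R) (hlR : ∀ e, |l e| ≤ R) (x : Vec d) :
    Tendsto (fun k => ∫ e, (φ k (x + h e) - φ k x - l e) * w e ∂μ) atTop
      (𝓝 (∫ e, (u (x + h e) - u x - l e) * w e ∂μ)) := by
  refine tendsto_integral_of_dominated_convergence (fun _ => (B + B + R) * R) (fun k => ?_)
    (integrable_const _) (fun k => ae_of_all _ fun e => ?_) (ae_of_all _ fun e => ?_)
  · exact ((((hφ k).measurable.comp (hh.const_add x)).sub measurable_const).sub
      hl |>.mul hw).aestronglyMeasurable
  · rw [Real.norm_eq_abs, abs_mul]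
    have h1 : |φ k (x + h e) - φ k x - l e| ≤ B + B + R :=
      (abs_sub _ _).trans (add_le_add ((abs_sub _ _).trans (add_le_add (hB k _) (hB k _))) (hlR e))
    exact mul_le_mul h1 (hwR e) (abs_nonneg _) ((abs_nonneg _).trans h1)
  · exact (((hlim _).sub (hlim _)).sub tendsto_const_nhds).mul tendsto_const_nhds

section
variable {ν : Measure (Vec n)} {A : Set (Vec m)} {T : ℝ}
    {b : Vec m → Vec d → Vec d} {σ : Vec m → Vec d → Matrix (Fin d) (Fin d) ℝ}
    {η : Vec m → Vec d → Vec n → Vec d} {γ : Vec d → Vec n → ℝ}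
    {f : Vec m → ℝ → Vec d → ℝ → Vec d → ℝ → ℝ}
    {ζ : ℝ → Vec d → ℝ} {g : Vec d → ℝ} {C : ℝ}

lemma AssumptionA.norm_jump_le (hA : AssumptionA ν A T b σ η γ f ζ g C) {α : Vec m} (hα : α ∈ A)
    (x : Vec d) (e : Vec n) : ‖η α x e‖ ≤ C :=
  (hA.hη_bdd α hα x e).trans (mul_le_of_le_one_right hA.hC.le (min_le_left _ _))

lemma AssumptionA.weight_le (hA : AssumptionA ν A T b σ η γ f ζ g C)
    (x : Vec d) (e : Vec n) : γ x e ≤ C :=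
  (hA.hγ_bdd x e).trans (mul_le_of_le_one_right hA.hC.le (min_le_left _ _))

/-- Test functions realising a given local test function, whose nonlocal terms converge to those
of the touched function. -/
lemma exists_testFunctions (hA : AssumptionA ν A T b σ η γ f ζ g C) {ε : ℝ}
    (hε : ε ∈ Ioo (0:ℝ) 1) {α : Vec m} (hα : α ∈ A) {u : ℝ → Vec d → ℝ} {M : ℝ}
    (hM : ∀ t x, |u t x| ≤ M)
    (hu : UpperSemicontinuousOn (fun p : ℝ × Vec d => u p.1 p.2) (Icc 0 T ×ˢ univ))
    {t₀ : ℝ} (ht₀ : t₀ ∈ Icc (0:ℝ) T) {x₀ : Vec d} {Φ : ℝ × Vec d → ℝ} (hΦ : ContDiff ℝ 2 Φ)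
    (h0 : Φ (t₀, x₀) = u t₀ x₀)
    (hle : ∀ᶠ z in 𝓝[Icc 0 T ×ˢ univ] (t₀, x₀), u z.1 z.2 ≤ Φ z)
    {a : ℝ} {G : Vec d → Vec d} {X : Vec d →L[ℝ] Vec d}
    (ha : HasDerivAt (fun t => Φ (t, x₀)) a t₀)
    (hG : ∀ x, HasGradientAt (fun y => Φ (t₀, y)) (G x) x) (hX : HasFDerivAt G X x₀) :
    ∃ φ : ℕ → C12 d, ∀ k,
      (∀ t ∈ Icc (0:ℝ) T, ∀ x, u t x ≤ (φ k).toFun t x) ∧ (φ k).toFun t₀ x₀ = u t₀ x₀ ∧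
      (φ k).dt t₀ x₀ = a ∧ (φ k).grad t₀ x₀ = G x₀ ∧
      (Matrix.toEuclideanLin ((φ k).hess t₀ x₀)).toContinuousLinearMap = X ∧
      Tendsto (fun k => Ktr ν η ε (φ k) α t₀ x₀) atTop
        (𝓝 (Kfun ν η ε α (u t₀) x₀ (G x₀))) ∧
      Tendsto (fun k => Btr ν η γ ε (φ k) α t₀ x₀) atTop (𝓝 (Bfun ν η γ ε α (u t₀) x₀)) := by
  have hfin := isFiniteMeasure_restrict_norm_gt hA.hν_int hε
  have hz₀ : (t₀, x₀) ∈ Icc 0 T ×ˢ (univ : Set (Vec d)) := ⟨ht₀, mem_univ _⟩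
  obtain ⟨φ, B, hφ, huφ, hφB, hφΦ, hφt⟩ := exists_contDiff_tendsto_of_touching hz₀
    (fun z _ => hM z.1 z.2) hu hΦ h0 hle
  have hder := fun k => (C12.ofContDiff (φ k) (hφ k)).derivs_eq (hφΦ k) ha hG hX
  have hmem : ∀ x : Vec d, (t₀, x) ∈ Icc 0 T ×ˢ (univ : Set (Vec d)) :=
    fun x => ⟨ht₀, mem_univ _⟩
  have hcont : ∀ k, Continuous fun x => φ k (t₀, x) := fun k =>
    (hφ k).continuous.comp (Continuous.prodMk_right t₀)
  have hηm := hA.hη_meas α x₀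
  refine ⟨fun k => C12.ofContDiff (φ k) (hφ k),
    fun k => ⟨fun t ht x => huφ k (t, x) ⟨ht, mem_univ _⟩,
    (hφΦ k).self_of_nhds.trans h0, (hder k).1, (hder k).2.1, (hder k).2.2, ?_, ?_⟩⟩
  · have h1 := tendsto_integral_increment (μ := ν.restrict {e : Vec n | ε < ‖e‖})
      (φ := fun k x => φ k (t₀, x)) (u := u t₀) (B := B) (R := max 1 (C * ‖G x₀‖)) hcont
      (fun k x => hφB k _ (hmem x)) (fun x => hφt _ (hmem x)) hηm (w := fun _ => 1)
      (l := fun e => ⟪η α x₀ e, G x₀⟫) measurable_const (hηm.inner measurable_const)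
      (fun e => by simp) (fun e => (abs_real_inner_le_norm _ _).trans ((mul_le_mul_of_nonneg_right
        (hA.norm_jump_le hα x₀ e) (norm_nonneg _)).trans (le_max_right _ _))) x₀
    simp only [mul_one] at h1
    refine h1.congr fun k => ?_
    have h2 : (C12.ofContDiff (φ k) (hφ k)).grad t₀ x₀ = G x₀ := (hder k).2.1
    simp only [Ktr, Kop, h2]
    rfl
  · have h1 := tendsto_integral_increment (μ := ν.restrict {e : Vec n | ε < ‖e‖})
      (φ := fun k x => φ k (t₀, x)) (u := u t₀) (B := B) (R := C) hcont
      (fun k x => hφB k _ (hmem x)) (fun x => hφt _ (hmem x)) hηm (w := fun e => γ x₀ e)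
      (l := fun e => 0) (hA.hγ_meas x₀) measurable_const
      (fun e => by rw [abs_of_nonneg (hA.hγ_nonneg _ _)]; exact hA.weight_le x₀ e)
      (fun e => by simpa using hA.hC.le) x₀
    simp only [sub_zero] at h1
    exact h1

lemma AssumptionA.continuous_of_mem (hA : AssumptionA ν A T b σ η γ f ζ g C) {α : Vec m}
    (hα : α ∈ A) {t : ℝ} (ht : t ∈ Icc (0:ℝ) T) (x : Vec d) (u : ℝ) (p : Vec d) :
    Continuous fun k => f α t x u p k := by
  have : LipschitzWith C.toNNReal fun k => f α t x u p k := by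
    refine LipschitzWith.of_dist_le_mul fun k k' => ?_
    have := hA.hf_lip α hα α hα t ht x u u p p k k'
    rw [Real.coe_toNNReal _ hA.hC.le, Real.dist_eq, Real.dist_eq]
    simpa using this
  exact this.continuous

/-- The subsolution inequality at a local test function. -/
lemma SubsolnSwitch.le_of_touching (hA : AssumptionA ν A T b σ η γ f ζ g C) {ε : ℝ}
    (hε : ε ∈ Ioo (0:ℝ) 1) {J : ℕ} {αs : Fin J → Vec m} (hαs : ∀ j, αs j ∈ A) {c : ℝ}
    {U : Fin J → ℝ → Vec d → ℝ} (hU : SubsolnSwitch ν T b σ η γ f ζ ε αs c U) {M : ℝ}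
    (hM : ∀ j t x, |U j t x| ≤ M)
    (hu : ∀ j, UpperSemicontinuousOn (fun p : ℝ × Vec d => U j p.1 p.2) (Icc 0 T ×ˢ univ))
    {j : Fin J} {t₀ : ℝ} (ht₀ : t₀ ∈ Ioc (0:ℝ) T) {x₀ : Vec d}
    (hζ : ζ t₀ x₀ < U j t₀ x₀) (hsw : MaxSw U c j t₀ x₀ < U j t₀ x₀)
    {Φ : ℝ × Vec d → ℝ} (hΦ : ContDiff ℝ 2 Φ) (h0 : Φ (t₀, x₀) = U j t₀ x₀)
    (hle : ∀ᶠ z in 𝓝[Icc 0 T ×ˢ univ] (t₀, x₀), U j z.1 z.2 ≤ Φ z)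
    {a : ℝ} {G : Vec d → Vec d} {X : Vec d →L[ℝ] Vec d}
    (ha : HasDerivAt (fun t => Φ (t, x₀)) a t₀)
    (hG : ∀ x, HasGradientAt (fun y => Φ (t₀, y)) (G x) x) (hX : HasFDerivAt G X x₀) :
    a ≤ 1 / 2 * ∑ k, ⟪X (colE (sigmaTilde ν σ η ε (αs j) x₀) k),
        colE (sigmaTilde ν σ η ε (αs j) x₀) k⟫ + ⟪b (αs j) x₀, G x₀⟫
      + Kfun ν η ε (αs j) (U j t₀) x₀ (G x₀)
      + f (αs j) t₀ x₀ (U j t₀ x₀) (mvE ((sigmaTilde ν σ η ε (αs j) x₀)ᵀ) (G x₀))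
          (Bfun ν η γ ε (αs j) (U j t₀) x₀) := by
  have ht₀' : t₀ ∈ Icc (0:ℝ) T := ⟨ht₀.1.le, ht₀.2⟩
  obtain ⟨φ, hφ⟩ := exists_testFunctions hA hε (hαs j) (hM j) (hu j) ht₀' hΦ h0 hle ha hG hX
  have hK := (hφ 0).2.2.2.2.2.1
  have hB := (hφ 0).2.2.2.2.2.2
  have hf := ((hA.continuous_of_mem (hαs j) ht₀' x₀ (U j t₀ x₀)
    (mvE ((sigmaTilde ν σ η ε (αs j) x₀)ᵀ) (G x₀))).tendsto _).comp hB
  refine ge_of_tendsto' ((tendsto_const_nhds.add hK).add hf) fun k => ?_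
  obtain ⟨h1, h2, h3, h4, h5, -, -⟩ := hφ k
  have h6 := hU j (φ k) t₀ x₀ ht₀ fun t ht x => by
    have := h1 t ht x
    linarith
  rw [min_le_iff, min_le_iff] at h6
  have h7 : (φ k).dt t₀ x₀ - Ltr ν b σ η ε (φ k) (αs j) t₀ x₀
          - f (αs j) t₀ x₀ (U j t₀ x₀)
              (mvE ((sigmaTilde ν σ η ε (αs j) x₀)ᵀ) ((φ k).grad t₀ x₀))
              (Btr ν η γ ε (φ k) (αs j) t₀ x₀) ≤ 0 := by
    rcases h6 with h6 | h6 | h6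
    · linarith
    · exact h6
    · linarith
  rw [h3, h4, Ltr, h4, trace_mul_transpose_mul _ _ h5] at h7
  simp only [Function.comp_apply]
  linarith

/-- The supersolution inequality at a local test function for the opposite function. -/
lemma SupersolnSwitch.le_of_touching (hA : AssumptionA ν A T b σ η γ f ζ g C) {ε : ℝ}
    (hε : ε ∈ Ioo (0:ℝ) 1) {J : ℕ} {αs : Fin J → Vec m} (hαs : ∀ j, αs j ∈ A) {c : ℝ}
    {V : Fin J → ℝ → Vec d → ℝ} (hV : SupersolnSwitch ν T b σ η γ f ζ ε αs c V) {M : ℝ}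
    (hM : ∀ j t x, |V j t x| ≤ M)
    (hv : ∀ j, LowerSemicontinuousOn (fun p : ℝ × Vec d => V j p.1 p.2) (Icc 0 T ×ˢ univ))
    {j : Fin J} {t₀ : ℝ} (ht₀ : t₀ ∈ Ioc (0:ℝ) T) {x₀ : Vec d}
    {Φ : ℝ × Vec d → ℝ} (hΦ : ContDiff ℝ 2 Φ) (h0 : Φ (t₀, x₀) = -V j t₀ x₀)
    (hle : ∀ᶠ z in 𝓝[Icc 0 T ×ˢ univ] (t₀, x₀), -V j z.1 z.2 ≤ Φ z)
    {a : ℝ} {G : Vec d → Vec d} {X : Vec d →L[ℝ] Vec d}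
    (ha : HasDerivAt (fun t => Φ (t, x₀)) a t₀)
    (hG : ∀ x, HasGradientAt (fun y => Φ (t₀, y)) (G x) x) (hX : HasFDerivAt G X x₀) :
    ζ t₀ x₀ ≤ V j t₀ x₀ ∧ MaxSw V c j t₀ x₀ ≤ V j t₀ x₀ ∧
    a ≤ 1 / 2 * ∑ k, ⟪X (colE (sigmaTilde ν σ η ε (αs j) x₀) k),
        colE (sigmaTilde ν σ η ε (αs j) x₀) k⟫ + ⟪b (αs j) x₀, G x₀⟫
      - Kfun ν η ε (αs j) (V j t₀) x₀ (-G x₀)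
      - f (αs j) t₀ x₀ (V j t₀ x₀) (mvE ((sigmaTilde ν σ η ε (αs j) x₀)ᵀ) (-G x₀))
          (Bfun ν η γ ε (αs j) (V j t₀) x₀) := by
  have ht₀' : t₀ ∈ Icc (0:ℝ) T := ⟨ht₀.1.le, ht₀.2⟩
  have hu : UpperSemicontinuousOn (fun p : ℝ × Vec d => -V j p.1 p.2) (Icc 0 T ×ˢ univ) :=
    (hv j).neg
  obtain ⟨φ, hφ⟩ := exists_testFunctions (u := fun t x => -V j t x) hA hε (hαs j)
    (fun t x => by rw [abs_neg]; exact hM j t x) hu ht₀' hΦ h0 hle ha hG hX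
  have hK := (hφ 0).2.2.2.2.2.1
  have hB := (hφ 0).2.2.2.2.2.2
  have hKV : Kfun ν η ε (αs j) (fun x => -V j t₀ x) x₀ (G x₀)
      = -Kfun ν η ε (αs j) (V j t₀) x₀ (-G x₀) := by
    simp only [Kfun]
    rw [← integral_neg]
    refine integral_congr_ae (ae_of_all _ fun e => ?_)
    simp only [inner_neg_right]; ring
  have hBV : Bfun ν η γ ε (αs j) (fun x => -V j t₀ x) x₀ = -Bfun ν η γ ε (αs j) (V j t₀) x₀ := by
    simp only [Bfun]
    rw [← integral_neg]
    refine integral_congr_ae (ae_of_all _ fun e => ?_)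
    dsimp only; ring
  have hsup : ∀ k, 0 ≤ min (V j t₀ x₀ - ζ t₀ x₀)
      (min (-a - (-(1 / 2 * ∑ k, ⟪X (colE (sigmaTilde ν σ η ε (αs j) x₀) k),
        colE (sigmaTilde ν σ η ε (αs j) x₀) k⟫ + ⟪b (αs j) x₀, G x₀⟫
          + Ktr ν η ε (φ k) (αs j) t₀ x₀))
          - f (αs j) t₀ x₀ (V j t₀ x₀)
              (mvE ((sigmaTilde ν σ η ε (αs j) x₀)ᵀ) (-G x₀))
              (-Btr ν η γ ε (φ k) (αs j) t₀ x₀))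
        (V j t₀ x₀ - MaxSw V c j t₀ x₀)) := by
    intro k
    obtain ⟨h1, h2, h3, h4, h5, -, -⟩ := hφ k
    have h6 := hV j (φ k).neg t₀ x₀ ht₀ fun t ht x => by
      have := h1 t ht x
      simp only [C12.neg]
      linarith
    have e1 : Ktr ν η ε (φ k).neg (αs j) t₀ x₀ = -Ktr ν η ε (φ k) (αs j) t₀ x₀ := by
      simp only [Ktr, Kop, C12.neg]
      rw [← integral_neg]
      refine integral_congr_ae (ae_of_all _ fun e => ?_)
      simp only [inner_neg_right]; ring
    have e2 : Btr ν η γ ε (φ k).neg (αs j) t₀ x₀ = -Btr ν η γ ε (φ k) (αs j) t₀ x₀ := by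
      simp only [Btr, Bop, C12.neg]
      rw [← integral_neg]
      refine integral_congr_ae (ae_of_all _ fun e => ?_)
      dsimp only; ring
    have e3 : Ltr ν b σ η ε (φ k).neg (αs j) t₀ x₀
        = -(1 / 2 * ∑ k, ⟪X (colE (sigmaTilde ν σ η ε (αs j) x₀) k),
        colE (sigmaTilde ν σ η ε (αs j) x₀) k⟫ + ⟪b (αs j) x₀, G x₀⟫
          + Ktr ν η ε (φ k) (αs j) t₀ x₀) := by
      rw [Ltr, e1, ← trace_mul_transpose_mul _ _ h5]
      simp only [C12.neg, Matrix.mul_neg, Matrix.trace_neg, inner_neg_right, h4]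
      ring
    rw [e2, e3] at h6
    simp only [C12.neg, h3, h4] at h6
    exact h6
  simp only [le_min_iff] at hsup
  refine ⟨by linarith [(hsup 0).1], by linarith [(hsup 0).2.2], ?_⟩
  have hf := ((hA.continuous_of_mem (hαs j) ht₀' x₀ (V j t₀ x₀)
    (mvE ((sigmaTilde ν σ η ε (αs j) x₀)ᵀ) (-G x₀))).tendsto _).comp hB.neg
  rw [hBV, neg_neg] at hf
  rw [hKV] at hK
  have hlim := (tendsto_const_nhds (x := 1 / 2 * ∑ k, ⟪X (colE (sigmaTilde ν σ η ε (αs j) x₀) k),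
        colE (sigmaTilde ν σ η ε (αs j) x₀) k⟫ + ⟪b (αs j) x₀, G x₀⟫)).add hK |>.sub hf
  rw [← sub_eq_add_neg] at hlim
  refine ge_of_tendsto' hlim fun k => ?_
  have := (hsup k).2.1
  simp only [Function.comp_apply]
  linarith

end

/-- A logarithmic penalty at infinity. -/
def logPen {d : ℕ} (x : Vec d) : ℝ := Real.log (1 + ‖x‖ ^ 2)

/-- The gradient of the logarithmic penalty. -/
def logPenGrad {d : ℕ} (x : Vec d) : Vec d := (2 / (1 + ‖x‖ ^ 2)) • x

/-- The Hessian of the logarithmic penalty. -/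
def logPenHess {d : ℕ} (x : Vec d) : Vec d →L[ℝ] Vec d :=
  (2 / (1 + ‖x‖ ^ 2)) • ContinuousLinearMap.id ℝ (Vec d)
    - (4 / (1 + ‖x‖ ^ 2) ^ 2) • (innerSL ℝ x).smulRight x

lemma logPen_nonneg {d : ℕ} (x : Vec d) : 0 ≤ logPen x :=
  Real.log_nonneg (by nlinarith [sq_nonneg ‖x‖])

lemma contDiff_logPen {d : ℕ} : ContDiff ℝ 2 (logPen (d := d)) :=
  (contDiff_const.add (contDiff_norm_sq ℝ)).log fun x => by positivity

lemma hasGradientAt_logPen {d : ℕ} (x : Vec d) : HasGradientAt logPen (logPenGrad x) x := by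
  rw [hasGradientAt_iff_hasFDerivAt]
  have h1 : HasFDerivAt (fun y : Vec d => 1 + ‖y‖ ^ 2) (2 • innerSL ℝ x) x :=
    (hasStrictFDerivAt_norm_sq x).hasFDerivAt.const_add 1
  refine (h1.log (by positivity)).congr_fderiv ?_
  ext v
  simp only [logPenGrad, InnerProductSpace.toDual_apply_apply, real_inner_smul_left, smul_apply,
    innerSL_apply_apply, smul_eq_mul, nsmul_eq_mul]
  push_cast
  ring

lemma hasFDerivAt_logPenGrad {d : ℕ} (x : Vec d) :
    HasFDerivAt logPenGrad (logPenHess x) x := by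
  have h1 : HasFDerivAt (fun y : Vec d => 1 + ‖y‖ ^ 2) (2 • innerSL ℝ x) x :=
    (hasStrictFDerivAt_norm_sq x).hasFDerivAt.const_add 1
  have h0 : (1 + ‖x‖ ^ 2) ≠ 0 := by positivity
  have h2 : HasFDerivAt (fun y : Vec d => 2 / (1 + ‖y‖ ^ 2))
      ((-2 / (1 + ‖x‖ ^ 2) ^ 2) • (2 • innerSL ℝ x)) x := by
    have h3 : HasDerivAt (fun s : ℝ => 2 / s) (-2 / (1 + ‖x‖ ^ 2) ^ 2) (1 + ‖x‖ ^ 2) := by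
      have := (hasDerivAt_inv h0).const_mul (2 : ℝ)
      simp only [← div_eq_mul_inv] at this
      refine this.congr_deriv ?_
      ring
    exact h3.comp_hasFDerivAt x h1
  have h4 := h2.smul (hasFDerivAt_id x)
  refine h4.congr_fderiv ?_
  ext v : 1
  simp only [logPenHess, sub_apply, add_apply, smul_apply, ContinuousLinearMap.smulRight_apply,
    ContinuousLinearMap.id_apply, innerSL_apply_apply, smul_smul, id_eq, nsmul_eq_mul, smul_eq_mul]
  rw [sub_eq_add_neg, ← neg_smul]
  congr 2
  push_cast
  ring

lemma norm_logPenGrad {d : ℕ} (x : Vec d) : ‖logPenGrad x‖ = 2 / (1 + ‖x‖ ^ 2) * ‖x‖ := by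
  rw [logPenGrad, norm_smul, Real.norm_of_nonneg (by positivity)]

lemma norm_logPenGrad_le_one {d : ℕ} (x : Vec d) : ‖logPenGrad x‖ ≤ 1 := by
  rw [norm_logPenGrad, div_mul_eq_mul_div, div_le_one (by positivity)]
  nlinarith [sq_nonneg (‖x‖ - 1)]

lemma one_add_norm_mul_logPenGrad_le {d : ℕ} (x : Vec d) : (1 + ‖x‖) * ‖logPenGrad x‖ ≤ 4 := by
  rw [norm_logPenGrad, div_mul_eq_mul_div, mul_div_assoc', div_le_iff₀ (by positivity)]
  nlinarith [sq_nonneg (‖x‖ - 1)]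

lemma abs_inner_logPenHess_le {d : ℕ} (x h : Vec d) :
    (1 + ‖x‖) ^ 2 * |⟪logPenHess x h, h⟫| ≤ 12 * ‖h‖ ^ 2 := by
  have h1 : ⟪logPenHess x h, h⟫
      = 2 / (1 + ‖x‖ ^ 2) * ‖h‖ ^ 2 - 4 / (1 + ‖x‖ ^ 2) ^ 2 * ⟪x, h⟫ ^ 2 := by
    simp only [logPenHess, sub_apply, smul_apply, ContinuousLinearMap.smulRight_apply,
      ContinuousLinearMap.id_apply, innerSL_apply_apply, inner_sub_left, real_inner_smul_left,
      real_inner_self_eq_norm_sq]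
    ring
  have h2 : ⟪x, h⟫ ^ 2 ≤ ‖x‖ ^ 2 * ‖h‖ ^ 2 := by
    rw [← mul_pow, ← sq_abs]
    exact pow_le_pow_left₀ (abs_nonneg _) (abs_real_inner_le_norm x h) 2
  have hq : 0 < 1 + ‖x‖ ^ 2 := by positivity
  have h3 : |⟪logPenHess x h, h⟫| ≤ 6 / (1 + ‖x‖ ^ 2) * ‖h‖ ^ 2 := by
    rw [h1]
    refine (abs_sub _ _).trans ?_
    rw [abs_of_nonneg (by positivity), abs_of_nonneg (by positivity)]
    have h4 : 4 / (1 + ‖x‖ ^ 2) ^ 2 * ⟪x, h⟫ ^ 2 ≤ 4 / (1 + ‖x‖ ^ 2) * ‖h‖ ^ 2 := by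
      calc 4 / (1 + ‖x‖ ^ 2) ^ 2 * ⟪x, h⟫ ^ 2
          ≤ 4 / (1 + ‖x‖ ^ 2) ^ 2 * ((1 + ‖x‖ ^ 2) * ‖h‖ ^ 2) := by
            gcongr
            nlinarith [sq_nonneg ‖h‖]
        _ = _ := by field_simp
    calc _ ≤ 2 / (1 + ‖x‖ ^ 2) * ‖h‖ ^ 2 + 4 / (1 + ‖x‖ ^ 2) * ‖h‖ ^ 2 := by linarith
      _ = _ := by ring
  calc (1 + ‖x‖) ^ 2 * |⟪logPenHess x h, h⟫|
      ≤ (2 * (1 + ‖x‖ ^ 2)) * (6 / (1 + ‖x‖ ^ 2) * ‖h‖ ^ 2) := by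
        gcongr
        nlinarith [sq_nonneg (‖x‖ - 1)]
    _ = _ := by field_simp; ring

lemma abs_logPen_sub_le {d : ℕ} (x y : Vec d) : |logPen x - logPen y| ≤ ‖x - y‖ := by
  have h := Convex.norm_image_sub_le_of_norm_hasFDerivWithin_le (𝕜 := ℝ) (f := logPen (d := d))
    (f' := fun x => InnerProductSpace.toDual ℝ (Vec d) (logPenGrad x)) (C := 1) (s := univ)
    (x := y) (y := x)
    (fun z _ => (hasGradientAt_iff_hasFDerivAt.1 (hasGradientAt_logPen z)).hasFDerivWithinAt)
    (fun z _ => by rw [LinearIsometryEquiv.norm_map]; exact norm_logPenGrad_le_one z)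
    convex_univ (mem_univ _) (mem_univ _)
  simpa using h

/-- A quadratic polynomial with a multiple of the logarithmic penalty. -/
def penQuad {d : ℕ} (A₀ a c₀ β : ℝ) (p : Vec d) (X : Vec d →L[ℝ] Vec d) (t₀ : ℝ) (x₀ : Vec d)
    (z : ℝ × Vec d) : ℝ :=
  A₀ + a * (z.1 - t₀) + c₀ * (z.1 - t₀) ^ 2 + ⟪p, z.2 - x₀⟫
    + 1 / 2 * ⟪X (z.2 - x₀), z.2 - x₀⟫ + β * (logPen z.2 - logPen x₀)

lemma contDiff_penQuad {d : ℕ} (A₀ a c₀ β : ℝ) (p : Vec d) (X : Vec d →L[ℝ] Vec d) (t₀ : ℝ)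
    (x₀ : Vec d) : ContDiff ℝ 2 (penQuad A₀ a c₀ β p X t₀ x₀) := by
  have h1 : ContDiff ℝ 2 fun z : ℝ × Vec d => z.1 - t₀ := contDiff_fst.sub contDiff_const
  have h2 : ContDiff ℝ 2 fun z : ℝ × Vec d => z.2 - x₀ := contDiff_snd.sub contDiff_const
  have h3 : ContDiff ℝ 2 fun z : ℝ × Vec d => logPen z.2 := contDiff_logPen.comp contDiff_snd
  unfold penQuad
  exact (((((contDiff_const.add (contDiff_const.mul h1)).add (contDiff_const.mul (h1.pow 2))).add
    (contDiff_const.inner ℝ h2)).add (contDiff_const.mul ((X.contDiff.comp h2).inner ℝ h2)))).add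
    (contDiff_const.mul (h3.sub contDiff_const))

lemma hasDerivAt_penQuad {d : ℕ} (A₀ a c₀ β : ℝ) (p : Vec d) (X : Vec d →L[ℝ] Vec d) (t₀ : ℝ)
    (x₀ : Vec d) : HasDerivAt (fun t => penQuad A₀ a c₀ β p X t₀ x₀ (t, x₀)) a t₀ := by
  have h1 : HasDerivAt (fun t : ℝ => t - t₀) 1 t₀ := (hasDerivAt_id t₀).sub_const t₀
  have h2 := ((h1.const_mul a).const_add A₀).add ((h1.pow 2).const_mul c₀)
  refine (h2.congr_deriv (by simp)).congr_of_eventuallyEq (Eventually.of_forall fun t => ?_)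
  simp [penQuad]

lemma hasGradientAt_penQuad {d : ℕ} (A₀ a c₀ β : ℝ) (p : Vec d) {X : Vec d →L[ℝ] Vec d}
    (hX : ∀ h k, ⟪X h, k⟫ = ⟪h, X k⟫) (t₀ : ℝ) (x₀ x : Vec d) :
    HasGradientAt (fun y => penQuad A₀ a c₀ β p X t₀ x₀ (t₀, y))
      (p + X (x - x₀) + β • logPenGrad x) x := by
  rw [hasGradientAt_iff_hasFDerivAt]
  have h1 : HasFDerivAt (fun y : Vec d => y - x₀) (ContinuousLinearMap.id ℝ (Vec d)) x :=
    (hasFDerivAt_id x).sub_const x₀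
  have h2 : HasFDerivAt (fun y : Vec d => ⟪p, y - x₀⟫) (innerSL ℝ p) x :=
    (innerSL ℝ p).hasFDerivAt.comp x h1
  have h3 := ((X.hasFDerivAt.comp x h1).inner ℝ h1).const_mul (1 / 2)
  have h4 := ((hasGradientAt_iff_hasFDerivAt.1 (hasGradientAt_logPen x)).sub_const
    (logPen x₀)).const_mul β
  have h5 := ((h2.const_add A₀).add h3).add h4
  refine (h5.congr_fderiv ?_).congr_of_eventuallyEq (Eventually.of_forall fun y => ?_)
  · apply ContinuousLinearMap.ext
    intro v
    simp only [add_apply, smul_apply, innerSL_apply_apply, InnerProductSpace.toDual_apply_apply,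
      smul_eq_mul, inner_add_left, real_inner_smul_left, ContinuousLinearMap.comp_apply,
      ContinuousLinearMap.prod_apply, ContinuousLinearMap.id_apply, fderivInnerCLM_apply,
      Function.comp_apply]
    rw [hX v, real_inner_comm (X (x - x₀)) v, ← real_inner_comm (X (x - x₀)) v]
    have h6 : ⟪v, X (x - x₀)⟫ = ⟪X (x - x₀), v⟫ := real_inner_comm _ _
    linarith
  · simp [penQuad]

lemma hasFDerivAt_penQuadGrad {d : ℕ} (β : ℝ) (p : Vec d) (X : Vec d →L[ℝ] Vec d)
    (x₀ x : Vec d) :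
    HasFDerivAt (fun x => p + X (x - x₀) + β • logPenGrad x) (X + β • logPenHess x) x := by
  have h1 : HasFDerivAt (fun y : Vec d => y - x₀) (ContinuousLinearMap.id ℝ (Vec d)) x :=
    (hasFDerivAt_id x).sub_const x₀
  have h2 := ((X.hasFDerivAt.comp x h1).const_add p).add ((hasFDerivAt_logPenGrad x).const_smul β)
  exact h2

section
variable {ν : Measure (Vec n)} {A : Set (Vec m)} {T : ℝ}
    {b : Vec m → Vec d → Vec d} {σ : Vec m → Vec d → Matrix (Fin d) (Fin d) ℝ}
    {η : Vec m → Vec d → Vec n → Vec d} {γ : Vec d → Vec n → ℝ}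
    {f : Vec m → ℝ → Vec d → ℝ → Vec d → ℝ → ℝ}
    {ζ : ℝ → Vec d → ℝ} {g : Vec d → ℝ} {C : ℝ}

/-- The subsolution inequality at a jet of a scaled and penalised subsolution. -/
lemma SubsolnSwitch.le_of_jet (hA : AssumptionA ν A T b σ η γ f ζ g C) {ε : ℝ}
    (hε : ε ∈ Ioo (0:ℝ) 1) {J : ℕ} {αs : Fin J → Vec m} (hαs : ∀ j, αs j ∈ A) {c : ℝ}
    {U : Fin J → ℝ → Vec d → ℝ} (hU : SubsolnSwitch ν T b σ η γ f ζ ε αs c U) {M : ℝ}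
    (hM : ∀ j t x, |U j t x| ≤ M)
    (hu : ∀ j, UpperSemicontinuousOn (fun p : ℝ × Vec d => U j p.1 p.2) (Icc 0 T ×ˢ univ))
    {j : Fin J} {t₀ : ℝ} (ht₀ : t₀ ∈ Ioc (0:ℝ) T) {x₀ : Vec d}
    (hζ : ζ t₀ x₀ < U j t₀ x₀) (hsw : MaxSw U c j t₀ x₀ < U j t₀ x₀)
    {w a c₀ β : ℝ} (hw : 0 < w) {p P : Vec d} {X : Vec d →L[ℝ] Vec d}
    (hX : ∀ h k, ⟪X h, k⟫ = ⟪h, X k⟫)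
    (hle : ∀ᶠ z in 𝓝[Icc 0 T ×ˢ univ] (t₀, x₀), w * U j z.1 z.2 - β * logPen z.2 ≤
      w * U j t₀ x₀ - β * logPen x₀ + a * (z.1 - t₀) + c₀ * (z.1 - t₀) ^ 2 + ⟪p, z.2 - x₀⟫
        + 1 / 2 * ⟪X (z.2 - x₀), z.2 - x₀⟫)
    (hP : P = p + β • logPenGrad x₀) :
    a ≤ 1 / 2 * ∑ k, ⟪X (colE (sigmaTilde ν σ η ε (αs j) x₀) k),
        colE (sigmaTilde ν σ η ε (αs j) x₀) k⟫
      + β / 2 * ∑ k, ⟪logPenHess x₀ (colE (sigmaTilde ν σ η ε (αs j) x₀) k),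
        colE (sigmaTilde ν σ η ε (αs j) x₀) k⟫
      + ⟪b (αs j) x₀, P⟫
      + w * Kfun ν η ε (αs j) (U j t₀) x₀ (w⁻¹ • P)
      + w * f (αs j) t₀ x₀ (U j t₀ x₀)
          (w⁻¹ • mvE ((sigmaTilde ν σ η ε (αs j) x₀)ᵀ) P)
          (Bfun ν η γ ε (αs j) (U j t₀) x₀) := by
  have hX' : ∀ h k, ⟪(w⁻¹ • X) h, k⟫ = ⟪h, (w⁻¹ • X) k⟫ := fun h k => by
    rw [smul_apply, smul_apply, real_inner_smul_left, real_inner_smul_right, hX]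
  have h := hU.le_of_touching hA hε hαs hM hu ht₀ hζ hsw
    (contDiff_penQuad (U j t₀ x₀) (w⁻¹ * a) (w⁻¹ * c₀) (w⁻¹ * β) (w⁻¹ • p) (w⁻¹ • X) t₀ x₀)
    (by simp [penQuad])
    (by
      filter_upwards [hle] with z hz
      rw [← mul_le_mul_iff_right₀ hw]
      refine le_trans (by linarith [hz] : w * U j z.1 z.2 ≤ w * U j t₀ x₀ + a * (z.1 - t₀)
        + c₀ * (z.1 - t₀) ^ 2 + ⟪p, z.2 - x₀⟫ + 1 / 2 * ⟪X (z.2 - x₀), z.2 - x₀⟫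
        + β * (logPen z.2 - logPen x₀)) (le_of_eq ?_)
      rw [penQuad, smul_apply, real_inner_smul_left, real_inner_smul_left]
      field_simp)
    (hasDerivAt_penQuad _ _ _ _ _ _ _ _)
    (fun x => hasGradientAt_penQuad _ _ _ _ _ hX' _ _ x)
    (hasFDerivAt_penQuadGrad _ _ _ _ _)
  have hG : w⁻¹ • p + (w⁻¹ • X) (x₀ - x₀) + (w⁻¹ * β) • logPenGrad x₀ = w⁻¹ • P := by
    rw [hP, sub_self, map_zero, add_zero, smul_add, smul_smul]
  rw [hG, mvE_smul, real_inner_smul_right] at h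
  simp only [add_apply, smul_apply, inner_add_left, real_inner_smul_left, Finset.sum_add_distrib,
    ← Finset.mul_sum] at h
  have h2 := mul_le_mul_of_nonneg_left h hw.le
  have e1 : w * (w⁻¹ * a) = a := by field_simp
  rw [e1] at h2
  refine h2.trans (le_of_eq ?_)
  field_simp

/-- The supersolution inequality at a jet of the opposite of a penalised supersolution. -/
lemma SupersolnSwitch.le_of_jet (hA : AssumptionA ν A T b σ η γ f ζ g C) {ε : ℝ}
    (hε : ε ∈ Ioo (0:ℝ) 1) {J : ℕ} {αs : Fin J → Vec m} (hαs : ∀ j, αs j ∈ A) {c : ℝ}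
    {V : Fin J → ℝ → Vec d → ℝ} (hV : SupersolnSwitch ν T b σ η γ f ζ ε αs c V) {M : ℝ}
    (hM : ∀ j t x, |V j t x| ≤ M)
    (hv : ∀ j, LowerSemicontinuousOn (fun p : ℝ × Vec d => V j p.1 p.2) (Icc 0 T ×ˢ univ))
    {j : Fin J} {t₀ : ℝ} (ht₀ : t₀ ∈ Ioc (0:ℝ) T) {x₀ : Vec d}
    {a c₀ β : ℝ} {p P : Vec d} {X : Vec d →L[ℝ] Vec d}
    (hX : ∀ h k, ⟪X h, k⟫ = ⟪h, X k⟫)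
    (hle : ∀ᶠ z in 𝓝[Icc 0 T ×ˢ univ] (t₀, x₀), -V j z.1 z.2 - β * logPen z.2 ≤
      -V j t₀ x₀ - β * logPen x₀ + a * (z.1 - t₀) + c₀ * (z.1 - t₀) ^ 2 + ⟪p, z.2 - x₀⟫
        + 1 / 2 * ⟪X (z.2 - x₀), z.2 - x₀⟫)
    (hP : P = p + β • logPenGrad x₀) :
    ζ t₀ x₀ ≤ V j t₀ x₀ ∧ MaxSw V c j t₀ x₀ ≤ V j t₀ x₀ ∧
    a ≤ 1 / 2 * ∑ k, ⟪X (colE (sigmaTilde ν σ η ε (αs j) x₀) k),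
        colE (sigmaTilde ν σ η ε (αs j) x₀) k⟫
      + β / 2 * ∑ k, ⟪logPenHess x₀ (colE (sigmaTilde ν σ η ε (αs j) x₀) k),
        colE (sigmaTilde ν σ η ε (αs j) x₀) k⟫
      + ⟪b (αs j) x₀, P⟫
      - Kfun ν η ε (αs j) (V j t₀) x₀ (-P)
      - f (αs j) t₀ x₀ (V j t₀ x₀) (mvE ((sigmaTilde ν σ η ε (αs j) x₀)ᵀ) (-P))
          (Bfun ν η γ ε (αs j) (V j t₀) x₀) := by
  have h := hV.le_of_touching (j := j) hA hε hαs hM hv ht₀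
    (contDiff_penQuad (-V j t₀ x₀) a c₀ β p X t₀ x₀)
    (by simp [penQuad])
    (by
      filter_upwards [hle] with z hz
      rw [penQuad]
      linarith)
    (hasDerivAt_penQuad _ _ _ _ _ _ _ _)
    (fun x => hasGradientAt_penQuad _ _ _ _ _ hX _ _ x)
    (hasFDerivAt_penQuadGrad _ _ _ _ _)
  have hG : p + X (x₀ - x₀) + β • logPenGrad x₀ = P := by
    rw [hP, sub_self, map_zero, add_zero]
  rw [hG] at h
  simp only [add_apply, smul_apply, inner_add_left, real_inner_smul_left, Finset.sum_add_distrib,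
    ← Finset.mul_sum] at h
  refine ⟨h.1, h.2.1, h.2.2.trans (le_of_eq ?_)⟩
  ring

/-- The Lipschitz bound for the Euclidean combination of a number and a square integrable
function. -/
lemma abs_sqrt_sub_sqrt_le {Ω : Type*} [MeasurableSpace Ω] {μ : Measure Ω} {h k : Ω → ℝ}
    (hh : MemLp h 2 μ) (hk : MemLp k 2 μ) (r s : ℝ) :
    |√(r ^ 2 + ∫ e, h e ^ 2 ∂μ) - √(s ^ 2 + ∫ e, k e ^ 2 ∂μ)| ≤
      √((r - s) ^ 2 + ∫ e, (h e - k e) ^ 2 ∂μ) := by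
  have hn : ∀ (q : ℝ) (l : Ω → ℝ) (hl : MemLp l 2 μ),
      ‖(WithLp.toLp 2 (q, hl.toLp l) : WithLp 2 (ℝ × Lp ℝ 2 μ))‖ = √(q ^ 2 + ∫ e, l e ^ 2 ∂μ) := by
    intro q l hl
    rw [WithLp.prod_norm_eq_of_L2]
    congr 1
    change ‖q‖ ^ 2 + ‖hl.toLp l‖ ^ 2 = _
    rw [Real.norm_eq_abs, sq_abs, ← real_inner_self_eq_norm_sq, L2.inner_def]
    congr 1
    refine integral_congr_ae ?_
    filter_upwards [hl.coeFn_toLp] with e he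
    rw [he, real_inner_self_eq_norm_sq, Real.norm_eq_abs, sq_abs]
  rw [← hn r h hh, ← hn s k hk]
  refine (abs_norm_sub_norm_le _ _).trans (le_of_eq ?_)
  have h1 := hn (r - s) (h - k) (hh.sub hk)
  simp only [Pi.sub_apply] at h1
  rw [← h1]
  congr 1

lemma AssumptionA.lipschitz_sigmaTilde (hA : AssumptionA ν A T b σ η γ f ζ g C) {ε : ℝ} {α : Vec m}
    (hα : α ∈ A) (x y : Vec d) (i k : Fin d) :
    |sigmaTilde ν σ η ε α x i k - sigmaTilde ν σ η ε α y i k| ≤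
      C * (1 + ∫ e, min 1 (‖e‖ ^ 2) ∂ν) * ‖x - y‖ := by
  have hC := hA.hC
  have hI0 : 0 ≤ ∫ e, min 1 (‖e‖ ^ 2) ∂ν := integral_nonneg fun e => by positivity
  have hσ : ∀ i k, |σ α x i k - σ α y i k| ≤ C * ‖x - y‖ := fun i k => by
    have h1 := Matrix.norm_entry_le_entrywise_sup_norm (σ α x - σ α y) (i := i) (j := k)
    have h2 := hA.hb α hα α hα x y
    rw [sub_self, norm_zero, add_zero] at h2
    rw [Matrix.sub_apply, Real.norm_eq_abs] at h1
    linarith [norm_nonneg (b α x - b α y)]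
  by_cases hik : i = k
  · subst hik
    simp only [sigmaTilde, Matrix.of_apply, if_true]
    have hsq : ∀ e : Vec n, (min 1 ‖e‖) ^ 2 = min 1 (‖e‖ ^ 2) := fun e => by
      rcases le_total 1 ‖e‖ with h | h
      · rw [min_eq_left h, min_eq_left (by nlinarith)]; norm_num
      · rw [min_eq_right h, min_eq_right (by nlinarith [norm_nonneg e])]
    have hmem : ∀ z, MemLp (fun e => η α z e i) 2 (ν.restrict {e : Vec n | ‖e‖ < ε}) := fun z => by
      have hms : Measurable fun e => η α z e i :=
        (EuclideanSpace.proj (𝕜 := ℝ) i).continuous.measurable.comp (hA.hη_meas α z)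
      rw [memLp_two_iff_integrable_sq hms.aestronglyMeasurable]
      refine ((hA.hν_int.const_mul (C ^ 2)).restrict).mono' (hms.pow_const 2).aestronglyMeasurable
        (ae_of_all _ fun e => ?_)
      rw [Real.norm_eq_abs, abs_of_nonneg (sq_nonneg _), ← sq_abs, ← hsq, ← mul_pow]
      exact pow_le_pow_left₀ (abs_nonneg _)
        ((PiLp.norm_apply_le (η α z e) i).trans (hA.hη_bdd α hα z e)) 2
    refine (abs_sqrt_sub_sqrt_le (hmem x) (hmem y) _ _).trans ?_
    rw [Real.sqrt_le_left (by positivity)]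
    have h1 : (σ α x i i - σ α y i i) ^ 2 ≤ (C * ‖x - y‖) ^ 2 := by
      rw [← sq_abs]; exact pow_le_pow_left₀ (abs_nonneg _) (hσ i i) 2
    have h2 : ∫ e in {e : Vec n | ‖e‖ < ε}, (η α x e i - η α y e i) ^ 2 ∂ν ≤
        (C * ‖x - y‖) ^ 2 * ∫ e, min 1 (‖e‖ ^ 2) ∂ν := by
      rw [← integral_const_mul]
      refine (integral_mono_of_nonneg (ae_of_all _ fun e => sq_nonneg _)
        (hA.hν_int.const_mul _).restrict (ae_of_all _ fun e => ?_)).trans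
        (setIntegral_le_integral (hA.hν_int.const_mul _) (ae_of_all _ fun e => ?_))
      · dsimp only
        rw [← hsq, ← mul_pow, ← sq_abs]
        refine pow_le_pow_left₀ (abs_nonneg _) ?_ 2
        have h3 := PiLp.norm_apply_le (η α x e - η α y e) i
        have h4 := hA.hη_lip α hα α hα x y e
        rw [sub_self, norm_zero, add_zero] at h4
        exact h3.trans h4
      · simp only [Pi.zero_apply]; positivity
    nlinarith [sq_nonneg (C * ‖x - y‖), mul_nonneg (sq_nonneg (C * ‖x - y‖)) hI0,
      mul_nonneg (sq_nonneg (C * ‖x - y‖)) (mul_nonneg hI0 hI0)]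
  · simp only [sigmaTilde, Matrix.of_apply, if_neg hik]
    refine (hσ i k).trans ?_
    have := mul_nonneg (mul_nonneg hC.le hI0) (norm_nonneg (x - y))
    linarith

/-- Lipschitz and growth constants of the coefficients, uniform over finitely many controls. -/
lemma AssumptionA.exists_coefficient_bound (hA : AssumptionA ν A T b σ η γ f ζ g C) (ε : ℝ)
    {J : ℕ} {αs : Fin J → Vec m} (hαs : ∀ j, αs j ∈ A) :
    ∃ L : ℝ, 0 < L ∧ ∀ j, ∀ x y : Vec d,
      (∑ k, ‖colE (sigmaTilde ν σ η ε (αs j) x) k - colE (sigmaTilde ν σ η ε (αs j) y) k‖)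
        ≤ L * ‖x - y‖ ∧
      (∑ k, ‖colE (sigmaTilde ν σ η ε (αs j) x) k‖) ≤ L * (1 + ‖x‖) ∧
      ‖b (αs j) x - b (αs j) y‖ ≤ L * ‖x - y‖ ∧ ‖b (αs j) x‖ ≤ L * (1 + ‖x‖) := by
  have hC := hA.hC
  have hI0 : 0 ≤ ∫ e, min 1 (‖e‖ ^ 2) ∂ν := integral_nonneg fun e => by positivity
  obtain ⟨L₀, hL₀0, hcol⟩ : ∃ L₀ : ℝ, 0 ≤ L₀ ∧ ∀ j, ∀ x y : Vec d,
      (∑ k, ‖colE (sigmaTilde ν σ η ε (αs j) x) k - colE (sigmaTilde ν σ η ε (αs j) y) k‖)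
        ≤ L₀ * ‖x - y‖ := by
    refine ⟨∑ _k : Fin d, ∑ _i : Fin d, C * (1 + ∫ e, min 1 (‖e‖ ^ 2) ∂ν),
      Finset.sum_nonneg fun k _ => Finset.sum_nonneg fun i _ => by positivity, fun j x y => ?_⟩
    rw [Finset.sum_mul]
    refine Finset.sum_le_sum fun k _ => (norm_le_sum_abs _).trans ?_
    rw [Finset.sum_mul]
    exact Finset.sum_le_sum fun i _ => hA.lipschitz_sigmaTilde (hαs j) x y i k
  have hterm : ∀ j, 0 ≤ (∑ k, ‖colE (sigmaTilde ν σ η ε (αs j) 0) k‖) + ‖b (αs j) 0‖ := fun j =>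
    add_nonneg (Finset.sum_nonneg fun k _ => norm_nonneg _) (norm_nonneg _)
  obtain ⟨L₁, hL₁0, hL₁j⟩ : ∃ L₁ : ℝ, 0 ≤ L₁ ∧
      ∀ j, (∑ k, ‖colE (sigmaTilde ν σ η ε (αs j) 0) k‖) + ‖b (αs j) 0‖ ≤ L₁ :=
    ⟨∑ j, ((∑ k, ‖colE (sigmaTilde ν σ η ε (αs j) 0) k‖) + ‖b (αs j) 0‖),
      Finset.sum_nonneg fun j _ => hterm j, fun j =>
      Finset.single_le_sum (f := fun j => (∑ k, ‖colE (sigmaTilde ν σ η ε (αs j) 0) k‖)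
        + ‖b (αs j) 0‖) (fun j _ => hterm j) (Finset.mem_univ j)⟩
  have hbl : ∀ j, ∀ x y : Vec d, ‖b (αs j) x - b (αs j) y‖ ≤ C * ‖x - y‖ := fun j x y => by
    have h2 := hA.hb (αs j) (hαs j) (αs j) (hαs j) x y
    rw [sub_self, norm_zero, add_zero] at h2
    linarith [norm_nonneg (σ (αs j) x - σ (αs j) y)]
  have arith : ∀ s r q l K : ℝ, 0 ≤ r → 0 ≤ K → 0 ≤ L₁ - q → 0 ≤ l → l + K = L₀ + L₁ + C →
      s ≤ l * r + q → L₁ ≤ K → s ≤ (L₀ + L₁ + C) * (1 + r) := fun s r q l K hr hK hq hl e h h' => by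
    rw [← e]
    have := mul_nonneg hK hr
    linarith
  refine ⟨L₀ + L₁ + C, by linarith, fun j x y => ⟨?_, ?_, ?_, ?_⟩⟩
  · exact (hcol j x y).trans (mul_le_mul_of_nonneg_right (by linarith) (norm_nonneg _))
  · have h1 := hcol j x 0
    rw [sub_zero] at h1
    have h2 : (∑ k, ‖colE (sigmaTilde ν σ η ε (αs j) x) k‖) ≤
        (∑ k, ‖colE (sigmaTilde ν σ η ε (αs j) x) k - colE (sigmaTilde ν σ η ε (αs j) 0) k‖)
          + ∑ k, ‖colE (sigmaTilde ν σ η ε (αs j) 0) k‖ := by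
      rw [← Finset.sum_add_distrib]
      exact Finset.sum_le_sum fun k _ => norm_le_norm_sub_add _ _
    exact arith _ _ _ L₀ (L₁ + C) (norm_nonneg x) (by linarith)
      (sub_nonneg.2 ((le_add_of_nonneg_right (norm_nonneg _)).trans (hL₁j j))) hL₀0 (by ring)
      (h2.trans (add_le_add_left h1 _)) (by linarith)
  · exact (hbl j x y).trans (mul_le_mul_of_nonneg_right (by linarith) (norm_nonneg _))
  · have h1 := hbl j x 0
    rw [sub_zero] at h1
    have h2 := norm_le_norm_sub_add (b (αs j) x) (b (αs j) 0)
    exact arith _ _ _ C (L₁ + L₀) (norm_nonneg x) (by linarith)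
      (sub_nonneg.2 ((le_add_of_nonneg_left (Finset.sum_nonneg fun k _ => norm_nonneg _)).trans
        (hL₁j j))) hC.le (by ring)
      (h2.trans (add_le_add_left h1 _)) (by linarith)

end

section
variable {ν : Measure (Vec n)} {A : Set (Vec m)} {T : ℝ}
    {b : Vec m → Vec d → Vec d} {σ : Vec m → Vec d → Matrix (Fin d) (Fin d) ℝ}
    {η : Vec m → Vec d → Vec n → Vec d} {γ : Vec d → Vec n → ℝ}
    {f : Vec m → ℝ → Vec d → ℝ → Vec d → ℝ → ℝ}
    {ζ : ℝ → Vec d → ℝ} {g : Vec d → ℝ} {C : ℝ}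

lemma AssumptionA.integrable_increment (hA : AssumptionA ν A T b σ η γ f ζ g C) {ε : ℝ}
    (hε : ε ∈ Ioo (0:ℝ) 1) {α : Vec m} {u : Vec d → ℝ} (hu : Measurable u) {M : ℝ}
    (hM : ∀ x, |u x| ≤ M) (x : Vec d) :
    Integrable (fun e => u (x + η α x e) - u x) (ν.restrict {e : Vec n | ε < ‖e‖}) := by
  have hfin := isFiniteMeasure_restrict_norm_gt hA.hν_int hε
  refine Integrable.of_bound
    ((hu.comp ((hA.hη_meas α x).const_add x)).sub_const _).aestronglyMeasurable (M + M)
    (ae_of_all _ fun e => ?_)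
  exact (abs_sub _ _).trans (add_le_add (hM _) (hM _))

lemma AssumptionA.integrable_inner_jump (hA : AssumptionA ν A T b σ η γ f ζ g C) {ε : ℝ}
    (hε : ε ∈ Ioo (0:ℝ) 1) {α : Vec m} (hα : α ∈ A) (x P : Vec d) :
    Integrable (fun e => ⟪η α x e, P⟫) (ν.restrict {e : Vec n | ε < ‖e‖}) := by
  have hfin := isFiniteMeasure_restrict_norm_gt hA.hν_int hε
  refine Integrable.of_bound
    ((hA.hη_meas α x).inner measurable_const).aestronglyMeasurable (C * ‖P‖)
    (ae_of_all _ fun e => ?_)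
  exact (norm_inner_le_norm _ _).trans
    (mul_le_mul_of_nonneg_right (hA.norm_jump_le hα x e) (norm_nonneg _))

lemma AssumptionA.integrable_weighted_increment (hA : AssumptionA ν A T b σ η γ f ζ g C) {ε : ℝ}
    (hε : ε ∈ Ioo (0:ℝ) 1) {α : Vec m} {u : Vec d → ℝ} (hu : Measurable u) {M : ℝ}
    (hM : ∀ x, |u x| ≤ M) (x : Vec d) :
    Integrable (fun e => (u (x + η α x e) - u x) * γ x e) (ν.restrict {e : Vec n | ε < ‖e‖}) := by
  refine (hA.integrable_increment hε hu hM x).mul_bdd (c := C)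
    (hA.hγ_meas x).aestronglyMeasurable (ae_of_all _ fun e => ?_)
  rw [Real.norm_eq_abs, abs_of_nonneg (hA.hγ_nonneg _ _)]
  exact hA.weight_le x e

lemma AssumptionA.Kfun_sub_le (hA : AssumptionA ν A T b σ η γ f ζ g C) {ε : ℝ}
    (hε : ε ∈ Ioo (0:ℝ) 1) {α : Vec m} (hα : α ∈ A) {u v : Vec d → ℝ} (hu : Measurable u)
    (hv : Measurable v) {M : ℝ} (hMu : ∀ x, |u x| ≤ M) (hMv : ∀ x, |v x| ≤ M) {w : ℝ} (hw : 0 < w)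
    {x y P P' : Vec d} {B : ℝ}
    (hB : ∀ e, w * (u (x + η α x e) - u x) - (v (y + η α y e) - v y) - ⟪η α x e, P⟫
      - ⟪η α y e, P'⟫ ≤ B) :
    w * Kfun ν η ε α u x (w⁻¹ • P) - Kfun ν η ε α v y (-P') ≤
      (ν.restrict {e : Vec n | ε < ‖e‖}).real univ * B := by
  have hfin := isFiniteMeasure_restrict_norm_gt hA.hν_int hε
  have i1 := (((hA.integrable_increment hε (α := α) hu hMu x).sub
    (hA.integrable_inner_jump hε hα x (w⁻¹ • P)))).const_mul w
  have i2 := (hA.integrable_increment hε (α := α) hv hMv y).sub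
    (hA.integrable_inner_jump hε hα y (-P'))
  rw [Kfun, Kfun, ← integral_const_mul]
  refine (integral_sub i1 i2).symm.trans_le ?_
  refine (integral_mono (i1.sub i2) (integrable_const B) fun e => ?_).trans ?_
  · refine le_trans (le_of_eq ?_) (hB e)
    simp only [Pi.sub_apply, inner_neg_right, real_inner_smul_right]
    field_simp
    ring
  · rw [integral_const, smul_eq_mul]

lemma AssumptionA.Bfun_sub_le (hA : AssumptionA ν A T b σ η γ f ζ g C) {ε : ℝ}
    (hε : ε ∈ Ioo (0:ℝ) 1) {α : Vec m} {u v : Vec d → ℝ} (hu : Measurable u)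
    (hv : Measurable v) {M : ℝ} (hMu : ∀ x, |u x| ≤ M) (hMv : ∀ x, |v x| ≤ M) {w : ℝ}
    {x y : Vec d} {B : ℝ} (hB0 : 0 ≤ B)
    (hB : ∀ e, w * (u (x + η α x e) - u x) - (v (y + η α y e) - v y) ≤ B) :
    w * Bfun ν η γ ε α u x - Bfun ν η γ ε α v y ≤
      (ν.restrict {e : Vec n | ε < ‖e‖}).real univ * (C * B + 2 * M * C * ‖x - y‖) := by
  have hfin := isFiniteMeasure_restrict_norm_gt hA.hν_int hε
  have i1 := (hA.integrable_weighted_increment hε (α := α) hu hMu x).const_mul w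
  have i2 := hA.integrable_weighted_increment hε (α := α) hv hMv y
  rw [Bfun, Bfun, ← integral_const_mul]
  refine (integral_sub i1 i2).symm.trans_le ?_
  refine (integral_mono (i1.sub i2) (integrable_const (C * B + 2 * M * C * ‖x - y‖))
    fun e => ?_).trans ?_
  · have h1 : (w * (u (x + η α x e) - u x) - (v (y + η α y e) - v y)) * γ x e ≤ B * C :=
      (mul_le_mul_of_nonneg_right (hB e) (hA.hγ_nonneg _ _)).trans
        (mul_le_mul_of_nonneg_left (hA.weight_le x e) hB0)
    have h2 : |v (y + η α y e) - v y| ≤ M + M := (abs_sub _ _).trans (add_le_add (hMv _) (hMv _))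
    have h3 : |γ x e - γ y e| ≤ C * ‖x - y‖ := (hA.hγ_lip x y e).trans
      (mul_le_of_le_one_right (mul_nonneg hA.hC.le (norm_nonneg _)) (min_le_left _ _))
    have h4 : (v (y + η α y e) - v y) * (γ x e - γ y e) ≤ (M + M) * (C * ‖x - y‖) :=
      (le_abs_self _).trans ((abs_mul _ _).trans_le
        (mul_le_mul h2 h3 (abs_nonneg _) ((abs_nonneg _).trans h2)))
    simp only [Pi.sub_apply]
    linarith
  · rw [integral_const, smul_eq_mul]

lemma AssumptionA.abs_Bfun_le (hA : AssumptionA ν A T b σ η γ f ζ g C) {ε : ℝ}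
    (hε : ε ∈ Ioo (0:ℝ) 1) {α : Vec m} {u : Vec d → ℝ} {M : ℝ} (hM : ∀ x, |u x| ≤ M) (x : Vec d) :
    |Bfun ν η γ ε α u x| ≤
      2 * M * C * (ν.restrict {e : Vec n | ε < ‖e‖}).real univ := by
  have hfin := isFiniteMeasure_restrict_norm_gt hA.hν_int hε
  rw [← Real.norm_eq_abs, Bfun]
  refine norm_integral_le_of_norm_le_const (μ := ν.restrict {e : Vec n | ε < ‖e‖})
    (ae_of_all _ fun e => ?_)
  have h2 : |u (x + η α x e) - u x| ≤ M + M := (abs_sub _ _).trans (add_le_add (hM _) (hM _))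
  rw [Real.norm_eq_abs, abs_mul, abs_of_nonneg (hA.hγ_nonneg x e), two_mul]
  exact mul_le_mul h2 (hA.weight_le x e) (hA.hγ_nonneg _ _) ((abs_nonneg _).trans h2)

/-- The increments of a pair of functions at a near maximum of the penalised doubled difference. -/
lemma AssumptionA.increment_le (hA : AssumptionA ν A T b σ η γ f ζ g C) {α : Vec m} (hα : α ∈ A)
    {u v : Vec d → ℝ} {w β δ ρ : ℝ} (hβ : 0 ≤ β) (hδ : 0 < δ) {x y p p' : Vec d}
    (hp : ‖p - (1 / δ) • (x - y)‖ ≤ ρ) (hp' : ‖p' + (1 / δ) • (x - y)‖ ≤ ρ) (e : Vec n)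
    (hmax : w * u (x + η α x e) - β * logPen (x + η α x e)
        + (-v (y + η α y e) - β * logPen (y + η α y e))
        - ‖x + η α x e - (y + η α y e)‖ ^ 2 / (2 * δ) ≤
      w * u x - β * logPen x + (-v y - β * logPen y) - ‖x - y‖ ^ 2 / (2 * δ) + ρ) :
    w * (u (x + η α x e) - u x) - (v (y + η α y e) - v y) ≤
        2 * β * C + ρ + (C + C ^ 2 / 2) * (‖x - y‖ ^ 2 / δ) ∧
    w * (u (x + η α x e) - u x) - (v (y + η α y e) - v y)
        - ⟪η α x e, p + β • logPenGrad x⟫ - ⟪η α y e, p' + β • logPenGrad y⟫ ≤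
      4 * β * C + ρ + 2 * C * ρ + C ^ 2 / 2 * (‖x - y‖ ^ 2 / δ) := by
  have hC := hA.hC
  set a := η α x e with ha
  set a' := η α y e with ha'
  have na : ‖a‖ ≤ C := hA.norm_jump_le hα x e
  have na' : ‖a'‖ ≤ C := hA.norm_jump_le hα y e
  have nd : ‖a - a'‖ ≤ C * ‖x - y‖ := by
    have h := hA.hη_lip α hα α hα x y e
    rw [sub_self, norm_zero, add_zero] at h
    exact h.trans (mul_le_of_le_one_right (mul_nonneg hC.le (norm_nonneg _)) (min_le_left _ _))
  have l1 : logPen (x + a) - logPen x ≤ C := by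
    have := abs_logPen_sub_le (x + a) x
    rw [add_sub_cancel_left] at this
    exact (le_abs_self _).trans (this.trans na)
  have l2 : logPen (y + a') - logPen y ≤ C := by
    have := abs_logPen_sub_le (y + a') y
    rw [add_sub_cancel_left] at this
    exact (le_abs_self _).trans (this.trans na')
  have hsq : ‖x + a - (y + a')‖ ^ 2 / (2 * δ) - ‖x - y‖ ^ 2 / (2 * δ) =
      1 / δ * ⟪x - y, a - a'⟫ + ‖a - a'‖ ^ 2 / (2 * δ) := by
    rw [show x + a - (y + a') = (x - y) + (a - a') by abel, norm_add_sq_real]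
    field_simp
    ring
  have hn2 : ‖a - a'‖ ^ 2 / (2 * δ) ≤ C ^ 2 / 2 * (‖x - y‖ ^ 2 / δ) := by
    have : ‖a - a'‖ ^ 2 ≤ (C * ‖x - y‖) ^ 2 := pow_le_pow_left₀ (norm_nonneg _) nd 2
    calc _ ≤ (C * ‖x - y‖) ^ 2 / (2 * δ) := by gcongr
      _ = _ := by field_simp
  have hi : 1 / δ * ⟪x - y, a - a'⟫ ≤ C * (‖x - y‖ ^ 2 / δ) := by
    have : ⟪x - y, a - a'⟫ ≤ ‖x - y‖ * (C * ‖x - y‖) :=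
      (real_inner_le_norm _ _).trans (mul_le_mul_of_nonneg_left nd (norm_nonneg _))
    calc _ ≤ 1 / δ * (‖x - y‖ * (C * ‖x - y‖)) := by gcongr
      _ = _ := by ring
  have hβ1 := mul_le_mul_of_nonneg_left l1 hβ
  have hβ2 := mul_le_mul_of_nonneg_left l2 hβ
  constructor
  · linarith
  · have e1 : ⟪a, p + β • logPenGrad x⟫ = ⟪a, p - (1 / δ) • (x - y)⟫ + 1 / δ * ⟪x - y, a⟫
        + β * ⟪a, logPenGrad x⟫ := by
      rw [real_inner_comm a (x - y), inner_add_right, inner_sub_right, real_inner_smul_right,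
        real_inner_smul_right]
      ring
    have e2 : ⟪a', p' + β • logPenGrad y⟫ = ⟪a', p' + (1 / δ) • (x - y)⟫ - 1 / δ * ⟪x - y, a'⟫
        + β * ⟪a', logPenGrad y⟫ := by
      rw [real_inner_comm a' (x - y), inner_add_right, inner_add_right, real_inner_smul_right,
        real_inner_smul_right]
      ring
    have e3 : 1 / δ * ⟪x - y, a - a'⟫ = 1 / δ * ⟪x - y, a⟫ - 1 / δ * ⟪x - y, a'⟫ := by
      rw [inner_sub_right]; ring
    have b1 : -⟪a, p - (1 / δ) • (x - y)⟫ ≤ C * ρ := (neg_le_abs _).trans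
      ((abs_real_inner_le_norm _ _).trans (mul_le_mul na hp (norm_nonneg _) hC.le))
    have b2 : -⟪a', p' + (1 / δ) • (x - y)⟫ ≤ C * ρ := (neg_le_abs _).trans
      ((abs_real_inner_le_norm _ _).trans (mul_le_mul na' hp' (norm_nonneg _) hC.le))
    have b3 : -⟪a, logPenGrad x⟫ ≤ C * 1 := (neg_le_abs _).trans
      ((abs_real_inner_le_norm _ _).trans
        (mul_le_mul na (norm_logPenGrad_le_one x) (norm_nonneg _) hC.le))
    have b4 : -⟪a', logPenGrad y⟫ ≤ C * 1 := (neg_le_abs _).trans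
      ((abs_real_inner_le_norm _ _).trans
        (mul_le_mul na' (norm_logPenGrad_le_one y) (norm_nonneg _) hC.le))
    have b3' := mul_le_mul_of_nonneg_left b3 hβ
    have b4' := mul_le_mul_of_nonneg_left b4 hβ
    rw [e1, e2]
    linarith

end

/-- The second order terms at a pair of jets obtained by doubling the variables. -/
lemma sum_inner_add_sum_inner_le {X X' : Vec d →L[ℝ] Vec d} {δ ρ : ℝ} (hδ : 0 < δ) (hρ : 0 ≤ ρ)
    (hXX : ∀ h k, ⟪X h, h⟫ + ⟪X' k, k⟫ ≤ 2 / δ * ‖h - k‖ ^ 2 + ρ * (‖h‖ ^ 2 + ‖k‖ ^ 2))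
    {S S' : Fin d → Vec d} {a r r' : ℝ} (ha : ∑ k, ‖S k - S' k‖ ≤ a) (hr : ∑ k, ‖S k‖ ≤ r)
    (hr' : ∑ k, ‖S' k‖ ≤ r') :
    1 / 2 * ∑ k, ⟪X (S k), S k⟫ + 1 / 2 * ∑ k, ⟪X' (S' k), S' k⟫ ≤
      a ^ 2 / δ + ρ / 2 * (r ^ 2 + r' ^ 2) := by
  have hsum : ∀ {s : Fin d → Vec d} {q : ℝ}, ∑ k, ‖s k‖ ≤ q → ∑ k, ‖s k‖ ^ 2 ≤ q ^ 2 :=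
    fun {s q} h => (Finset.sum_sq_le_sq_sum_of_nonneg fun k _ => norm_nonneg _).trans
      (pow_le_pow_left₀ (Finset.sum_nonneg fun k _ => norm_nonneg _) h 2)
  have h1 := hsum (s := fun k => S k - S' k) ha
  have h2 := hsum hr
  have h3 := hsum hr'
  have h4 : (∑ k, ⟪X (S k), S k⟫) + ∑ k, ⟪X' (S' k), S' k⟫ ≤
      2 / δ * ∑ k, ‖S k - S' k‖ ^ 2 + ρ * ((∑ k, ‖S k‖ ^ 2) + ∑ k, ‖S' k‖ ^ 2) := by
    rw [← Finset.sum_add_distrib, ← Finset.sum_add_distrib, Finset.mul_sum, Finset.mul_sum,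
      ← Finset.sum_add_distrib]
    exact Finset.sum_le_sum fun k _ => hXX _ _
  have h5 : 2 / δ * ∑ k, ‖S k - S' k‖ ^ 2 ≤ 2 / δ * a ^ 2 :=
    mul_le_mul_of_nonneg_left h1 (by positivity)
  have h6 := mul_le_mul_of_nonneg_left (add_le_add h2 h3) hρ
  have h7 : a ^ 2 / δ = 1 / 2 * (2 / δ * a ^ 2) := by ring
  rw [h7]
  linarith

lemma sum_inner_logPenHess_le {S : Fin d → Vec d} {x : Vec d} {L : ℝ}
    (hS : ∑ k, ‖S k‖ ≤ L * (1 + ‖x‖)) :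
    ∑ k, ⟪logPenHess x (S k), S k⟫ ≤ 12 * L ^ 2 := by
  have hx : 0 < (1 + ‖x‖) ^ 2 := by positivity
  have h1 : ∑ k, ‖S k‖ ^ 2 ≤ (L * (1 + ‖x‖)) ^ 2 :=
    (Finset.sum_sq_le_sq_sum_of_nonneg fun k _ => norm_nonneg _).trans
      (pow_le_pow_left₀ (Finset.sum_nonneg fun k _ => norm_nonneg _) hS 2)
  rw [← mul_le_mul_iff_right₀ hx, Finset.mul_sum]
  calc _ ≤ ∑ k, 12 * ‖S k‖ ^ 2 := Finset.sum_le_sum fun k _ =>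
        le_trans (mul_le_mul_of_nonneg_left (le_abs_self _) hx.le) (abs_inner_logPenHess_le _ _)
    _ ≤ 12 * (L * (1 + ‖x‖)) ^ 2 := by
        rw [← Finset.mul_sum]; linarith
    _ = _ := by ring

/-- The drift terms at a pair of jets obtained by doubling the variables. -/
lemma inner_add_inner_le {B B' x y p p' : Vec d} {δ ρ β L R : ℝ} (hδ : 0 < δ)
    (hβ : 0 ≤ β) (hL : 0 ≤ L) (hx : ‖x‖ ≤ R) (hy : ‖y‖ ≤ R)
    (hp : ‖p - (1 / δ) • (x - y)‖ ≤ ρ) (hp' : ‖p' + (1 / δ) • (x - y)‖ ≤ ρ)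
    (hBB : ‖B - B'‖ ≤ L * ‖x - y‖) (hB : ‖B‖ ≤ L * (1 + ‖x‖)) (hB' : ‖B'‖ ≤ L * (1 + ‖y‖)) :
    ⟪B, p + β • logPenGrad x⟫ + ⟪B', p' + β • logPenGrad y⟫ ≤
      L * (‖x - y‖ ^ 2 / δ) + 2 * ρ * (L * (1 + R)) + 8 * β * L := by
  have e1 : ⟪B, p + β • logPenGrad x⟫ + ⟪B', p' + β • logPenGrad y⟫ =
      1 / δ * ⟪B - B', x - y⟫ + ⟪B, p - (1 / δ) • (x - y)⟫ + ⟪B', p' + (1 / δ) • (x - y)⟫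
        + β * (⟪B, logPenGrad x⟫ + ⟪B', logPenGrad y⟫) := by
    simp only [inner_add_right, inner_sub_left, inner_sub_right, real_inner_smul_right]
    ring
  have b1 : 1 / δ * ⟪B - B', x - y⟫ ≤ L * (‖x - y‖ ^ 2 / δ) := by
    have : ⟪B - B', x - y⟫ ≤ L * ‖x - y‖ * ‖x - y‖ :=
      (real_inner_le_norm _ _).trans (mul_le_mul_of_nonneg_right hBB (norm_nonneg _))
    calc _ ≤ 1 / δ * (L * ‖x - y‖ * ‖x - y‖) := by gcongr
      _ = _ := by ring
  have hR : ∀ {z : Vec d}, ‖z‖ ≤ R → L * (1 + ‖z‖) ≤ L * (1 + R) := fun h =>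
    mul_le_mul_of_nonneg_left (by linarith) hL
  have b2 : ⟪B, p - (1 / δ) • (x - y)⟫ ≤ L * (1 + R) * ρ := (real_inner_le_norm _ _).trans
    (mul_le_mul (hB.trans (hR hx)) hp (norm_nonneg _) ((norm_nonneg _).trans (hB.trans (hR hx))))
  have b3 : ⟪B', p' + (1 / δ) • (x - y)⟫ ≤ L * (1 + R) * ρ := (real_inner_le_norm _ _).trans
    (mul_le_mul (hB'.trans (hR hy)) hp' (norm_nonneg _) ((norm_nonneg _).trans (hB'.trans (hR hy))))
  have hg : ∀ {D z : Vec d}, ‖D‖ ≤ L * (1 + ‖z‖) → ⟪D, logPenGrad z⟫ ≤ 4 * L := fun {D z} h => by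
    refine (real_inner_le_norm _ _).trans ((mul_le_mul_of_nonneg_right h (norm_nonneg _)).trans ?_)
    rw [mul_assoc, mul_comm 4 L]
    exact mul_le_mul_of_nonneg_left (one_add_norm_mul_logPenGrad_le z) hL
  have b4 := mul_le_mul_of_nonneg_left (add_le_add (hg hB) (hg hB')) hβ
  rw [e1]
  linarith

/-- The images of the gradients at a pair of jets obtained by doubling the variables. -/
lemma norm_mvE_jet_le {M N : Matrix (Fin d) (Fin d) ℝ} {x y p p' : Vec d} {δ ρ β L R : ℝ}
    (hδ : 0 < δ) (hρ : 0 ≤ ρ) (hβ : 0 ≤ β) (hL : 0 ≤ L) (hx : ‖x‖ ≤ R) (hy : ‖y‖ ≤ R)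
    (hxy : ‖x - y‖ ≤ 1)
    (hp : ‖p - (1 / δ) • (x - y)‖ ≤ ρ) (hp' : ‖p' + (1 / δ) • (x - y)‖ ≤ ρ)
    (hMN : ∑ k, ‖colE M k - colE N k‖ ≤ L * ‖x - y‖)
    (hM : ∑ k, ‖colE M k‖ ≤ L * (1 + ‖x‖)) (hN : ∑ k, ‖colE N k‖ ≤ L * (1 + ‖y‖)) :
    ‖mvE Mᵀ (p + β • logPenGrad x)‖ ≤ L * (1 + R) * (‖x - y‖ / δ + ρ) + 4 * β * L ∧
    ‖mvE Nᵀ (-(p' + β • logPenGrad y))‖ ≤ L * (1 + R) * (‖x - y‖ / δ + ρ) + 4 * β * L ∧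
    ‖mvE Mᵀ (p + β • logPenGrad x) - mvE Nᵀ (-(p' + β • logPenGrad y))‖ ≤
      L * (‖x - y‖ ^ 2 / δ) + L * (ρ + β) + 2 * ρ * (L * (1 + R)) + 9 * β * L := by
  have nq : ‖(1 / δ) • (x - y)‖ = ‖x - y‖ / δ := by
    rw [norm_smul, Real.norm_of_nonneg (by positivity)]; ring
  have np : ‖p‖ ≤ ‖x - y‖ / δ + ρ := by
    have := norm_le_norm_sub_add p ((1 / δ) • (x - y))
    rw [nq] at this
    linarith
  have np' : ‖p'‖ ≤ ‖x - y‖ / δ + ρ := by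
    have := norm_le_norm_add_norm_sub' p' (-((1 / δ) • (x - y)))
    rw [norm_neg, nq, sub_neg_eq_add] at this
    linarith
  have hR : ∀ {z : Vec d}, ‖z‖ ≤ R → L * (1 + ‖z‖) ≤ L * (1 + R) := fun h =>
    mul_le_mul_of_nonneg_left (by linarith) hL
  have hq0 : 0 ≤ ‖x - y‖ / δ + ρ := by positivity
  have hbd : ∀ {Z : Matrix (Fin d) (Fin d) ℝ} {z r : Vec d}, ‖z‖ ≤ R →
      ‖r‖ ≤ ‖x - y‖ / δ + ρ → ∑ k, ‖colE Z k‖ ≤ L * (1 + ‖z‖) →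
      (∑ k, ‖colE Z k‖) * ‖r + β • logPenGrad z‖ ≤
        L * (1 + R) * (‖x - y‖ / δ + ρ) + 4 * β * L := fun {Z z r} hz hr hZ => by
    have h1 : ‖r + β • logPenGrad z‖ ≤ (‖x - y‖ / δ + ρ) + β * ‖logPenGrad z‖ := by
      refine (norm_add_le _ _).trans (add_le_add hr ?_)
      rw [norm_smul, Real.norm_of_nonneg hβ]
    refine (mul_le_mul hZ h1 (norm_nonneg _) (mul_nonneg hL (by positivity))).trans ?_
    have h2 := mul_le_mul_of_nonneg_right (hR hz) hq0
    have h3 := mul_le_mul_of_nonneg_left (one_add_norm_mul_logPenGrad_le z) (mul_nonneg hβ hL)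
    linarith
  refine ⟨(norm_mvE_transpose_le _ _).trans (hbd hx np hM),
    (norm_mvE_transpose_le _ _).trans ?_, (norm_mvE_transpose_sub_le _ _ _ _).trans ?_⟩
  · rw [norm_neg]
    exact hbd hy np' hN
  · have hgx := norm_logPenGrad_le_one x
    have h1 : ‖p + β • logPenGrad x‖ ≤ ‖x - y‖ / δ + ρ + β := by
      refine (norm_add_le _ _).trans (add_le_add np ?_)
      rw [norm_smul, Real.norm_of_nonneg hβ]
      exact mul_le_of_le_one_right hβ hgx
    have h2 : ‖p + β • logPenGrad x - -(p' + β • logPenGrad y)‖ ≤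
        2 * ρ + β * ‖logPenGrad x‖ + β * ‖logPenGrad y‖ := by
      rw [show p + β • logPenGrad x - -(p' + β • logPenGrad y) =
        (p - (1 / δ) • (x - y)) + (p' + (1 / δ) • (x - y)) + β • logPenGrad x + β • logPenGrad y by
          abel]
      have hs : ∀ z : Vec d, ‖β • logPenGrad z‖ = β * ‖logPenGrad z‖ := fun z => by
        rw [norm_smul, Real.norm_of_nonneg hβ]
      have t1 := norm_add_le ((p - (1 / δ) • (x - y)) + (p' + (1 / δ) • (x - y))
        + β • logPenGrad x) (β • logPenGrad y)
      have t2 := norm_add_le ((p - (1 / δ) • (x - y)) + (p' + (1 / δ) • (x - y)))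
        (β • logPenGrad x)
      have t3 := norm_add_le (p - (1 / δ) • (x - y)) (p' + (1 / δ) • (x - y))
      rw [hs] at t1 t2
      linarith
    have h3 : (∑ k, ‖colE M k - colE N k‖) * ‖p + β • logPenGrad x‖ ≤
        L * (‖x - y‖ ^ 2 / δ) + L * (ρ + β) := by
      refine (mul_le_mul hMN h1 (norm_nonneg _) (mul_nonneg hL (norm_nonneg _))).trans ?_
      have : ‖x - y‖ * (ρ + β) ≤ 1 * (ρ + β) := mul_le_mul_of_nonneg_right hxy (by linarith)
      have h4 := mul_le_mul_of_nonneg_left this hL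
      have h5 : L * ‖x - y‖ * (‖x - y‖ / δ + ρ + β) =
        L * (‖x - y‖ ^ 2 / δ) + L * (‖x - y‖ * (ρ + β)) := by ring
      rw [h5]
      linarith
    have h4 : (∑ k, ‖colE N k‖) * ‖p + β • logPenGrad x - -(p' + β • logPenGrad y)‖ ≤
        2 * ρ * (L * (1 + R)) + 9 * β * L := by
      refine (mul_le_mul hN h2 (norm_nonneg _) (mul_nonneg hL (by positivity))).trans ?_
      have g1 := one_add_norm_mul_logPenGrad_le x
      have g2 := one_add_norm_mul_logPenGrad_le y
      have g3 : (1 + ‖y‖) * ‖logPenGrad x‖ ≤ 5 := by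
        have : ‖y‖ ≤ ‖x‖ + 1 := by
          have := norm_le_norm_sub_add y x
          rw [norm_sub_rev] at this
          linarith
        have := mul_le_mul_of_nonneg_right this (norm_nonneg (logPenGrad x))
        linarith
      have g4 := mul_le_mul_of_nonneg_left (add_le_add g3 g2) (mul_nonneg hβ hL)
      have g5 := mul_le_mul_of_nonneg_left (hR hy) hρ
      linarith
    linarith

section
variable {ν : Measure (Vec n)} {A : Set (Vec m)} {T : ℝ}
    {b : Vec m → Vec d → Vec d} {σ : Vec m → Vec d → Matrix (Fin d) (Fin d) ℝ}
    {η : Vec m → Vec d → Vec n → Vec d} {γ : Vec d → Vec n → ℝ}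
    {f : Vec m → ℝ → Vec d → ℝ → Vec d → ℝ → ℝ}
    {ζ : ℝ → Vec d → ℝ} {g : Vec d → ℝ} {C : ℝ}

/-- The difference of the source terms at a pair of jets. -/
lemma AssumptionA.source_sub_le (hA : AssumptionA ν A T b σ η γ f ζ g C) {α : Vec m} (hα : α ∈ A)
    {t s : ℝ} (ht : t ∈ Icc (0:ℝ) T) {x y Q Q' : Vec d} {U₀ V₀ w μ M q k₁ k₂ K κ ω τ : ℝ}
    (hμ : 0 ≤ μ) (hw : w = 1 + μ) (hU : |U₀| ≤ M) (hQ : ‖Q‖ ≤ q) (hk₁ : |k₁| ≤ K) (hκ : 0 ≤ κ)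
    (hk : w * k₁ - k₂ ≤ κ) (hUV : V₀ ≤ w * U₀)
    (hω : |f α t x V₀ Q (w * k₁) - f α t y V₀ Q (w * k₁)| ≤ ω)
    (hτ : |f α t y V₀ Q' k₂ - f α s y V₀ Q' k₂| ≤ τ) :
    w * f α t x U₀ (w⁻¹ • Q) k₁ - f α s y V₀ Q' k₂ ≤
      -(C * (w * U₀ - V₀)) + ω + C * ‖Q - Q'‖ + C * κ + τ + μ * (C + 2 * C * (M + q + K)) := by
  have hC := hA.hC
  have hw1 : 1 ≤ w := by linarith
  have hw0 : 0 < w := by linarith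
  have hwi : w⁻¹ ≤ 1 := inv_le_one_of_one_le₀ hw1
  have hQ' : ‖w⁻¹ • Q‖ ≤ q := by
    rw [norm_smul, Real.norm_of_nonneg (inv_nonneg.2 hw0.le)]
    exact (mul_le_of_le_one_left (norm_nonneg _) hwi).trans hQ
  have hQd : ‖w⁻¹ • Q - Q‖ ≤ μ * q := by
    have e : w⁻¹ • Q - Q = (-(μ * w⁻¹)) • Q := by
      have : w⁻¹ - 1 = -(μ * w⁻¹) := by field_simp; linarith
      rw [← this, sub_smul, one_smul]
    rw [e, norm_smul, Real.norm_eq_abs, abs_neg, abs_of_nonneg (by positivity)]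
    exact mul_le_mul (mul_le_of_le_one_right hμ hwi) hQ (norm_nonneg _) hμ
  have s1 : |f α t x U₀ (w⁻¹ • Q) k₁| ≤ C + C * (M + q + K) := by
    have h1 := hA.hf_lip α hα α hα t ht x U₀ 0 (w⁻¹ • Q) 0 k₁ 0
    rw [sub_self, norm_zero, zero_add, sub_zero, sub_zero, sub_zero] at h1
    have h2 := hA.hf_bdd α hα t ht x
    have h3 := abs_sub_abs_le_abs_sub (f α t x U₀ (w⁻¹ • Q) k₁) (f α t x 0 0 0)
    have h4 : C * (|U₀| + ‖w⁻¹ • Q‖ + |k₁|) ≤ C * (M + q + K) :=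
      mul_le_mul_of_nonneg_left (by linarith) hC.le
    linarith
  have s1' : μ * f α t x U₀ (w⁻¹ • Q) k₁ ≤ μ * (C + C * (M + q + K)) :=
    mul_le_mul_of_nonneg_left ((le_abs_self _).trans s1) hμ
  have s2 : f α t x U₀ (w⁻¹ • Q) k₁ - f α t x (w * U₀) Q (w * k₁) ≤ C * (μ * (M + q + K)) := by
    refine (le_abs_self _).trans ((hA.hf_lip α hα α hα t ht x _ _ _ _ _ _).trans ?_)
    have e : ∀ r : ℝ, |r - w * r| = μ * |r| := fun r => by
      rw [show r - w * r = -(μ * r) by rw [hw]; ring, abs_neg, abs_mul, abs_of_nonneg hμ]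
    rw [sub_self, norm_zero, zero_add, e, e]
    refine mul_le_mul_of_nonneg_left ?_ hC.le
    have h1 := mul_le_mul_of_nonneg_left hU hμ
    have h2 := mul_le_mul_of_nonneg_left hk₁ hμ
    linarith
  have s3 := hA.hf_mono α hα t ht x Q (w * k₁) (w * U₀) V₀ hUV
  have s4 := (le_abs_self _).trans hω
  have s5 : f α t y V₀ Q (w * k₁) - f α t y V₀ Q' (w * k₁) ≤ C * ‖Q - Q'‖ := by
    have := (le_abs_self _).trans (hA.hf_lip α hα α hα t ht y V₀ V₀ Q Q' (w * k₁) (w * k₁))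
    simpa using this
  have s6 : f α t y V₀ Q' (w * k₁) ≤ f α t y V₀ Q' (k₂ + κ) :=
    hA.hf_k_mono α hα t ht y V₀ Q' (by linarith)
  have s7 : f α t y V₀ Q' (k₂ + κ) - f α t y V₀ Q' k₂ ≤ C * κ := by
    have := (le_abs_self _).trans (hA.hf_lip α hα α hα t ht y V₀ V₀ Q' Q' (k₂ + κ) k₂)
    simpa [abs_of_nonneg hκ] using this
  have s8 := (le_abs_self _).trans hτ
  have e : w * f α t x U₀ (w⁻¹ • Q) k₁ =
    f α t x U₀ (w⁻¹ • Q) k₁ + μ * f α t x U₀ (w⁻¹ • Q) k₁ := by rw [hw]; ring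
  rw [e]
  linarith

lemma measurable_section_of_upperSemicontinuousOn {u : ℝ → Vec d → ℝ}
    (hu : UpperSemicontinuousOn (fun p : ℝ × Vec d => u p.1 p.2) (Icc 0 T ×ˢ univ)) {t : ℝ}
    (ht : t ∈ Icc (0:ℝ) T) : Measurable (u t) := by
  have h : UpperSemicontinuous (u t) := by
    rw [← upperSemicontinuousOn_univ_iff]
    exact hu.comp (g := fun x : Vec d => (t, x)) (Continuous.prodMk_right t).continuousOn
      fun x _ => ⟨ht, mem_univ _⟩
  exact h.measurable

/-- The estimate obtained by combining the sub- and supersolution inequalities at a pair of jets. -/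
lemma AssumptionA.sub_le_of_jets (hA : AssumptionA ν A T b σ η γ f ζ g C) {ε : ℝ}
    (hε : ε ∈ Ioo (0:ℝ) 1) {J : ℕ} {αs : Fin J → Vec m} (hαs : ∀ j, αs j ∈ A) {c : ℝ}
    {U V : Fin J → ℝ → Vec d → ℝ} (hU : SubsolnSwitch ν T b σ η γ f ζ ε αs c U)
    (hV : SupersolnSwitch ν T b σ η γ f ζ ε αs c V) {M : ℝ}
    (hMU : ∀ j t x, |U j t x| ≤ M) (hMV : ∀ j t x, |V j t x| ≤ M)
    (hu : ∀ j, UpperSemicontinuousOn (fun p : ℝ × Vec d => U j p.1 p.2) (Icc 0 T ×ˢ univ))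
    (hv : ∀ j, LowerSemicontinuousOn (fun p : ℝ × Vec d => V j p.1 p.2) (Icc 0 T ×ˢ univ))
    {j : Fin J} {t s : ℝ} (ht : t ∈ Ioc (0:ℝ) T) (hs : s ∈ Ioc (0:ℝ) T) {x y : Vec d}
    (hζ : ζ t x < U j t x) (hsw : MaxSw U c j t x < U j t x)
    {μ β δ ρ R L q ω τ N : ℝ} (hμ : 0 ≤ μ) (hβ : 0 ≤ β) (hδ : 0 < δ) (hρ : 0 ≤ ρ) (hL : 0 ≤ L)
    (hN : (ν.restrict {e : Vec n | ε < ‖e‖}).real univ = N)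
    (hx : ‖x‖ ≤ R) (hy : ‖y‖ ≤ R) (hxy : ‖x - y‖ ≤ 1)
    (hcoef : ∑ k, ‖colE (sigmaTilde ν σ η ε (αs j) x) k - colE (sigmaTilde ν σ η ε (αs j) y) k‖
        ≤ L * ‖x - y‖)
    (hcx : ∑ k, ‖colE (sigmaTilde ν σ η ε (αs j) x) k‖ ≤ L * (1 + ‖x‖))
    (hcy : ∑ k, ‖colE (sigmaTilde ν σ η ε (αs j) y) k‖ ≤ L * (1 + ‖y‖))
    (hb : ‖b (αs j) x - b (αs j) y‖ ≤ L * ‖x - y‖) (hbx : ‖b (αs j) x‖ ≤ L * (1 + ‖x‖))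
    (hby : ‖b (αs j) y‖ ≤ L * (1 + ‖y‖))
    {a a' c₀ c₀' : ℝ} {p p' : Vec d} {X X' : Vec d →L[ℝ] Vec d} (haa : -ρ ≤ a + a')
    (hp : ‖p - (1 / δ) • (x - y)‖ ≤ ρ) (hp' : ‖p' + (1 / δ) • (x - y)‖ ≤ ρ)
    (hX : ∀ h k, ⟪X h, k⟫ = ⟪h, X k⟫) (hX' : ∀ h k, ⟪X' h, k⟫ = ⟪h, X' k⟫)
    (hXX : ∀ h k, ⟪X h, h⟫ + ⟪X' k, k⟫ ≤ 2 / δ * ‖h - k‖ ^ 2 + ρ * (‖h‖ ^ 2 + ‖k‖ ^ 2))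
    (hjet : ∀ᶠ z in 𝓝[Icc 0 T ×ˢ univ] (t, x), (1 + μ) * U j z.1 z.2 - β * logPen z.2 ≤
      (1 + μ) * U j t x - β * logPen x + a * (z.1 - t) + c₀ * (z.1 - t) ^ 2 + ⟪p, z.2 - x⟫
        + 1 / 2 * ⟪X (z.2 - x), z.2 - x⟫)
    (hjet' : ∀ᶠ z in 𝓝[Icc 0 T ×ˢ univ] (s, y), -V j z.1 z.2 - β * logPen z.2 ≤
      -V j s y - β * logPen y + a' * (z.1 - s) + c₀' * (z.1 - s) ^ 2 + ⟪p', z.2 - y⟫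
        + 1 / 2 * ⟪X' (z.2 - y), z.2 - y⟫)
    (hmax : ∀ x' y' : Vec d, ‖x' - x‖ ≤ C → ‖y' - y‖ ≤ C →
      (1 + μ) * U j t x' - β * logPen x' + (-V j s y' - β * logPen y')
        - ‖x' - y'‖ ^ 2 / (2 * δ) ≤
      (1 + μ) * U j t x - β * logPen x + (-V j s y - β * logPen y)
        - ‖x - y‖ ^ 2 / (2 * δ) + ρ)
    (hUV : V j s y ≤ (1 + μ) * U j t x)
    (hq : L * (1 + R) * (‖x - y‖ / δ + ρ) + 4 * β * L ≤ q)
    (hω : ∀ (Q : Vec d) (k : ℝ), ‖Q‖ ≤ L * (1 + R) * (‖x - y‖ / δ + ρ) + 4 * β * L →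
      |f (αs j) t x (V j s y) Q k - f (αs j) t y (V j s y) Q k| ≤ ω)
    (hτ : ∀ (Q : Vec d) (k : ℝ), ‖Q‖ ≤ q → |k| ≤ 2 * M * C * N →
      |f (αs j) t y (V j s y) Q k - f (αs j) s y (V j s y) Q k| ≤ τ) :
    C * ((1 + μ) * U j t x - V j s y) ≤
      (L ^ 2 + L + N * (C ^ 2 / 2) + C * L + C ^ 2 * N * (C + C ^ 2 / 2)) * (‖x - y‖ ^ 2 / δ)
      + (12 * L ^ 2 + 8 * L + 4 * N * C + 10 * C * L + 2 * C ^ 3 * N) * β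
      + 2 * M * C ^ 2 * N * ‖x - y‖
      + (1 + (L * (1 + R)) ^ 2 + 2 * L * (1 + R) + N * (1 + 2 * C) + C * L + 2 * C * L * (1 + R)
        + C ^ 2 * N) * ρ
      + (C + 2 * C * (M + q + 2 * M * C * N)) * μ + ω + τ := by
  have hC := hA.hC
  have hM0 : 0 ≤ M := (abs_nonneg _).trans (hMU j t x)
  have hN0 : 0 ≤ N := by rw [← hN]; exact measureReal_nonneg
  have htI : t ∈ Icc (0:ℝ) T := ⟨ht.1.le, ht.2⟩
  have hsI : s ∈ Icc (0:ℝ) T := ⟨hs.1.le, hs.2⟩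
  have hmu : Measurable (U j t) := measurable_section_of_upperSemicontinuousOn (hu j) htI
  have hmv : Measurable (V j s) := by
    have h := measurable_section_of_upperSemicontinuousOn (u := fun t x => -V j t x) (hv j).neg hsI
    have h2 := h.neg
    simp only [Pi.neg_def, neg_neg] at h2
    exact h2
  have hw : 0 < 1 + μ := by linarith
  have hsub := hU.le_of_jet hA hε hαs hMU hu ht hζ hsw hw hX hjet rfl
  have hsup := (hV.le_of_jet hA hε hαs hMV hv hs hX' hjet' rfl).2.2
  have hinc := fun e => hA.increment_le (hαs j) (u := U j t) (v := V j s) (w := 1 + μ)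
    hβ hδ hp hp' e
    (hmax _ _ (by rw [add_sub_cancel_left]; exact hA.norm_jump_le (hαs j) x e)
      (by rw [add_sub_cancel_left]; exact hA.norm_jump_le (hαs j) y e))
  have hK := hA.Kfun_sub_le hε (hαs j) hmu hmv (hMU j t) (hMV j s) hw fun e => (hinc e).2
  have hB0 : 0 ≤ 2 * β * C + ρ + (C + C ^ 2 / 2) * (‖x - y‖ ^ 2 / δ) := by positivity
  have hB := hA.Bfun_sub_le hε (α := αs j) hmu hmv (hMU j t) (hMV j s) hB0 fun e => (hinc e).1
  have hBU := hA.abs_Bfun_le hε (α := αs j) (hMU j t) x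
  have hBV := hA.abs_Bfun_le hε (α := αs j) (hMV j s) y
  rw [hN] at hK hB hBU hBV
  obtain ⟨hQ, hQ', hQQ⟩ := norm_mvE_jet_le hδ hρ hβ hL hx hy hxy hp hp' hcoef hcx hcy
  have hκ0 : 0 ≤ N * (C * (2 * β * C + ρ + (C + C ^ 2 / 2) * (‖x - y‖ ^ 2 / δ))
      + 2 * M * C * ‖x - y‖) := by positivity
  have hsrc := hA.source_sub_le (hαs j) htI hμ rfl (hMU j t x) (hQ.trans hq) hBU hκ0 hB hUV
    (hω _ _ hQ) (hτ _ _ (hQ'.trans hq) hBV)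
  have hR : ∀ {z : Vec d}, ‖z‖ ≤ R → L * (1 + ‖z‖) ≤ L * (1 + R) := fun h =>
    mul_le_mul_of_nonneg_left (by linarith) hL
  have h2 := sum_inner_add_sum_inner_le hδ hρ hXX hcoef (hcx.trans (hR hx)) (hcy.trans (hR hy))
  have hx1 := mul_le_mul_of_nonneg_left (sum_inner_logPenHess_le hcx) (by linarith : (0:ℝ) ≤ β / 2)
  have hy1 := mul_le_mul_of_nonneg_left (sum_inner_logPenHess_le hcy) (by linarith : (0:ℝ) ≤ β / 2)
  have h1 := inner_add_inner_le hδ hβ hL hx hy hp hp' hb hbx hby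
  have hQQ' := mul_le_mul_of_nonneg_left hQQ hC.le
  have e2 : (L * ‖x - y‖) ^ 2 / δ = L ^ 2 * (‖x - y‖ ^ 2 / δ) := by ring
  rw [e2] at h2
  have combine : ∀ {g₁ g₂ g₃ g₄ d₁ d₂ k₁ k₂ F₁ F₂ S₁ S₂ D₁ K₁ F₀ G : ℝ},
      a ≤ g₁ + g₂ + d₁ + k₁ + F₁ → a' ≤ g₃ + g₄ + d₂ - k₂ - F₂ → g₁ + g₃ ≤ S₁ →
      g₂ ≤ S₂ → g₄ ≤ S₂ → d₁ + d₂ ≤ D₁ → k₁ - k₂ ≤ K₁ → F₁ - F₂ ≤ -G + F₀ →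
      G ≤ ρ + S₁ + 2 * S₂ + D₁ + K₁ + F₀ := by
    intros
    linarith
  have hfin := combine hsub hsup h2 hx1 hy1 h1 hK
    (hsrc.trans_eq (by simp only [add_assoc]; rfl))
  refine hfin.trans ?_
  generalize ‖x - y‖ ^ 2 / δ = D at *
  linarith only [hQQ']

end

/-- An upper semicontinuous function on a compact set of pairs which is negative on the diagonal is
negative near the diagonal. -/
lemma exists_neg_near_diagonal {E : Type*} [MetricSpace E] {K : Set (E × E)} (hK : IsCompact K)
    {F : E × E → ℝ} (hF : UpperSemicontinuousOn F K) (h : ∀ z, (z, z) ∈ K → F (z, z) < 0) :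
    ∃ r > 0, ∀ z z', (z, z') ∈ K → dist z z' ≤ r → F (z, z') < 0 := by
  have key : ∃ r > 0, ∀ p ∈ K, p ∈ K → dist p.1 p.2 ≤ r → F p < 0 := by
    refine hK.induction_on (p := fun S => ∃ r > 0, ∀ p ∈ S, p ∈ K → dist p.1 p.2 ≤ r → F p < 0)
      ⟨1, one_pos, by simp⟩ ?_ ?_ ?_
    · rintro S S' hS ⟨r, hr, h'⟩
      exact ⟨r, hr, fun p hp => h' p (hS hp)⟩
    · rintro S S' ⟨r, hr, h1⟩ ⟨r', hr', h2⟩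
      refine ⟨min r r', lt_min hr hr', fun p hp hpK hd => ?_⟩
      rcases hp with hp | hp
      · exact h1 p hp hpK (hd.trans (min_le_left _ _))
      · exact h2 p hp hpK (hd.trans (min_le_right _ _))
    · rintro ⟨z, z'⟩ hp
      by_cases hz : z = z'
      · subst hz
        exact ⟨{p | F p < 0}, hF (z, z) hp 0 (h z hp), 1, one_pos, fun p hp _ _ => hp⟩
      · have hd : 0 < dist z z' := dist_pos.2 hz
        refine ⟨{p | dist z z' / 2 < dist p.1 p.2}, nhdsWithin_le_nhds
          ((continuous_dist.tendsto (z, z')).eventually (lt_mem_nhds (half_lt_self hd))),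
          dist z z' / 2, half_pos hd, fun p hp _ hle => absurd hle (not_le.2 hp)⟩
  obtain ⟨r, hr, h'⟩ := key
  exact ⟨r, hr, fun z z' hz => h' (z, z') hz hz⟩

lemma nhdsWithin_prod_closedBall_eq {I : Set ℝ} {x : Vec d} {R : ℝ} (hx : ‖x‖ < R) (t : ℝ) :
    𝓝[I ×ˢ closedBall (0 : Vec d) R] (t, x) = 𝓝[I ×ˢ univ] (t, x) := by
  have hx' : closedBall (0 : Vec d) R ∈ 𝓝 x :=
    mem_of_superset (isOpen_ball.mem_nhds (by simpa using hx)) ball_subset_closedBall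
  rw [nhdsWithin_prod_eq, nhdsWithin_prod_eq, nhdsWithin_univ, nhdsWithin_eq_nhds.2 hx']

section
variable {ν : Measure (Vec n)} {A : Set (Vec m)} {T : ℝ}
    {b : Vec m → Vec d → Vec d} {σ : Vec m → Vec d → Matrix (Fin d) (Fin d) ℝ}
    {η : Vec m → Vec d → Vec n → Vec d} {γ : Vec d → Vec n → ℝ}
    {f : Vec m → ℝ → Vec d → ℝ → Vec d → ℝ → ℝ}
    {ζ : ℝ → Vec d → ℝ} {g : Vec d → ℝ} {C : ℝ}

lemma AssumptionA.continuousOn_source (hA : AssumptionA ν A T b σ η γ f ζ g C) {α : Vec m}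
    (hα : α ∈ A) {R : ℝ} (hR : 0 < R) :
    ContinuousOn (fun z : ℝ × Vec d × ℝ × Vec d × ℝ => f α z.1 z.2.1 z.2.2.1 z.2.2.2.1 z.2.2.2.2)
      {z | z.1 ∈ Icc (0:ℝ) T ∧ ‖z.2.1‖ ≤ R ∧ |z.2.2.1| ≤ R} := by
  obtain ⟨mR, hmc, hm0, -, hmR⟩ := hA.hf_x R hR
  rintro ⟨t₀, x₀, u₀, p₀, k₀⟩ ⟨ht₀, hx₀, hu₀⟩
  rw [ContinuousWithinAt, tendsto_iff_dist_tendsto_zero]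
  set S := {z : ℝ × Vec d × ℝ × Vec d × ℝ | z.1 ∈ Icc (0:ℝ) T ∧ ‖z.2.1‖ ≤ R ∧ |z.2.2.1| ≤ R}
  have hbound : Continuous fun z : ℝ × Vec d × ℝ × Vec d × ℝ =>
      C * (|z.2.2.1 - u₀| + ‖z.2.2.2.1 - p₀‖ + |z.2.2.2.2 - k₀|)
        + mR (‖z.2.1 - x₀‖ * (1 + ‖p₀‖)) + |f α z.1 x₀ u₀ p₀ k₀ - f α t₀ x₀ u₀ p₀ k₀| := by
    refine ((Continuous.mul continuous_const (by fun_prop)).add (hmc.comp (by fun_prop))).add ?_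
    exact (((hA.hf_t_cont α x₀ u₀ p₀ k₀).comp continuous_fst).sub continuous_const).abs
  have hlim := (hbound.tendsto (t₀, x₀, u₀, p₀, k₀)).mono_left
    (nhdsWithin_le_nhds (s := S))
  simp only [sub_self, abs_zero, norm_zero, add_zero, mul_zero, zero_mul, hm0] at hlim
  refine squeeze_zero' (Eventually.of_forall fun _ => dist_nonneg) ?_ hlim
  filter_upwards [self_mem_nhdsWithin] with z hz
  obtain ⟨t, x, u, p, k⟩ := z
  obtain ⟨ht, hx, hu⟩ := hz
  dsimp only at ht hx hu ⊢
  rw [Real.dist_eq]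
  have h1 := hA.hf_lip α hα α hα t ht x u u₀ p p₀ k k₀
  have h2 := hmR α hα t ht x x₀ u₀ p₀ k₀ hx hx₀ hu₀
  rw [sub_self, norm_zero, zero_add] at h1
  refine (abs_sub_le _ (f α t x u₀ p₀ k₀) _).trans ?_
  have h3 := abs_sub_le (f α t x u₀ p₀ k₀) (f α t x₀ u₀ p₀ k₀) (f α t₀ x₀ u₀ p₀ k₀)
  linarith

/-- Uniform continuity in time of the source on bounded sets, for finitely many controls. -/
lemma AssumptionA.exists_time_modulus (hA : AssumptionA ν A T b σ η γ f ζ g C)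
    {J : ℕ} {αs : Fin J → Vec m} (hαs : ∀ j, αs j ∈ A) {R : ℝ} (hR : 0 < R) (q K : ℝ) {τ : ℝ}
    (hτ : 0 < τ) :
    ∃ r > 0, ∀ j, ∀ t ∈ Icc (0:ℝ) T, ∀ s ∈ Icc (0:ℝ) T, |t - s| ≤ r →
      ∀ (x : Vec d) (u : ℝ) (p : Vec d) (k : ℝ), ‖x‖ ≤ R → |u| ≤ R → ‖p‖ ≤ q → |k| ≤ K →
        |f (αs j) t x u p k - f (αs j) s x u p k| ≤ τ := by
  set Z : Set (ℝ × Vec d × ℝ × Vec d × ℝ) :=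
    Icc (0:ℝ) T ×ˢ closedBall 0 R ×ˢ closedBall 0 R ×ˢ closedBall 0 q ×ˢ closedBall 0 K with hZ
  have hZc : IsCompact Z := isCompact_Icc.prod ((isCompact_closedBall _ _).prod
    ((isCompact_closedBall _ _).prod ((isCompact_closedBall _ _).prod (isCompact_closedBall _ _))))
  have hj : ∀ j, ∃ r > 0, ∀ t ∈ Icc (0:ℝ) T, ∀ s ∈ Icc (0:ℝ) T, |t - s| < r →
      ∀ (x : Vec d) (u : ℝ) (p : Vec d) (k : ℝ), ‖x‖ ≤ R → |u| ≤ R → ‖p‖ ≤ q → |k| ≤ K →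
        |f (αs j) t x u p k - f (αs j) s x u p k| ≤ τ := fun j => by
    have hc := (hA.continuousOn_source (hαs j) hR).mono (t := Z) (fun z hz => by
      simp only [hZ, mem_prod, mem_closedBall_zero_iff, Real.norm_eq_abs] at hz
      exact ⟨hz.1, hz.2.1, hz.2.2.1⟩)
    obtain ⟨r, hr, h⟩ := Metric.uniformContinuousOn_iff.1
      (hZc.uniformContinuousOn_of_continuous hc) τ hτ
    refine ⟨r, hr, fun t ht s hs hts x u p k hx hu hp hk => ?_⟩
    have hm : ∀ t ∈ Icc (0:ℝ) T, (t, x, u, p, k) ∈ Z := fun t ht => by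
      simp only [hZ, mem_prod, mem_closedBall_zero_iff, Real.norm_eq_abs]
      exact ⟨ht, hx, hu, hp, hk⟩
    have := h (t, x, u, p, k) (hm t ht) (s, x, u, p, k) (hm s hs) (by
      rw [Prod.dist_eq, dist_self, Real.dist_eq, max_eq_left (abs_nonneg _)]
      exact hts)
    exact this.le
  choose r hr h using hj
  obtain ⟨r₀, hr₀, hle⟩ : ∃ r₀ > 0, ∀ j, r₀ < r j := by
    have h1 : ∀ᶠ r₀ in 𝓝[>] (0:ℝ), ∀ j, r₀ < r j := eventually_all.2 fun j =>
      nhdsWithin_le_nhds (gt_mem_nhds (hr j))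
    obtain ⟨r₀, h2, h3⟩ := (h1.and self_mem_nhdsWithin).exists
    exact ⟨r₀, h3, h2⟩
  exact ⟨r₀, hr₀, fun j t ht s hs hts => h j t ht s hs (hts.trans_lt (hle j))⟩

lemma AssumptionA.continuous_obstacle (hA : AssumptionA ν A T b σ η γ f ζ g C) :
    Continuous fun p : ℝ × Vec d => ζ p.1 p.2 := by
  have hlip : ∀ t, LipschitzWith C.toNNReal (ζ t) := fun t =>
    LipschitzWith.of_dist_le_mul fun x y => by
      have := hA.hζg_lip t x y
      rw [Real.coe_toNNReal _ hA.hC.le, Real.dist_eq, dist_eq_norm]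
      linarith [abs_nonneg (g x - g y)]
  exact continuous_prod_of_continuous_lipschitzWith' _ _ (fun t => hlip t) fun x => hA.hζ_t_cont x

end

/-- Jets at a near maximum of the doubled and penalised differences of two finite families of
functions. -/
lemma exists_jets_of_families {T R : ℝ} (hT : 0 ≤ T) (hR : 0 ≤ R) {J : ℕ} (hJ : 0 < J)
    {U V : Fin J → ℝ → Vec d → ℝ}
    (hu : ∀ j, UpperSemicontinuousOn (fun p : ℝ × Vec d => U j p.1 p.2) (Icc 0 T ×ˢ univ))
    (hv : ∀ j, LowerSemicontinuousOn (fun p : ℝ × Vec d => V j p.1 p.2) (Icc 0 T ×ˢ univ))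
    {w : ℝ} (hw : 0 ≤ w) (β : ℝ) {κ δ ρ : ℝ} (hκ : 0 < κ) (hδ : 0 < δ) (hρ : 0 < ρ) :
    ∃ (j : Fin J) (t s : ℝ) (x y : Vec d) (a a' c₀ c₀' : ℝ) (p p' : Vec d)
      (X X' : Vec d →L[ℝ] Vec d),
      t ∈ Icc 0 T ∧ s ∈ Icc 0 T ∧ ‖x‖ ≤ R ∧ ‖y‖ ≤ R ∧
      (∀ k, ∀ t' ∈ Icc 0 T, ∀ s' ∈ Icc 0 T, ∀ x' y' : Vec d, ‖x'‖ ≤ R → ‖y'‖ ≤ R →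
        w * U k t' x' - β * logPen x' + (-V k s' y' - β * logPen y')
          - ((t' - s') ^ 2 / (2 * κ) + ‖x' - y'‖ ^ 2 / (2 * δ)) ≤
        w * U j t x - β * logPen x + (-V j s y - β * logPen y)
          - ((t - s) ^ 2 / (2 * κ) + ‖x - y‖ ^ 2 / (2 * δ)) + ρ) ∧
      |a + a'| ≤ ρ ∧ ‖p - (1 / δ) • (x - y)‖ ≤ ρ ∧ ‖p' + (1 / δ) • (x - y)‖ ≤ ρ ∧
      (∀ h k, ⟪X h, k⟫ = ⟪h, X k⟫) ∧ (∀ h k, ⟪X' h, k⟫ = ⟪h, X' k⟫) ∧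
      (∀ᶠ z in 𝓝[Icc 0 T ×ˢ closedBall 0 R] (t, x), w * U j z.1 z.2 - β * logPen z.2 ≤
        w * U j t x - β * logPen x + a * (z.1 - t) + c₀ * (z.1 - t) ^ 2 + ⟪p, z.2 - x⟫
          + 1 / 2 * ⟪X (z.2 - x), z.2 - x⟫) ∧
      (∀ᶠ z in 𝓝[Icc 0 T ×ˢ closedBall 0 R] (s, y), -V j z.1 z.2 - β * logPen z.2 ≤
        -V j s y - β * logPen y + a' * (z.1 - s) + c₀' * (z.1 - s) ^ 2 + ⟪p', z.2 - y⟫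
          + 1 / 2 * ⟪X' (z.2 - y), z.2 - y⟫) ∧
      ∀ h k, ⟪X h, h⟫ + ⟪X' k, k⟫ ≤ 2 / δ * ‖h - k‖ ^ 2 + ρ * (‖h‖ ^ 2 + ‖k‖ ^ 2) := by
  have hS : IsCompact (Icc 0 T ×ˢ closedBall (0 : Vec d) R) :=
    isCompact_Icc.prod (isCompact_closedBall _ _)
  have hne : (Icc 0 T ×ˢ closedBall (0 : Vec d) R).Nonempty :=
    ⟨(0, 0), ⟨le_rfl, hT⟩, by simpa using hR⟩
  have hsub : Icc 0 T ×ˢ closedBall (0 : Vec d) R ⊆ Icc 0 T ×ˢ univ :=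
    prod_mono_right (subset_univ _)
  have hpen : UpperSemicontinuousOn (fun p : ℝ × Vec d => -(β * logPen p.2))
      (Icc 0 T ×ˢ closedBall (0 : Vec d) R) := by
    refine ContinuousOn.upperSemicontinuousOn (Continuous.continuousOn ?_)
    exact ((contDiff_logPen.continuous.comp continuous_snd).const_mul β).neg
  have hu' : ∀ j, UpperSemicontinuousOn (fun p : ℝ × Vec d => w * U j p.1 p.2 - β * logPen p.2)
      (Icc 0 T ×ˢ closedBall (0 : Vec d) R) := fun j => by
    simp only [sub_eq_add_neg]
    refine UpperSemicontinuousOn.add ?_ hpen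
    exact (continuous_const_mul w).comp_upperSemicontinuousOn ((hu j).mono hsub)
      fun r r' h => mul_le_mul_of_nonneg_left h hw
  have hv' : ∀ j, UpperSemicontinuousOn (fun p : ℝ × Vec d => -V j p.1 p.2 - β * logPen p.2)
      (Icc 0 T ×ˢ closedBall (0 : Vec d) R) := fun j => by
    simp only [sub_eq_add_neg]
    exact ((hv j).mono hsub).neg.add hpen
  have key := fun j => exists_parabolic_jets_at_perturbed_max hS hne (hu' j) (hv' j) hκ hδ hρ
  choose z hz z' hz' a a' c₀ c₀' p p' X X' hmax haa hp hp' hX hX' hj hj' hXX using key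
  have : Nonempty (Fin J) := ⟨⟨0, hJ⟩⟩
  obtain ⟨j, hjmax⟩ := Finite.exists_max fun j => w * U j (z j).1 (z j).2 - β * logPen (z j).2
    + (-V j (z' j).1 (z' j).2 - β * logPen (z' j).2)
    - (((z j).1 - (z' j).1) ^ 2 / (2 * κ) + ‖(z j).2 - (z' j).2‖ ^ 2 / (2 * δ))
  have hball : ∀ {q : ℝ × Vec d}, q ∈ Icc 0 T ×ˢ closedBall (0 : Vec d) R → ‖q.2‖ ≤ R :=
    fun h => by simpa using h.2
  refine ⟨j, (z j).1, (z' j).1, (z j).2, (z' j).2, a j, a' j, c₀ j, c₀' j, p j, p' j, X j, X' j,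
    (hz j).1, (hz' j).1, hball (hz j), hball (hz' j), fun k t' ht' s' hs' x' y' hx' hy' => ?_,
    haa j, hp j, hp' j, hX j, hX' j, hj j, hj' j, hXX j⟩
  have h1 := hmax k (t', x') ⟨ht', by simpa using hx'⟩ (s', y') ⟨hs', by simpa using hy'⟩
  exact h1.trans (add_le_add_left (hjmax k) ρ)

/-- An upper semicontinuous function on a compact set of pairs which is negative on the diagonal is
negative sufficiently near the diagonal. -/
lemma eventually_neg_near_diagonal {E : Type*} [MetricSpace E] {K : Set (E × E)} (hK : IsCompact K)
    {F : E × E → ℝ} (hF : UpperSemicontinuousOn F K) (h : ∀ z, (z, z) ∈ K → F (z, z) < 0) :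
    ∀ᶠ r in 𝓝[>] (0:ℝ), ∀ z z', (z, z') ∈ K → dist z z' ≤ r → F (z, z') < 0 := by
  obtain ⟨r₀, hr₀, h'⟩ := exists_neg_near_diagonal hK hF h
  filter_upwards [nhdsWithin_le_nhds (gt_mem_nhds hr₀)] with r hr z z' hz hd
  exact h' z z' hz (hd.trans (le_of_lt hr))

lemma eventually_mul_le_of_pos (K : ℝ) {a : ℝ} (ha : 0 < a) : ∀ᶠ r in 𝓝[>] (0:ℝ), K * r ≤ a := by
  have h : Tendsto (fun r : ℝ => K * r) (𝓝 0) (𝓝 (K * 0)) :=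
    (continuous_const_mul K).tendsto 0
  rw [mul_zero] at h
  exact nhdsWithin_le_nhds ((h.eventually (gt_mem_nhds ha)).mono fun r hr => le_of_lt hr)

lemma upperSemicontinuousOn_add_neg_add {E : Type*} [TopologicalSpace E] {S : Set E} {u v : E → ℝ}
    (hu : UpperSemicontinuousOn u S) (hv : LowerSemicontinuousOn v S) {G : E × E → ℝ}
    (hG : Continuous G) :
    UpperSemicontinuousOn (fun p : E × E => u p.1 + -v p.2 + G p) (S ×ˢ S) := by
  refine UpperSemicontinuousOn.add (UpperSemicontinuousOn.add ?_ ?_)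
    hG.continuousOn.upperSemicontinuousOn
  · exact hu.comp (g := Prod.fst) continuous_fst.continuousOn fun p hp => hp.1
  · exact hv.neg.comp (g := Prod.snd) continuous_snd.continuousOn fun p hp => hp.2

lemma norm_le_of_mul_logPen_le {β K : ℝ} (hβ : 0 < β) {x : Vec d} (h : β * logPen x ≤ K) :
    ‖x‖ ≤ Real.exp (K / β) := by
  have h1 : logPen x ≤ K / β := by
    rw [le_div_iff₀ hβ]
    linarith
  have h2 : 0 < 1 + ‖x‖ ^ 2 := by positivity
  rw [logPen, Real.log_le_iff_le_exp h2] at h1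
  nlinarith [sq_nonneg (‖x‖ - 1)]

/-- At a point where the obstacle by switching is active for the subsolution, another component has
a larger difference. -/
lemma exists_mul_le_of_le_MaxSw {J : ℕ} (hJ : 2 ≤ J) {U V : Fin J → ℝ → Vec d → ℝ} {c : ℝ}
    {j : Fin J} {t s : ℝ} {x y : Vec d} (h : U j t x ≤ MaxSw U c j t x)
    (h' : MaxSw V c j s y ≤ V j s y) : ∃ k, U j t x ≤ U k t x - c ∧ V k s y - c ≤ V j s y := by
  have : Nontrivial (Fin J) := Fin.nontrivial_iff_two_le.2 hJ
  obtain ⟨k₀, hk₀⟩ := exists_ne j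
  have : Nonempty {k : Fin J // k ≠ j} := ⟨⟨k₀, hk₀⟩⟩
  obtain ⟨k, hk⟩ := exists_eq_ciSup_of_finite (f := fun k : {k : Fin J // k ≠ j} => U k t x - c)
  refine ⟨k, h.trans hk.symm.le, le_trans ?_ h'⟩
  exact le_ciSup (f := fun k : {k : Fin J // k ≠ j} => V k s y - c) (finite_range _).bddAbove k

lemma abs_le_of_sq_div_le {z κ K r : ℝ} (hκ : 0 < κ) (hr : 0 ≤ r) (h : z ^ 2 / (2 * κ) ≤ K)
    (hK : 2 * κ * K ≤ r ^ 2) : |z| ≤ r := by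
  rw [div_le_iff₀ (by positivity)] at h
  exact abs_le_of_sq_le_sq (by linarith) hr

/-- Consequences of near maximality for the doubled and penalised difference. -/
lemma near_max_estimates {u v u₀ v₀ l l' l₀ q q' μ M θ ρ β : ℝ} (hβ : 0 ≤ β) (hμ : 0 ≤ μ)
    (hl : 0 ≤ l) (hl' : 0 ≤ l') (hq : 0 ≤ q) (hq' : 0 ≤ q') (hu : |u| ≤ M) (hv : |v| ≤ M)
    (hu₀ : |u₀| ≤ M) (hθ : θ ≤ u₀ - v₀) (hθ0 : 0 ≤ θ) (hμM : μ * M ≤ θ / 8) (hρ : ρ ≤ θ / 8)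
    (hl₀ : β * l₀ + β * l₀ ≤ θ / 8)
    (h : (1 + μ) * u₀ - β * l₀ + (-v₀ - β * l₀) ≤
      (1 + μ) * u - β * l + (-v - β * l') - (q + q') + ρ) :
    β * l ≤ 2 * M + θ ∧ β * l' ≤ 2 * M + θ ∧ q ≤ 2 * M + θ ∧ q' ≤ 2 * M + θ ∧
      5 * θ / 8 ≤ (1 + μ) * u - v ∧ θ / 2 ≤ u - v := by
  have h1 : 0 ≤ β * l := by positivity
  have h2 : 0 ≤ β * l' := by positivity
  have h3 : μ * u ≤ μ * M := mul_le_mul_of_nonneg_left (abs_le.1 hu).2 hμ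
  have h4 : μ * -M ≤ μ * u₀ := mul_le_mul_of_nonneg_left (abs_le.1 hu₀).1 hμ
  have h5 := (abs_le.1 hu).2
  have h6 := (abs_le.1 hv).1
  refine ⟨?_, ?_, ?_, ?_, ?_, ?_⟩ <;> linarith

section
variable {ν : Measure (Vec n)} {A : Set (Vec m)} {T : ℝ}
    {b : Vec m → Vec d → Vec d} {σ : Vec m → Vec d → Matrix (Fin d) (Fin d) ℝ}
    {η : Vec m → Vec d → Vec n → Vec d} {γ : Vec d → Vec n → ℝ}
    {f : Vec m → ℝ → Vec d → ℝ → Vec d → ℝ → ℝ}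
    {ζ : ℝ → Vec d → ℝ} {g : Vec d → ℝ} {C : ℝ}

/-- Near the diagonal the differences are almost maximal on the diagonal, small at time zero, and
the obstacle varies little. -/
lemma AssumptionA.eventually_near_diagonal (hA : AssumptionA ν A T b σ η γ f ζ g C) {J : ℕ}
    {U V : Fin J → ℝ → Vec d → ℝ}
    (hu : ∀ j, UpperSemicontinuousOn (fun p : ℝ × Vec d => U j p.1 p.2) (Icc 0 T ×ˢ univ))
    (hv : ∀ j, LowerSemicontinuousOn (fun p : ℝ × Vec d => V j p.1 p.2) (Icc 0 T ×ˢ univ))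
    (h0 : ∀ j x, U j 0 x ≤ V j 0 x) {R β ϖ M₀ θ : ℝ} (hϖ : 0 < ϖ) (hθ : 0 < θ)
    (hM₀ : ∀ k, ∀ t ∈ Icc (0:ℝ) T, ∀ x : Vec d, ‖x‖ ≤ R →
      U k t x - V k t x - (β * logPen x + β * logPen x) ≤ M₀) :
    ∀ᶠ r in 𝓝[>] (0:ℝ), ∀ t ∈ Icc (0:ℝ) T, ∀ s ∈ Icc (0:ℝ) T, ∀ x y : Vec d, ‖x‖ ≤ R → ‖y‖ ≤ R →
      |t - s| ≤ r → ‖x - y‖ ≤ r →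
        (∀ k, U k t x - V k s y - (β * logPen x + β * logPen y) ≤ M₀ + ϖ) ∧
        (∀ k, t = 0 ∨ s = 0 → U k t x - V k s y < θ / 2) ∧ ζ t x - ζ s y < θ / 2 := by
  set S := Icc 0 T ×ˢ closedBall (0 : Vec d) R with hS
  have hSc : IsCompact S := isCompact_Icc.prod (isCompact_closedBall _ _)
  have hsub : S ⊆ Icc 0 T ×ˢ univ := prod_mono_right (subset_univ _)
  have hpen : Continuous fun p : (ℝ × Vec d) × (ℝ × Vec d) =>
      -(β * logPen p.1.2 + β * logPen p.2.2) - (M₀ + ϖ) := by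
    have := contDiff_logPen (d := d) |>.continuous
    fun_prop
  have hζ : Continuous fun p : (ℝ × Vec d) × (ℝ × Vec d) =>
      ζ p.1.1 p.1.2 - ζ p.2.1 p.2.2 - θ / 2 :=
    ((hA.continuous_obstacle.comp continuous_fst).sub
      (hA.continuous_obstacle.comp continuous_snd)).sub continuous_const
  have ha := eventually_all.2 fun k => eventually_neg_near_diagonal (hSc.prod hSc)
    (upperSemicontinuousOn_add_neg_add ((hu k).mono hsub) ((hv k).mono hsub) hpen)
    (fun z hz => by
      have := hM₀ k z.1 hz.1.1 z.2 (by simpa using hz.1.2)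
      linarith)
  have hcl : IsClosed {p : (ℝ × Vec d) × (ℝ × Vec d) | p.1.1 = 0 ∨ p.2.1 = 0} :=
    (isClosed_eq (by fun_prop) continuous_const).union
      (isClosed_eq (by fun_prop) continuous_const)
  have hb := eventually_all.2 fun k => eventually_neg_near_diagonal ((hSc.prod hSc).inter_right hcl)
    ((upperSemicontinuousOn_add_neg_add ((hu k).mono hsub) ((hv k).mono hsub)
      (G := fun _ => -(θ / 2)) continuous_const).mono inter_subset_left)
    (fun z hz => by
      have hz0 : z.1 = 0 := by simpa using hz.2
      have := h0 k z.2
      dsimp only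
      rw [hz0]
      linarith)
  have hc := eventually_neg_near_diagonal (hSc.prod hSc) hζ.continuousOn.upperSemicontinuousOn
    (fun z _ => by simpa using hθ)
  filter_upwards [ha, hb, hc] with r ha hb hc t ht s hs x y hx hy hts hxy
  have hz : ((t, x), (s, y)) ∈ S ×ˢ S := ⟨⟨ht, by simpa using hx⟩, ⟨hs, by simpa using hy⟩⟩
  have hd : dist (t, x) (s, y) ≤ r := by
    rw [Prod.dist_eq, Real.dist_eq, dist_eq_norm]
    exact max_le hts hxy
  refine ⟨fun k => ?_, fun k h => ?_, ?_⟩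
  · linarith only [ha k _ _ hz hd]
  · linarith only [hb k _ _ ⟨hz, h⟩ hd]
  · linarith only [hc _ _ hz hd]

end

lemma mul_one_add_norm_le {h δ ρ β L Lr Q r ϖ r₁ : ℝ} (hδ : 0 < δ) (h0 : 0 ≤ h) (hhr : h ≤ r)
    (hL : 0 ≤ L) (hLr : 0 ≤ Lr) (hβ : 0 ≤ β) (hρ1 : ρ ≤ 1) (hh : h ^ 2 / δ ≤ 6 * ϖ)
    (hr : (1 + 4 * β * L + Lr) * r ≤ r₁ / 4) (hϖ : Lr * (6 * ϖ) ≤ r₁ / 4) (hr₁ : 0 ≤ r₁)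
    (hQ : Q ≤ Lr * (h / δ + ρ) + 4 * β * L) : h * (1 + Q) ≤ r₁ := by
  have h1 : h * (1 + Q) ≤ h * (1 + (Lr * (h / δ + 1) + 4 * β * L)) := by gcongr; nlinarith
  have h2 : h * (1 + (Lr * (h / δ + 1) + 4 * β * L)) =
      (1 + 4 * β * L + Lr) * h + Lr * (h ^ 2 / δ) := by
    field_simp
    ring
  have h3 : (1 + 4 * β * L + Lr) * h ≤ (1 + 4 * β * L + Lr) * r := by gcongr
  have h4 : Lr * (h ^ 2 / δ) ≤ Lr * (6 * ϖ) := by gcongr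
  linarith

section
variable {ν : Measure (Vec n)} {A : Set (Vec m)} {T : ℝ}
    {b : Vec m → Vec d → Vec d} {σ : Vec m → Vec d → Matrix (Fin d) (Fin d) ℝ}
    {η : Vec m → Vec d → Vec n → Vec d} {γ : Vec d → Vec n → ℝ}
    {f : Vec m → ℝ → Vec d → ℝ → Vec d → ℝ → ℝ}
    {ζ : ℝ → Vec d → ℝ} {g : Vec d → ℝ} {C : ℝ}

/-- A positive value of `U - V` is incompatible with the equations, for a suitable choice of the
parameters of the doubling of variables. -/
lemma AssumptionA.false_of_parameters (hA : AssumptionA ν A T b σ η γ f ζ g C) {ε : ℝ}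
    (hε : ε ∈ Ioo (0:ℝ) 1) {J : ℕ} (hJ : 2 ≤ J) {αs : Fin J → Vec m} (hαs : ∀ j, αs j ∈ A) {c : ℝ}
    {U V : Fin J → ℝ → Vec d → ℝ} (hU : SubsolnSwitch ν T b σ η γ f ζ ε αs c U)
    (hV : SupersolnSwitch ν T b σ η γ f ζ ε αs c V) {M : ℝ}
    (hMU : ∀ j t x, |U j t x| ≤ M) (hMV : ∀ j t x, |V j t x| ≤ M)
    (hu : ∀ j, UpperSemicontinuousOn (fun p : ℝ × Vec d => U j p.1 p.2) (Icc 0 T ×ˢ univ))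
    (hv : ∀ j, LowerSemicontinuousOn (fun p : ℝ × Vec d => V j p.1 p.2) (Icc 0 T ×ˢ univ))
    {L N : ℝ} (hL : 0 < L)
    (hcoef : ∀ j, ∀ x y : Vec d,
      (∑ k, ‖colE (sigmaTilde ν σ η ε (αs j) x) k - colE (sigmaTilde ν σ η ε (αs j) y) k‖)
        ≤ L * ‖x - y‖ ∧
      (∑ k, ‖colE (sigmaTilde ν σ η ε (αs j) x) k‖) ≤ L * (1 + ‖x‖) ∧
      ‖b (αs j) x - b (αs j) y‖ ≤ L * ‖x - y‖ ∧ ‖b (αs j) x‖ ≤ L * (1 + ‖x‖))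
    (hN : (ν.restrict {e : Vec n | ε < ‖e‖}).real univ = N)
    {θ : ℝ} (hθ0 : 0 < θ) {j₀ : Fin J} {t₀ : ℝ} (ht₀ : t₀ ∈ Icc (0:ℝ) T) {x₀ : Vec d}
    (hθ : θ ≤ U j₀ t₀ x₀ - V j₀ t₀ x₀)
    {β : ℝ} (hβ : 0 < β)
    (hβK : (12 * L ^ 2 + 8 * L + 4 * N * C + 10 * C * L + 2 * C ^ 3 * N) * β ≤ C * θ / 16)
    (hβx : β * logPen x₀ + β * logPen x₀ ≤ θ / 8)
    {R : ℝ} (hRx : ‖x₀‖ ≤ R) (hRM : M ≤ R)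
    (hRβ : ∀ x : Vec d, β * logPen x ≤ 2 * M + θ → ‖x‖ ≤ R)
    {r₁ : ℝ} (hr₁ : 0 ≤ r₁)
    (hf : ∀ α ∈ A, ∀ t ∈ Icc (0:ℝ) T, ∀ (x x' : Vec d) (u : ℝ) (p : Vec d) (k : ℝ),
        ‖x‖ ≤ R → ‖x'‖ ≤ R → |u| ≤ R → ‖x - x'‖ * (1 + ‖p‖) ≤ r₁ →
        |f α t x u p k - f α t x' u p k| ≤ C * θ / 16)
    {ϖ : ℝ}
    (hϖK : (L ^ 2 + L + N * (C ^ 2 / 2) + C * L + C ^ 2 * N * (C + C ^ 2 / 2)) * (6 * ϖ)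
      ≤ C * θ / 16)
    (hϖr : L * (1 + R) * (6 * ϖ) ≤ r₁ / 4)
    {M₀ : ℝ} (hM₀ : ∃ k, ∃ t ∈ Icc (0:ℝ) T, ∃ x : Vec d, ‖x‖ ≤ R + C + 1 ∧
      M₀ ≤ U k t x - V k t x - (β * logPen x + β * logPen x))
    {r : ℝ} (hr : 0 ≤ r) (hr1 : r ≤ 1)
    (hdiag : ∀ t ∈ Icc (0:ℝ) T, ∀ s ∈ Icc (0:ℝ) T, ∀ x y : Vec d,
      ‖x‖ ≤ R + C + 1 → ‖y‖ ≤ R + C + 1 → |t - s| ≤ r → ‖x - y‖ ≤ r →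
        (∀ k, U k t x - V k s y - (β * logPen x + β * logPen y) ≤ M₀ + ϖ) ∧
        (∀ k, t = 0 ∨ s = 0 → U k t x - V k s y < θ / 2) ∧ ζ t x - ζ s y < θ / 2)
    (hr₁r : (1 + 4 * β * L + L * (1 + R)) * r ≤ r₁ / 4)
    (hrK : 2 * M * C ^ 2 * N * r ≤ C * θ / 16)
    {δ : ℝ} (hδ : 0 < δ) (hδr : 2 * δ * (2 * M + θ) ≤ r ^ 2)
    {r₂ : ℝ} (hr₂ : 0 ≤ r₂) (hr₂r : r₂ ≤ r) {q : ℝ}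
    (hq : L * (1 + R) * (r / δ + 1) + 4 * β * L ≤ q)
    (hτ : ∀ j, ∀ t ∈ Icc (0:ℝ) T, ∀ s ∈ Icc (0:ℝ) T, |t - s| ≤ r₂ →
      ∀ (x : Vec d) (u : ℝ) (p : Vec d) (k : ℝ), ‖x‖ ≤ R → |u| ≤ R → ‖p‖ ≤ q →
        |k| ≤ 2 * M * C * N → |f (αs j) t x u p k - f (αs j) s x u p k| ≤ C * θ / 16)
    {κ : ℝ} (hκ : 0 < κ) (hκr : 2 * κ * (2 * M + θ) ≤ r₂ ^ 2)
    {μ : ℝ} (hμ : 0 < μ) (hμθ : μ * M ≤ θ / 8) (hμϖ : μ * M ≤ ϖ / 2)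
    (hμK : (C + 2 * C * (M + q + 2 * M * C * N)) * μ ≤ C * θ / 16)
    {ρ : ℝ} (hρ : 0 < ρ) (hρ1 : ρ ≤ 1) (hρθ : ρ ≤ θ / 8) (hρϖ : ρ ≤ ϖ) (hρc : ρ < μ * c)
    (hρK : (1 + (L * (1 + R)) ^ 2 + 2 * L * (1 + R) + N * (1 + 2 * C) + C * L
      + 2 * C * L * (1 + R) + C ^ 2 * N) * ρ ≤ C * θ / 16) : False := by
  have hC := hA.hC
  have hR0 : 0 ≤ R := (norm_nonneg x₀).trans hRx
  have hM : 0 ≤ M := (abs_nonneg _).trans (hMU j₀ t₀ x₀)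
  have hN0 : 0 ≤ N := by rw [← hN]; exact measureReal_nonneg
  obtain ⟨j, t, s, x, y, a, a', c₀, c₀', p, p', X, X', ht, hs, hx, hy, hmax, haa, hp, hp', hX, hX',
    hjet, hjet', hXX⟩ := exists_jets_of_families hA.hT.le (by linarith : 0 ≤ R + C + 1)
      (by omega : 0 < J) hu hv (w := 1 + μ) (by linarith) β hκ hδ hρ
  have h1 := hmax j₀ t₀ ht₀ t₀ ht₀ x₀ x₀ (by linarith) (by linarith)
  rw [sub_self, sub_self, norm_zero, zero_pow two_ne_zero, zero_div, zero_div, add_zero,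
    sub_zero] at h1
  have hQ1 : 0 ≤ (t - s) ^ 2 / (2 * κ) := by positivity
  have hQ2 : 0 ≤ ‖x - y‖ ^ 2 / (2 * δ) := by positivity
  obtain ⟨hbx, hby, hts, hxy, hwUV, hUV⟩ := near_max_estimates hβ.le hμ.le (logPen_nonneg x)
    (logPen_nonneg y) hQ1 hQ2 (hMU j t x) (hMV j s y) (hMU j₀ t₀ x₀) hθ hθ0.le hμθ hρθ hβx h1
  have hxR := hRβ x hbx
  have hyR := hRβ y hby
  have hts' : |t - s| ≤ r₂ := abs_le_of_sq_div_le hκ hr₂ hts hκr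
  have hxy' : ‖x - y‖ ≤ r := by
    simpa using abs_le_of_sq_div_le hδ hr hxy hδr
  obtain ⟨hd1, hd2, hd3⟩ := hdiag t ht s hs x y hx hy (hts'.trans hr₂r) hxy'
  have ht0 : t ∈ Ioc (0:ℝ) T := ⟨lt_of_le_of_ne ht.1 fun h =>
    absurd (hd2 j (Or.inl h.symm)) (not_lt.2 hUV), ht.2⟩
  have hs0 : s ∈ Ioc (0:ℝ) T := ⟨lt_of_le_of_ne hs.1 fun h =>
    absurd (hd2 j (Or.inr h.symm)) (not_lt.2 hUV), hs.2⟩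
  rw [nhdsWithin_prod_closedBall_eq (by linarith)] at hjet hjet'
  obtain ⟨hVζ, hVsw, -⟩ := hV.le_of_jet (j := j) hA hε hαs hMV hv hs0 hX' hjet' rfl
  have hsw : MaxSw U c j t x < U j t x := by
    by_contra hcon
    obtain ⟨k, hk1, hk2⟩ := exists_mul_le_of_le_MaxSw hJ (not_lt.1 hcon) hVsw
    have h2 := hmax k t ht s hs x y hx hy
    have h3 : (1 + μ) * (U j t x + c) ≤ (1 + μ) * U k t x :=
      mul_le_mul_of_nonneg_left (by linarith) (by linarith)
    linarith
  have hpen : ‖x - y‖ ^ 2 / δ ≤ 6 * ϖ := by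
    obtain ⟨k, tk, htk, xk, hxk, hk⟩ := hM₀
    have h2 := hmax k tk htk tk htk xk xk hxk hxk
    rw [sub_self, sub_self, norm_zero, zero_pow two_ne_zero, zero_div, zero_div, add_zero,
      sub_zero] at h2
    have h3 := hd1 j
    have h4 : μ * U j t x ≤ μ * M := mul_le_mul_of_nonneg_left (abs_le.1 (hMU j t x)).2 hμ.le
    have h5 : μ * -M ≤ μ * U k tk xk :=
      mul_le_mul_of_nonneg_left (abs_le.1 (hMU k tk xk)).1 hμ.le
    have h6 : ‖x - y‖ ^ 2 / δ = 2 * (‖x - y‖ ^ 2 / (2 * δ)) := by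
      field_simp
    rw [h6]
    linarith
  have hLr : 0 ≤ L * (1 + R) := by positivity
  have hqq : L * (1 + R) * (‖x - y‖ / δ + ρ) + 4 * β * L ≤ q := by
    refine le_trans ?_ hq
    gcongr
  have hfin := hA.sub_le_of_jets hε hαs hU hV hMU hMV hu hv ht0 hs0 (by linarith) hsw hμ.le hβ.le hδ
    hρ.le hL.le hN hxR hyR (hxy'.trans hr1) (hcoef j x y).1 (hcoef j x y).2.1 (hcoef j y x).2.1
    (hcoef j x y).2.2.1 (hcoef j x y).2.2.2 (hcoef j y x).2.2.2 (neg_le_of_abs_le haa) hp hp' hX hX'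
    hXX hjet hjet' (fun x' y' hx' hy' => by
      have h2 := hmax j t ht s hs x' y'
        (by linarith [norm_le_norm_add_norm_sub' x' x])
        (by linarith [norm_le_norm_add_norm_sub' y' y])
      linarith) (by linarith) hqq
    (fun Q k hQ => hf (αs j) (hαs j) t ht x y _ Q k hxR hyR ((hMV j s y).trans hRM)
      (mul_one_add_norm_le hδ (norm_nonneg _) hxy' hL.le hLr hβ.le hρ1 hpen hr₁r hϖr hr₁ hQ))
    (fun Q k hQ hk => hτ j t ht s hs hts' y _ Q k hyR ((hMV j s y).trans hRM) hQ hk)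
  have e1 := (mul_le_mul_of_nonneg_left hpen (by positivity :
    0 ≤ L ^ 2 + L + N * (C ^ 2 / 2) + C * L + C ^ 2 * N * (C + C ^ 2 / 2))).trans hϖK
  have e2 := (mul_le_mul_of_nonneg_left hxy' (by positivity :
    0 ≤ 2 * M * C ^ 2 * N)).trans hrK
  have e3 := mul_le_mul_of_nonneg_left hwUV hC.le
  have e4 : 0 < C * θ := mul_pos hC hθ0
  have e5 : C * (5 * θ / 8) = 10 * (C * θ / 16) := by ring
  linarith only [hfin, e1, e2, e3, e4, e5, hβK, hμK, hρK]

end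

/-- The penalised differences of two finite families of semicontinuous functions attain their
maximum. -/
lemma exists_max_penalised_difference {T R : ℝ} (hT : 0 ≤ T) (hR : 0 ≤ R) {J : ℕ} (j₀ : Fin J)
    {U V : Fin J → ℝ → Vec d → ℝ}
    (hu : ∀ j, UpperSemicontinuousOn (fun p : ℝ × Vec d => U j p.1 p.2) (Icc 0 T ×ˢ univ))
    (hv : ∀ j, LowerSemicontinuousOn (fun p : ℝ × Vec d => V j p.1 p.2) (Icc 0 T ×ˢ univ))
    (β : ℝ) :
    ∃ M₀, (∀ k, ∀ t ∈ Icc (0:ℝ) T, ∀ x : Vec d, ‖x‖ ≤ R →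
        U k t x - V k t x - (β * logPen x + β * logPen x) ≤ M₀) ∧
      ∃ k, ∃ t ∈ Icc (0:ℝ) T, ∃ x : Vec d, ‖x‖ ≤ R ∧
        M₀ ≤ U k t x - V k t x - (β * logPen x + β * logPen x) := by
  have hS : IsCompact (Icc 0 T ×ˢ closedBall (0 : Vec d) R) :=
    isCompact_Icc.prod (isCompact_closedBall _ _)
  have hne : (Icc 0 T ×ˢ closedBall (0 : Vec d) R).Nonempty :=
    ⟨(0, 0), ⟨le_rfl, hT⟩, by simpa using hR⟩
  have hsub : Icc 0 T ×ˢ closedBall (0 : Vec d) R ⊆ Icc 0 T ×ˢ univ :=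
    prod_mono_right (subset_univ _)
  have hpen : Continuous fun p : ℝ × Vec d => -(β * logPen p.2 + β * logPen p.2) := by
    have := contDiff_logPen (d := d) |>.continuous
    fun_prop
  have key : ∀ k, ∃ z ∈ Icc 0 T ×ˢ closedBall (0 : Vec d) R,
      IsMaxOn (fun p : ℝ × Vec d => U k p.1 p.2 + -V k p.1 p.2
        + -(β * logPen p.2 + β * logPen p.2)) (Icc 0 T ×ˢ closedBall (0 : Vec d) R) z := fun k =>
    ((((hu k).mono hsub).add ((hv k).mono hsub).neg).add
      hpen.continuousOn.upperSemicontinuousOn).exists_isMaxOn hne hS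
  choose z hz hmax using key
  have : Nonempty (Fin J) := ⟨j₀⟩
  obtain ⟨k, hk⟩ := Finite.exists_max fun k => U k (z k).1 (z k).2 + -V k (z k).1 (z k).2
    + -(β * logPen (z k).2 + β * logPen (z k).2)
  refine ⟨_, fun j t ht x hx => ?_, k, (z k).1, (hz k).1, (z k).2, by simpa using (hz k).2, le_rfl⟩
  have h1 : U j t x + -V j t x + -(β * logPen x + β * logPen x) ≤ _ :=
    hmax j (show (t, x) ∈ Icc 0 T ×ˢ closedBall (0 : Vec d) R from ⟨ht, by simpa using hx⟩)
  have h2 := h1.trans (hk j)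
  linarith

/-- Comparison principle for the obstacle problem for switching
systems (Theorem 3.2 of the paper). -/
theorem comparison_principle_switching
    {n d m J : ℕ} (ν : Measure (Vec n)) (A : Set (Vec m)) (T : ℝ)
    (b : Vec m → Vec d → Vec d) (σ : Vec m → Vec d → Matrix (Fin d) (Fin d) ℝ)
    (η : Vec m → Vec d → Vec n → Vec d) (γ : Vec d → Vec n → ℝ)
    (f : Vec m → ℝ → Vec d → ℝ → Vec d → ℝ → ℝ)
    (ζ : ℝ → Vec d → ℝ) (g : Vec d → ℝ) (C : ℝ)
    (hA : AssumptionA ν A T b σ η γ f ζ g C)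
    (ε : ℝ) (hε : ε ∈ Ioo (0:ℝ) 1)
    (hJ : 2 ≤ J) (αs : Fin J → Vec m) (hαs : ∀ j, αs j ∈ A)
    (c : ℝ) (hc : 0 < c)
    (U V : Fin J → ℝ → Vec d → ℝ)
    (hU_bdd : ∃ M, ∀ j t x, |U j t x| ≤ M)
    (hV_bdd : ∃ M, ∀ j t x, |V j t x| ≤ M)
    (hU_usc : ∀ j, UpperSemicontinuousOn (fun p : ℝ × Vec d => U j p.1 p.2) (Icc 0 T ×ˢ univ))
    (hV_lsc : ∀ j, LowerSemicontinuousOn (fun p : ℝ × Vec d => V j p.1 p.2) (Icc 0 T ×ˢ univ))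
    (hU_sub : SubsolnSwitch ν T b σ η γ f ζ ε αs c U)
    (hV_super : SupersolnSwitch ν T b σ η γ f ζ ε αs c V)
    (h0 : ∀ j x, U j 0 x ≤ V j 0 x) :
    ∀ j, ∀ t ∈ Icc (0:ℝ) T, ∀ x, U j t x ≤ V j t x := by
  intro j₀ t₀ ht₀ x₀
  by_contra! hlt
  obtain ⟨M₁, hM₁⟩ := hU_bdd
  obtain ⟨M₂, hM₂⟩ := hV_bdd
  obtain ⟨M, hMU, hMV⟩ : ∃ M, (∀ j t x, |U j t x| ≤ M) ∧ ∀ j t x, |V j t x| ≤ M :=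
    ⟨max M₁ M₂, fun j t x => (hM₁ j t x).trans (le_max_left _ _),
      fun j t x => (hM₂ j t x).trans (le_max_right _ _)⟩
  have hC := hA.hC
  have hM : 0 ≤ M := (abs_nonneg _).trans (hMU j₀ t₀ x₀)
  obtain ⟨L, hL, hcoef⟩ := hA.exists_coefficient_bound ε hαs
  obtain ⟨N, hN⟩ : ∃ N, (ν.restrict {e : Vec n | ε < ‖e‖}).real univ = N := ⟨_, rfl⟩
  obtain ⟨θ, hθ0, hθ⟩ : ∃ θ, 0 < θ ∧ θ ≤ U j₀ t₀ x₀ - V j₀ t₀ x₀ := ⟨_, sub_pos.2 hlt, le_rfl⟩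
  have hCθ : 0 < C * θ / 16 := by positivity
  have hθ8 : 0 < θ / 8 := by positivity
  obtain ⟨β, ⟨hβK, hβx⟩, hβ⟩ := (((eventually_mul_le_of_pos
    (12 * L ^ 2 + 8 * L + 4 * N * C + 10 * C * L + 2 * C ^ 3 * N) hCθ).and
    (eventually_mul_le_of_pos (2 * logPen x₀) hθ8)).and self_mem_nhdsWithin).exists
  replace hβ : 0 < β := hβ
  obtain ⟨R, hR, hRx, hRM, hRβ⟩ : ∃ R, 0 < R ∧ ‖x₀‖ ≤ R ∧ M ≤ R ∧
      ∀ x : Vec d, β * logPen x ≤ 2 * M + θ → ‖x‖ ≤ R := by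
    have hE := Real.exp_pos ((2 * M + θ) / β)
    have hx := norm_nonneg x₀
    exact ⟨‖x₀‖ + M + Real.exp ((2 * M + θ) / β), by linarith, by linarith, by linarith,
      fun x h => (norm_le_of_mul_logPen_le hβ h).trans (by linarith)⟩
  obtain ⟨mR, hmc, hm0, -, hmR⟩ := hA.hf_x R hR
  obtain ⟨r₁, hr₁, hr₁m⟩ : ∃ r₁ > 0, ∀ s, 0 ≤ s → s ≤ r₁ → mR s ≤ C * θ / 16 := by
    have h : ∀ᶠ s in 𝓝 0, mR s < C * θ / 16 :=
      (hmc.tendsto 0).eventually (gt_mem_nhds (by rw [hm0]; exact hCθ))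
    obtain ⟨r, hr, h⟩ := Metric.eventually_nhds_iff.1 h
    refine ⟨r / 2, by positivity, fun s hs hsr => (h ?_).le⟩
    rw [Real.dist_eq, sub_zero, abs_of_nonneg hs]
    linarith
  have hr₁4 : 0 < r₁ / 4 := by positivity
  obtain ⟨ϖ, ⟨hϖK, hϖr⟩, hϖ⟩ := (((eventually_mul_le_of_pos
    ((L ^ 2 + L + N * (C ^ 2 / 2) + C * L + C ^ 2 * N * (C + C ^ 2 / 2)) * 6) hCθ).and
    (eventually_mul_le_of_pos (L * (1 + R) * 6) hr₁4)).and self_mem_nhdsWithin).exists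
  replace hϖ : 0 < ϖ := hϖ
  obtain ⟨M₀, hM₀, hM₀'⟩ := exists_max_penalised_difference hA.hT.le
    (by linarith : 0 ≤ R + C + 1) j₀ hU_usc hV_lsc β
  obtain ⟨r, ⟨⟨⟨hdiag, hr₁r⟩, hrK⟩, hr1⟩, hr⟩ := ((((hA.eventually_near_diagonal hU_usc hV_lsc h0
    hϖ hθ0 hM₀).and (eventually_mul_le_of_pos (1 + 4 * β * L + L * (1 + R)) hr₁4)).and
    (eventually_mul_le_of_pos (2 * M * C ^ 2 * N) hCθ)).and
    (eventually_mul_le_of_pos 1 one_pos)).and self_mem_nhdsWithin |>.exists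
  replace hr : 0 < r := hr
  obtain ⟨δ, hδr, hδ⟩ := ((eventually_mul_le_of_pos (2 * (2 * M + θ))
    (by positivity : 0 < r ^ 2)).and self_mem_nhdsWithin).exists
  replace hδ : 0 < δ := hδ
  obtain ⟨r₃, hr₃, hτ⟩ := hA.exists_time_modulus hαs hR
    (L * (1 + R) * (r / δ + 1) + 4 * β * L) (2 * M * C * N) hCθ
  have hr₂ : 0 < min r r₃ := lt_min hr hr₃
  obtain ⟨κ, hκr, hκ⟩ := ((eventually_mul_le_of_pos (2 * (2 * M + θ))
    (by positivity : 0 < min r r₃ ^ 2)).and self_mem_nhdsWithin).exists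
  replace hκ : 0 < κ := hκ
  obtain ⟨μ, ⟨⟨hμθ, hμϖ⟩, hμK⟩, hμ⟩ := ((((eventually_mul_le_of_pos M hθ8).and
    (eventually_mul_le_of_pos M (half_pos hϖ))).and (eventually_mul_le_of_pos
    (C + 2 * C * (M + (L * (1 + R) * (r / δ + 1) + 4 * β * L) + 2 * M * C * N)) hCθ)).and
    self_mem_nhdsWithin).exists
  replace hμ : 0 < μ := hμ
  obtain ⟨ρ, ⟨⟨⟨⟨hρ1, hρθ⟩, hρϖ⟩, hρc⟩, hρK⟩, hρ⟩ := ((((((eventually_mul_le_of_pos 1 one_pos).and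
    (eventually_mul_le_of_pos 1 hθ8)).and (eventually_mul_le_of_pos 1 hϖ)).and
    (eventually_mul_le_of_pos 2 (mul_pos hμ hc))).and (eventually_mul_le_of_pos
    (1 + (L * (1 + R)) ^ 2 + 2 * L * (1 + R) + N * (1 + 2 * C) + C * L
      + 2 * C * L * (1 + R) + C ^ 2 * N) hCθ)).and
    self_mem_nhdsWithin).exists
  replace hρ : 0 < ρ := hρ
  rw [one_mul] at hr1 hρ1 hρθ hρϖ
  exact hA.false_of_parameters hε hJ hαs hU_sub hV_super hMU hMV hU_usc hV_lsc hL hcoef hN hθ0 ht₀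
    hθ hβ hβK (by linarith) hRx hRM hRβ hr₁.le
    (fun α hα t ht x x' u p k hx hx' hu h => (hmR α hα t ht x x' u p k hx hx' hu).trans
      (hr₁m _ (by positivity) h))
    (by linarith) (by linarith) hM₀' hr.le hr1 hdiag hr₁r hrK hδ (by linarith) hr₂.le
    (min_le_left _ _) le_rfl
    (fun j t ht s hs hts => hτ j t ht s hs (hts.trans (min_le_right _ _)))
    hκ (by linarith) hμ (by linarith) (by linarith) hμK hρ hρ1 hρθ hρϖ (by linarith) hρK
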